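/- Let Δ = (T, 𝒮, ℬ) be a strong triangle blocking arrangement with vertices x₁, x₂, x₃ of T. Suppose there are vertices a₁ ∈ x₁x₂, a₂, b₁ ∈ x₁x₃, b₂ ∈ x₂x₃ such that a₁a₂ and b₁b₂ are proper initial segments intersecting at a point c. Let Q be the quadrilateral 𝒮̄-region with vertices a₁, c, b₂, x₂, bounded by the subsegment a₁c of a₁a₂, the subsegment cb₂ of b₁b₂, the subsegment b₂x₂ of x₂x₃ and the subsegment x₂a₁ of x₁x₂, and let Q' be the triangular 𝒮̄-region with vertices c, b₁, a₂, bounded by the subsegment cb₁ of b₁b₂, the subsegment ca₂ of a₁a₂ and the subsegment b₁a₂ of x₁x₃. Then: in Q, the vertices c and x₂ are externally blocked and the vertices a₁ and b₂ are internally blocked; no blocking segment passes through x₁ and no blocking segment passes through x₃; and in Q', the vertices a₂ and b₁ are externally blocked. -/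

import Mathlib

open Set

noncomputable section

/-- Points of the real plane. -/
abbrev Pt := ℝ × ℝ

/-- The boundary of the triangle with vertices `x1`, `x2`, `x3`:
the union of its three edges. -/
def triBdry (x1 x2 x3 : Pt) : Set Pt :=
  segment ℝ x1 x2 ∪ segment ℝ x2 x3 ∪ segment ℝ x3 x1

/-- The three edges of the triangle with vertices `x1`, `x2`, `x3`. -/
def triEdges (x1 x2 x3 : Pt) : Set (Set Pt) :=
  {segment ℝ x1 x2, segment ℝ x2 x3, segment ℝ x3 x1}

/-- A triangle blocking arrangement: a nondegenerate triangle `x1 x2 x3` together with two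
finite collections `S` (proper initial segments) and `B` (blocking segments) of closed
segments with endpoints on the boundary of the triangle and no interior point on the
boundary, satisfying the intersection conditions (i) and (ii). `S ∪ triEdges x1 x2 x3`
is the collection of initial segments `𝒮̄`. -/
structure TBA where
  x1 : Pt
  x2 : Pt
  x3 : Pt
  S : Set (Set Pt)
  B : Set (Set Pt)
  indep : AffineIndependent ℝ ![x1, x2, x3]
  finS : S.Finite
  finB : B.Finite
  seg_wf : ∀ s ∈ S ∪ B, ∃ a b : Pt, a ≠ b ∧ s = segment ℝ a b ∧
    a ∈ triBdry x1 x2 x3 ∧ b ∈ triBdry x1 x2 x3 ∧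
    ∀ p ∈ openSegment ℝ a b, p ∉ triBdry x1 x2 x3
  /- (i) no three initial segments are concurrent … -/
  no_three_concurrent : ∀ s₁ ∈ S ∪ triEdges x1 x2 x3, ∀ s₂ ∈ S ∪ triEdges x1 x2 x3,
    ∀ s₃ ∈ S ∪ triEdges x1 x2 x3, s₁ ≠ s₂ → s₁ ≠ s₃ → s₂ ≠ s₃ →
    ¬ ∃ p : Pt, p ∈ s₁ ∧ p ∈ s₂ ∧ p ∈ s₃
  /- … and through every intersection point of two initial segments, not both edges,
  there is a unique blocking segment … -/
  block_exists : ∀ s₁ ∈ S ∪ triEdges x1 x2 x3, ∀ s₂ ∈ S ∪ triEdges x1 x2 x3, s₁ ≠ s₂ →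
    ¬ (s₁ ∈ triEdges x1 x2 x3 ∧ s₂ ∈ triEdges x1 x2 x3) →
    ∀ p : Pt, p ∈ s₁ → p ∈ s₂ → ∃! b, b ∈ B ∧ p ∈ b
  /- … while through an intersection point of two edges there is at most one
  blocking segment. -/
  block_unique : ∀ s₁ ∈ S ∪ triEdges x1 x2 x3, ∀ s₂ ∈ S ∪ triEdges x1 x2 x3, s₁ ≠ s₂ →
    ∀ p : Pt, p ∈ s₁ → p ∈ s₂ → ∀ b₁ ∈ B, ∀ b₂ ∈ B, p ∈ b₁ → p ∈ b₂ → b₁ = b₂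
  /- (ii) through every intersection point of an initial segment and a blocking segment
  there is a unique second initial segment. -/
  second_segment : ∀ s ∈ S ∪ triEdges x1 x2 x3, ∀ b ∈ B, ∀ p : Pt, p ∈ s → p ∈ b →
    ∃! s', s' ∈ S ∪ triEdges x1 x2 x3 ∧ s' ≠ s ∧ p ∈ s'

namespace TBA

variable (Δ : TBA)

/-- The collection `𝒮̄` of initial segments. -/
def Sbar : Set (Set Pt) := Δ.S ∪ triEdges Δ.x1 Δ.x2 Δ.x3

/-- The (closed) triangle `T`. -/
def tri : Set Pt := convexHull ℝ {Δ.x1, Δ.x2, Δ.x3}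

/-- The boundary `∂T`. -/
def bdry : Set Pt := triBdry Δ.x1 Δ.x2 Δ.x3

/-- A vertex of the arrangement: an intersection point of two initial segments. -/
def IsVertex (p : Pt) : Prop :=
  ∃ s₁ ∈ Δ.Sbar, ∃ s₂ ∈ Δ.Sbar, s₁ ≠ s₂ ∧ p ∈ s₁ ∧ p ∈ s₂

/-- The segment `xy` is minimal if no vertex of the arrangement lies in its interior. -/
def MinimalSeg (x y : Pt) : Prop :=
  ∀ p ∈ openSegment ℝ x y, ¬ Δ.IsVertex p

/-- An `𝒮̄`-region: the closure of a connected component of `T \ ⋃ L` for some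
subset `L` of `𝒮̄`. -/
def IsRegion (R : Set Pt) : Prop :=
  ∃ L ⊆ Δ.Sbar, ∃ p ∈ Δ.tri \ ⋃₀ L,
    R = closure (connectedComponentIn (Δ.tri \ ⋃₀ L) p)

/-- A minimal `𝒮̄`-region: the closure of a connected component of `T \ ⋃ 𝒮̄`. -/
def IsMinRegion (R : Set Pt) : Prop :=
  ∃ p ∈ Δ.tri \ ⋃₀ Δ.Sbar,
    R = closure (connectedComponentIn (Δ.tri \ ⋃₀ Δ.Sbar) p)

/-- The set `s` contains an edge of the region `R`: it contains a nondegenerate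
segment lying on the boundary of `R`. -/
def ContainsEdgeOf (_Δ : TBA) (s R : Set Pt) : Prop :=
  ∃ q₁ q₂ : Pt, q₁ ≠ q₂ ∧ segment ℝ q₁ q₂ ⊆ s ∩ frontier R

/-- A vertex of the region `R`: a point of `R` that is the intersection of two initial
segments, each containing an edge of `R`. -/
def IsRegionVertex (R : Set Pt) (p : Pt) : Prop :=
  p ∈ R ∧ ∃ s₁ ∈ Δ.Sbar, ∃ s₂ ∈ Δ.Sbar, s₁ ≠ s₂ ∧ p ∈ s₁ ∧ p ∈ s₂ ∧
    Δ.ContainsEdgeOf s₁ R ∧ Δ.ContainsEdgeOf s₂ R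

/-- A vertex `p` is internally blocked in the region `R` if the blocking segment
through `p` exists and meets the interior of `R`.  (Externally blocked means not
internally blocked.) -/
def InternallyBlocked (R : Set Pt) (p : Pt) : Prop :=
  ∃ b ∈ Δ.B, p ∈ b ∧ (b ∩ interior R).Nonempty

/-- Two consecutive vertices of a region `R`: distinct vertices joined by an edge
lying on the boundary of `R`. -/
def Consec (R : Set Pt) (u v : Pt) : Prop :=
  u ≠ v ∧ Δ.IsRegionVertex R u ∧ Δ.IsRegionVertex R v ∧ segment ℝ u v ⊆ frontier R

/-- Condition (A): the arrangement is strong when for every minimal `𝒮̄`-region `R` and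
consecutive vertices `v₁, v₂, v₃, v₄, v₅` in this order along `∂R`, if the line
`l(v₁v₂)` and the blocking segment `β(v₃)` intersect inside `T`, and `β(v₃)` meets the
interior of `R`, then `l(v₁v₂)`, `β(v₃)` and `l(v₄v₅)` are concurrent. -/
def Strong : Prop :=
  ∀ R : Set Pt, Δ.IsMinRegion R →
  ∀ v₁ v₂ v₃ v₄ v₅ : Pt, List.Pairwise (· ≠ ·) [v₁, v₂, v₃, v₄, v₅] →
    Δ.Consec R v₁ v₂ → Δ.Consec R v₂ v₃ → Δ.Consec R v₃ v₄ → Δ.Consec R v₄ v₅ →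
    ∀ b ∈ Δ.B, v₃ ∈ b → (b ∩ interior R).Nonempty →
    (∃ q ∈ Δ.tri, q ∈ affineSpan ℝ ({v₁, v₂} : Set Pt) ∧ q ∈ b) →
    ∃ q : Pt, q ∈ b ∧ q ∈ affineSpan ℝ ({v₁, v₂} : Set Pt) ∧
      q ∈ affineSpan ℝ ({v₄, v₅} : Set Pt)

end TBA

namespace TBA

/-- The cross product of `b - a` and `x - a`. -/
def cr (a b x : Pt) : ℝ := (b.1 - a.1) * (x.2 - a.2) - (b.2 - a.2) * (x.1 - a.1)

open Classical in
/-- An affine functional vanishing exactly on the line spanned by the segment `s`. -/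
def ln (s : Set Pt) (x : Pt) : ℝ :=
  if h : ∃ a b : Pt, a ≠ b ∧ s = segment ℝ a b then cr h.choose h.choose_spec.choose x else 0

/-- The point at parameter `t` on the line from `x` to `y`. -/
def mv (x y : Pt) (t : ℝ) : Pt := (x.1 + t * (y.1 - x.1), x.2 + t * (y.2 - x.2))

theorem ln_spec {s : Set Pt} (h : ∃ a b : Pt, a ≠ b ∧ s = segment ℝ a b) :
    ∃ a b : Pt, a ≠ b ∧ s = segment ℝ a b ∧ ∀ x, ln s x = cr a b x :=
  ⟨h.choose, h.choose_spec.choose, h.choose_spec.choose_spec.1, h.choose_spec.choose_spec.2,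
    fun x => by simp only [ln, dif_pos h]⟩

theorem ln_form (s : Set Pt) : ∃ A B C : ℝ, ∀ x, ln s x = A * x.1 + B * x.2 + C := by
  by_cases h : ∃ a b : Pt, a ≠ b ∧ s = segment ℝ a b
  · obtain ⟨a, b, -, -, hx⟩ := ln_spec h
    exact ⟨-(b.2 - a.2), b.1 - a.1, -(b.1 - a.1) * a.2 + (b.2 - a.2) * a.1,
      fun x => by rw [hx, cr]; ring⟩
  · exact ⟨0, 0, 0, fun x => by rw [ln, dif_neg h]; ring⟩

theorem ln_mv (s : Set Pt) (x y : Pt) (t : ℝ) :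
    ln s (mv x y t) = (1 - t) * ln s x + t * ln s y := by
  obtain ⟨A, B, C, h⟩ := ln_form s
  simp only [h, mv]; ring

@[simp] theorem mv_zero (x y : Pt) : mv x y 0 = x := by simp [mv]

@[simp] theorem mv_one (x y : Pt) : mv x y 1 = y := by simp [mv]

theorem mv_eq_smul (x y : Pt) (t : ℝ) : mv x y t = (1 - t) • x + t • y := by
  ext <;> simp [mv] <;> ring

theorem mem_seg {a b x : Pt} : x ∈ segment ℝ a b ↔ ∃ t : ℝ, 0 ≤ t ∧ t ≤ 1 ∧ x = mv a b t := by
  constructor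
  · rintro ⟨u, v, hu, hv, huv, rfl⟩
    refine ⟨v, hv, by linarith, ?_⟩
    rw [mv_eq_smul, ← huv]; simp
  · rintro ⟨t, h0, h1, rfl⟩
    exact ⟨1 - t, t, by linarith, h0, by ring, (mv_eq_smul _ _ _).symm⟩

theorem mem_openSeg {a b x : Pt} :
    x ∈ openSegment ℝ a b ↔ ∃ t : ℝ, 0 < t ∧ t < 1 ∧ x = mv a b t := by
  constructor
  · rintro ⟨u, v, hu, hv, huv, rfl⟩
    refine ⟨v, hv, by linarith, ?_⟩
    rw [mv_eq_smul, ← huv]; simp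
  · rintro ⟨t, h0, h1, rfl⟩
    exact ⟨1 - t, t, by linarith, h0, by ring, (mv_eq_smul _ _ _).symm⟩

theorem mv_mem {K : Set Pt} (hK : Convex ℝ K) {x y : Pt} (hx : x ∈ K) (hy : y ∈ K) {t : ℝ}
    (h0 : 0 ≤ t) (h1 : t ≤ 1) : mv x y t ∈ K :=
  hK.segment_subset hx hy (mem_seg.2 ⟨t, h0, h1, rfl⟩)

theorem mv_inj {x y : Pt} (h : x ≠ y) {t t' : ℝ} (e : mv x y t = mv x y t') : t = t' := by
  by_contra hn
  apply h
  have h1 := congrArg Prod.fst e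
  have h2 := congrArg Prod.snd e
  simp only [mv] at h1 h2
  have h1' : (t - t') * (y.1 - x.1) = 0 := by linarith
  have h2' : (t - t') * (y.2 - x.2) = 0 := by linarith
  have ht : t - t' ≠ 0 := sub_ne_zero.2 hn
  ext
  · have := (mul_eq_zero.1 h1').resolve_left ht; linarith
  · have := (mul_eq_zero.1 h2').resolve_left ht; linarith

theorem exists_mv_of_cr {a b x : Pt} (hab : a ≠ b) (h : cr a b x = 0) : ∃ t, x = mv a b t := by
  by_cases h1 : b.1 - a.1 = 0
  · have h2 : b.2 - a.2 ≠ 0 := by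
      intro h2; apply hab; ext <;> linarith
    refine ⟨(x.2 - a.2) / (b.2 - a.2), ?_⟩
    have h3 : x.1 - a.1 = 0 := by
      rw [cr, h1] at h
      have : (b.2 - a.2) * (x.1 - a.1) = 0 := by linarith
      exact (mul_eq_zero.1 this).resolve_left h2
    ext
    · simp only [mv, h1]; linarith
    · simp only [mv]; field_simp; ring
  · refine ⟨(x.1 - a.1) / (b.1 - a.1), ?_⟩
    rw [cr] at h
    ext
    · simp only [mv]; field_simp; ring
    · simp only [mv]; field_simp; linarith

theorem cr_mv (a b : Pt) (t : ℝ) : cr a b (mv a b t) = 0 := by simp only [cr, mv]; ring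

theorem cr_aff (a b x y : Pt) (t : ℝ) :
    cr a b (mv x y t) = (1 - t) * cr a b x + t * cr a b y := by simp only [cr, mv]; ring

/-- An affine functional vanishing at two distinct
points is a multiple of the cross product. -/
theorem form_eq_cr {A B C : ℝ} {a b : Pt} (hab : a ≠ b)
    (ha : A * a.1 + B * a.2 + C = 0) (hb : A * b.1 + B * b.2 + C = 0) :
    ∃ k : ℝ, ∀ x : Pt, A * x.1 + B * x.2 + C = k * cr a b x := by
  have e : A * (b.1 - a.1) + B * (b.2 - a.2) = 0 := by linarith
  by_cases h1 : b.1 - a.1 = 0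
  · have h2 : b.2 - a.2 ≠ 0 := by
      intro h2; apply hab; ext <;> linarith
    refine ⟨-A / (b.2 - a.2), fun x => ?_⟩
    have hB : B = 0 := by
      rw [h1] at e; simpa [h2] using e
    subst hB
    simp only [cr, h1]; field_simp; linear_combination (b.2 - a.2) * ha
  · refine ⟨B / (b.1 - a.1), fun x => ?_⟩
    have hA : A = - B * (b.2 - a.2) / (b.1 - a.1) := by field_simp; linarith
    have hC : C = - A * a.1 - B * a.2 := by linarith
    rw [hC, hA]; simp only [cr]; field_simp; ring

theorem ln_eq_cr {s : Set Pt} {a b : Pt} (hab : a ≠ b) (ha : ln s a = 0) (hb : ln s b = 0) :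
    ∃ k : ℝ, ∀ x : Pt, ln s x = k * cr a b x := by
  obtain ⟨A, B, C, h⟩ := ln_form s
  rw [h] at ha hb
  obtain ⟨k, hk⟩ := form_eq_cr hab ha hb
  exact ⟨k, fun x => by rw [h, hk]⟩

theorem cr_self_left (a b : Pt) : cr a b a = 0 := by simp [cr]

theorem cr_self_right (a b : Pt) : cr a b b = 0 := by simp only [cr]; ring

theorem cr_cyc (a b c : Pt) : cr b c a = cr a b c := by simp only [cr]; ring

theorem cr_swap (a b c : Pt) : cr b a c = - cr a b c := by simp only [cr]; ring

theorem cr_sum (X Y Z x : Pt) : cr X Y x + cr Y Z x + cr Z X x = cr X Y Z := by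
  simp only [cr]; ring

/-- `X`, `Y`, `Z` are the three corners of the triangle in some order. -/
structure Cor (Δ : TBA) (X Y Z : Pt) : Prop where
  ne : cr X Y Z ≠ 0
  edges : triEdges Δ.x1 Δ.x2 Δ.x3 = triEdges X Y Z
  bd : triBdry Δ.x1 Δ.x2 Δ.x3 = triBdry X Y Z
  tri : Δ.tri = convexHull ℝ {X, Y, Z}

variable {Δ : TBA} {X Y Z : Pt}

theorem Cor.rot (h : Cor Δ X Y Z) : Cor Δ Y Z X where
  ne := by rw [cr_cyc]; exact h.ne
  edges := by rw [h.edges]; ext s; simp only [triEdges, mem_insert_iff, mem_singleton_iff]; tauto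
  bd := by rw [h.bd]; ext s; simp only [triBdry, mem_union]; tauto
  tri := by rw [h.tri]; congr 1; ext s; simp only [mem_insert_iff, mem_singleton_iff]; tauto

theorem Cor.swap (h : Cor Δ X Y Z) : Cor Δ Y X Z where
  ne := by rw [cr_swap]; exact neg_ne_zero.2 h.ne
  edges := by
    rw [h.edges]; ext s
    simp only [triEdges, mem_insert_iff, mem_singleton_iff, segment_symm ℝ Y X,
      segment_symm ℝ X Z, segment_symm ℝ Z Y]; tauto
  bd := by
    rw [h.bd]; ext s
    simp only [triBdry, mem_union, segment_symm ℝ Y X, segment_symm ℝ X Z, segment_symm ℝ Z Y]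
    tauto
  tri := by rw [h.tri]; congr 1; ext s; simp only [mem_insert_iff, mem_singleton_iff]; tauto

theorem cor_base (Δ : TBA) : Cor Δ Δ.x1 Δ.x2 Δ.x3 where
  ne := by
    intro h
    have hi := affineIndependent_iff_not_collinear_set.1 Δ.indep
    apply hi
    by_cases h12 : Δ.x1 = Δ.x2
    · rw [h12]; simpa using collinear_pair ℝ Δ.x2 Δ.x3
    · obtain ⟨t, ht⟩ := exists_mv_of_cr h12 h
      rw [collinear_iff_of_mem (p₀ := Δ.x1) (by simp)]
      refine ⟨Δ.x2 - Δ.x1, ?_⟩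
      intro p hp
      simp only [mem_insert_iff, mem_singleton_iff] at hp
      rcases hp with rfl | rfl | rfl
      · exact ⟨0, by simp⟩
      · exact ⟨1, by simp⟩
      · refine ⟨t, ?_⟩
        rw [ht]; ext <;> simp [mv] <;> ring
  edges := rfl
  bd := rfl
  tri := rfl

theorem Cor.ne12 (h : Cor Δ X Y Z) : X ≠ Y := by
  rintro rfl; exact h.ne (by simp [cr])

theorem Cor.e12 (h : Cor Δ X Y Z) : segment ℝ X Y ∈ triEdges Δ.x1 Δ.x2 Δ.x3 := by
  rw [h.edges]; simp [triEdges]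

theorem Cor.b12 (h : Cor Δ X Y Z) : segment ℝ X Y ∈ Δ.Sbar := Or.inr h.e12

theorem Cor.mem_tri (h : Cor Δ X Y Z) : X ∈ Δ.tri := by
  rw [h.tri]; exact subset_convexHull _ _ (by simp)

theorem tri_convex (Δ : TBA) : Convex ℝ Δ.tri := convex_convexHull _ _

theorem cr_convex (a b : Pt) (k : ℝ) : Convex ℝ {x | 0 ≤ k * cr a b x} := by
  rw [convex_iff_segment_subset]
  intro x hx y hy z hz
  obtain ⟨t, h0, h1, rfl⟩ := mem_seg.1 hz
  simp only [mem_ofPred_eq] at *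
  rw [cr_aff]
  nlinarith [mul_nonneg (sub_nonneg.2 h1) hx, mul_nonneg h0 hy]

/-- Every point of the plane in barycentric coordinates. -/
theorem bary_eq {X Y Z : Pt} (h : cr X Y Z ≠ 0) (x : Pt) :
    x = (cr Y Z x / cr X Y Z) • X + (cr Z X x / cr X Y Z) • Y + (cr X Y x / cr X Y Z) • Z := by
  ext
  · simp only [Prod.fst_add, Prod.smul_fst, smul_eq_mul]; field_simp; simp only [cr]; ring
  · simp only [Prod.snd_add, Prod.smul_snd, smul_eq_mul]; field_simp; simp only [cr]; ring

theorem hull_cr {X Y Z : Pt} (hne : cr X Y Z ≠ 0) {x : Pt} : x ∈ convexHull ℝ {X, Y, Z} ↔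
    0 ≤ cr X Y Z * cr X Y x ∧ 0 ≤ cr X Y Z * cr Y Z x ∧ 0 ≤ cr X Y Z * cr Z X x := by
  constructor
  · intro hx
    refine ⟨?_, ?_, ?_⟩
    · refine (convexHull_min ?_ (cr_convex X Y (cr X Y Z))) hx
      rintro y (rfl | rfl | rfl)
      · simp [cr_self_left]
      · simp [cr_self_right]
      · simp only [mem_ofPred_eq]; exact mul_self_nonneg _
    · refine (convexHull_min ?_ (cr_convex Y Z (cr X Y Z))) hx
      rintro y (rfl | rfl | rfl)
      · simp only [mem_ofPred_eq, cr_cyc]; exact mul_self_nonneg _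
      · simp [cr_self_left]
      · simp [cr_self_right]
    · refine (convexHull_min ?_ (cr_convex Z X (cr X Y Z))) hx
      rintro y (rfl | rfl | rfl)
      · simp [cr_self_right]
      · simp only [mem_ofPred_eq, ← cr_cyc Z X y]; exact mul_self_nonneg _
      · simp [cr_self_left]
  · rintro ⟨h1, h2, h3⟩
    have hs := cr_sum X Y Z x
    have key : ∀ r, 0 ≤ cr X Y Z * r → 0 ≤ r / cr X Y Z := by
      intro r hr
      rw [div_eq_mul_inv]
      rcases lt_or_gt_of_ne hne with hlt | hgt
      · exact mul_nonneg_of_nonpos_of_nonpos (by nlinarith) (by simpa using hlt.le)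
      · exact mul_nonneg (by nlinarith) (by simpa using hgt.le)
    rw [bary_eq hne x]
    have hc := convex_convexHull ℝ ({X, Y, Z} : Set Pt)
    have hm : ∀ y ∈ ({X, Y, Z} : Set Pt), y ∈ convexHull ℝ ({X, Y, Z} : Set Pt) :=
      fun y hy => subset_convexHull _ _ hy
    have := hc.sum_mem (t := Finset.univ)
      (w := ![cr Y Z x / cr X Y Z, cr Z X x / cr X Y Z, cr X Y x / cr X Y Z])
      (z := ![X, Y, Z]) (by
        intro i _
        fin_cases i
        · exact key _ h2
        · exact key _ h3
        · exact key _ h1) (by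
        simp only [Fin.sum_univ_three, Matrix.cons_val]
        field_simp; linarith) (by
        intro i _
        fin_cases i <;> apply hm <;> simp)
    simpa [Fin.sum_univ_three] using this

theorem Cor.mem (h : Cor Δ X Y Z) {x : Pt} : x ∈ Δ.tri ↔
    0 ≤ cr X Y Z * cr X Y x ∧ 0 ≤ cr X Y Z * cr Y Z x ∧ 0 ≤ cr X Y Z * cr Z X x := by
  rw [h.tri, hull_cr h.ne]

end TBA

namespace TBA

variable {Δ : TBA} {X Y Z : Pt} {s t : Set Pt} {x y : Pt}

theorem mem_bdry : x ∈ Δ.bdry ↔ ∃ s ∈ triEdges Δ.x1 Δ.x2 Δ.x3, x ∈ s := by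
  simp only [bdry, triBdry, triEdges, mem_union, mem_insert_iff, mem_singleton_iff,
    exists_eq_or_imp, exists_eq_left]
  tauto

theorem edge_cor (h : s ∈ triEdges Δ.x1 Δ.x2 Δ.x3) :
    ∃ X Y Z, Cor Δ X Y Z ∧ s = segment ℝ X Y := by
  rcases h with rfl | rfl | rfl
  · exact ⟨_, _, _, cor_base Δ, rfl⟩
  · exact ⟨_, _, _, (cor_base Δ).rot, rfl⟩
  · exact ⟨_, _, _, (cor_base Δ).rot.rot, rfl⟩

theorem Cor.seg_sub (h : Cor Δ X Y Z) : segment ℝ X Y ⊆ Δ.tri :=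
  (tri_convex Δ).segment_subset h.mem_tri h.rot.mem_tri

theorem edge_sub (h : s ∈ triEdges Δ.x1 Δ.x2 Δ.x3) : s ⊆ Δ.tri := by
  obtain ⟨X, Y, Z, hc, rfl⟩ := edge_cor h
  exact hc.seg_sub

theorem bdry_sub : Δ.bdry ⊆ Δ.tri := by
  intro x hx
  obtain ⟨s, hs, hx⟩ := mem_bdry.1 hx
  exact edge_sub hs hx

theorem Cor.on_line (h : Cor Δ X Y Z) (hx : x ∈ Δ.tri) (h0 : cr X Y x = 0) :
    x ∈ segment ℝ X Y := by
  obtain ⟨t, rfl⟩ := exists_mv_of_cr h.ne12 h0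
  obtain ⟨-, h2, h3⟩ := h.mem.1 hx
  have e2 : cr Y Z (mv X Y t) = (1 - t) * cr X Y Z := by simp only [cr, mv]; ring
  have e3 : cr Z X (mv X Y t) = t * cr X Y Z := by simp only [cr, mv]; ring
  have hp : 0 < cr X Y Z * cr X Y Z := mul_self_pos.2 h.ne
  rw [e2] at h2; rw [e3] at h3
  exact mem_seg.2 ⟨t, by nlinarith, by nlinarith, rfl⟩

theorem Sbar_wf (h : s ∈ Δ.Sbar) : ∃ a b : Pt, a ≠ b ∧ s = segment ℝ a b := by
  rcases h with h | h
  · obtain ⟨a, b, hab, e, -⟩ := Δ.seg_wf s (Or.inl h); exact ⟨a, b, hab, e⟩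
  · obtain ⟨X, Y, Z, hc, rfl⟩ := edge_cor h
    exact ⟨X, Y, hc.ne12, rfl⟩

theorem ln_cr (h : s ∈ Δ.Sbar) :
    ∃ a b : Pt, a ≠ b ∧ s = segment ℝ a b ∧ ∀ x, ln s x = cr a b x := ln_spec (Sbar_wf h)

theorem ln_nonzero (h : s ∈ Δ.Sbar) : ∃ x, ln s x ≠ 0 := by
  obtain ⟨a, b, hab, -, he⟩ := ln_cr h
  refine ⟨(a.1 - (b.2 - a.2), a.2 + (b.1 - a.1)), ?_⟩
  rw [he]
  simp only [cr]
  intro h0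
  have h1 : (b.1 - a.1) = 0 := by nlinarith [sq_nonneg (b.1 - a.1), sq_nonneg (b.2 - a.2)]
  have h2 : (b.2 - a.2) = 0 := by nlinarith [sq_nonneg (b.1 - a.1), sq_nonneg (b.2 - a.2)]
  exact hab (by ext <;> linarith)

theorem ln_eq_cr' (hs : s ∈ Δ.Sbar) {a b : Pt} (hab : a ≠ b) (ha : ln s a = 0)
    (hb : ln s b = 0) : ∃ k : ℝ, k ≠ 0 ∧ ∀ x : Pt, ln s x = k * cr a b x := by
  obtain ⟨k, hk⟩ := ln_eq_cr hab ha hb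
  refine ⟨k, ?_, hk⟩
  rintro rfl
  obtain ⟨x, hx⟩ := ln_nonzero hs
  exact hx (by simp [hk])

theorem ln_of_mem (hs : s ∈ Δ.Sbar) (hx : x ∈ s) : ln s x = 0 := by
  obtain ⟨a, b, hab, rfl, he⟩ := ln_cr hs
  obtain ⟨t, -, -, rfl⟩ := mem_seg.1 hx
  rw [he, cr_mv]

theorem Cor.ln_edge (h : Cor Δ X Y Z) :
    ∃ k : ℝ, k ≠ 0 ∧ ∀ x : Pt, ln (segment ℝ X Y) x = k * cr X Y x :=
  ln_eq_cr' h.b12 h.ne12 (ln_of_mem h.b12 (left_mem_segment ℝ X Y))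
    (ln_of_mem h.b12 (right_mem_segment ℝ X Y))

/-- Edges do not separate points of the triangle. -/
theorem edge_sign (hs : s ∈ triEdges Δ.x1 Δ.x2 Δ.x3) (hx : x ∈ Δ.tri) (hy : y ∈ Δ.tri) :
    0 ≤ ln s x * ln s y := by
  obtain ⟨X, Y, Z, hc, rfl⟩ := edge_cor hs
  obtain ⟨k, hk, he⟩ := hc.ln_edge
  rw [he, he]
  have h1 := (hc.mem.1 hx).1
  have h2 := (hc.mem.1 hy).1
  have hp : 0 < cr X Y Z * cr X Y Z := mul_self_pos.2 hc.ne
  have hkk : 0 < k * k := mul_self_pos.2 hk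
  have h3 := mul_nonneg h1 h2
  have h4 : 0 ≤ cr X Y x * cr X Y y := by
    by_contra hn
    push Not at hn
    nlinarith [mul_pos_of_neg_of_neg (neg_neg_of_pos hp) hn]
  nlinarith [mul_nonneg hkk.le h4]

theorem S_sub (h : s ∈ Δ.S ∪ Δ.B) : s ⊆ Δ.tri := by
  obtain ⟨a, b, -, rfl, ha, hb, -⟩ := Δ.seg_wf s h
  exact (tri_convex Δ).segment_subset (bdry_sub ha) (bdry_sub hb)

theorem Sbar_sub (h : s ∈ Δ.Sbar) : s ⊆ Δ.tri := by
  rcases h with h | h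
  · exact S_sub (Or.inl h)
  · exact edge_sub h

theorem pos_of_mul {a b : ℝ} (h : a * b < 0) : (a < 0 ∧ 0 < b) ∨ (0 < a ∧ b < 0) := by
  rcases mul_neg_iff.1 h with h | h
  · exact Or.inr h
  · exact Or.inl h

/-- A segment of `S` is not contained in the line of an edge. -/
theorem S_not_edge (hs : s ∈ Δ.S ∪ Δ.B) (ht : t ∈ triEdges Δ.x1 Δ.x2 Δ.x3) : ¬ s ⊆ t := by
  intro hst
  obtain ⟨a, b, hab, rfl, ha, hb, hn⟩ := Δ.seg_wf s hs
  refine hn (mv a b (1/2)) (mem_openSeg.2 ⟨1/2, by norm_num, by norm_num, rfl⟩) ?_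
  exact mem_bdry.2 ⟨t, ht, hst (mem_seg.2 ⟨1/2, by norm_num, by norm_num, rfl⟩)⟩

theorem S_ne_edge (hs : s ∈ Δ.S) (ht : t ∈ triEdges Δ.x1 Δ.x2 Δ.x3) : s ≠ t := by
  rintro rfl
  exact S_not_edge (Or.inl hs) ht le_rfl

theorem edge_convex (ht : t ∈ triEdges Δ.x1 Δ.x2 Δ.x3) : Convex ℝ t := by
  obtain ⟨X, Y, Z, hc, rfl⟩ := edge_cor ht; exact convex_segment _ _

theorem mem_edge (ht : t ∈ triEdges Δ.x1 Δ.x2 Δ.x3) (hx : x ∈ Δ.tri) (h0 : ln t x = 0) :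
    x ∈ t := by
  obtain ⟨X, Y, Z, hc, rfl⟩ := edge_cor ht
  obtain ⟨k, hk, he⟩ := hc.ln_edge
  rw [he] at h0
  exact hc.on_line hx ((mul_eq_zero.1 h0).resolve_left hk)

theorem mv_beyond {f a b : ℝ} (r : ℝ) (hb : b = 0) (hr : 1 < r) (ha : 0 ≤ a * f)
    (hx : (1 - r) * f + r * b = a) : f = 0 := by
  subst hb
  have : a = (1 - r) * f := by linarith
  rw [this] at ha
  by_contra hf
  have : 0 < f * f := mul_self_pos.2 hf
  nlinarith

theorem mem_iff_S (hs : s ∈ Δ.S ∪ Δ.B) {a b : Pt} (e : s = segment ℝ a b)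
    (ha : a ∈ Δ.bdry) (hb : b ∈ Δ.bdry) {r : ℝ} (hx : mv a b r ∈ Δ.tri) : r ≤ 1 := by
  by_contra hr
  push Not at hr
  obtain ⟨κ, hκ, hbκ⟩ := mem_bdry.1 hb
  have h0 : ln κ b = 0 := ln_of_mem (Or.inr hκ) hbκ
  have hsg := edge_sign hκ hx (bdry_sub ha)
  have : ln κ a = 0 := mv_beyond (a := ln κ (mv a b r)) r h0 hr hsg (ln_mv _ _ _ _).symm
  have haκ := mem_edge hκ (bdry_sub ha) this
  exact S_not_edge hs hκ (e ▸ (edge_convex hκ).segment_subset haκ hbκ)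

theorem mv_symm (a b : Pt) (r : ℝ) : mv a b r = mv b a (1 - r) := by
  ext <;> simp only [mv] <;> ring

theorem mem_of_ln (hs : s ∈ Δ.Sbar) (hx : x ∈ Δ.tri) (h0 : ln s x = 0) : x ∈ s := by
  rcases hs with hs | hs
  · obtain ⟨a, b, hab, e, ha, hb, -⟩ := Δ.seg_wf s (Or.inl hs)
    obtain ⟨k, hk, he⟩ := ln_eq_cr' (Or.inl hs) hab
      (ln_of_mem (Or.inl hs) (e ▸ left_mem_segment ℝ a b))
      (ln_of_mem (Or.inl hs) (e ▸ right_mem_segment ℝ a b))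
    rw [he] at h0
    obtain ⟨r, rfl⟩ := exists_mv_of_cr hab ((mul_eq_zero.1 h0).resolve_left hk)
    have h1 := mem_iff_S (Or.inl hs) e ha hb hx
    rw [mv_symm] at hx
    have h2 := mem_iff_S (Or.inl hs) (e.trans (segment_symm ℝ a b)) hb ha hx
    rw [e]
    exact mem_seg.2 ⟨r, by linarith, h1, rfl⟩
  · exact mem_edge hs hx h0

theorem Sbar_eq_of_two (hs : s ∈ Δ.Sbar) (ht : t ∈ Δ.Sbar) (hxy : x ≠ y)
    (hx : x ∈ s) (hx' : x ∈ t) (hy : y ∈ s) (hy' : y ∈ t) : s = t := by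
  obtain ⟨k, hk, e⟩ := ln_eq_cr' hs hxy (ln_of_mem hs hx) (ln_of_mem hs hy)
  obtain ⟨k', hk', e'⟩ := ln_eq_cr' ht hxy (ln_of_mem ht hx') (ln_of_mem ht hy')
  ext z
  constructor
  · intro hz
    refine mem_of_ln ht (Sbar_sub hs hz) ?_
    have := ln_of_mem hs hz
    rw [e] at this
    rw [e', (mul_eq_zero.1 this).resolve_left hk, mul_zero]
  · intro hz
    refine mem_of_ln hs (Sbar_sub ht hz) ?_
    have := ln_of_mem ht hz
    rw [e'] at this
    rw [e, (mul_eq_zero.1 this).resolve_left hk', mul_zero]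

theorem inter_unique (hs : s ∈ Δ.Sbar) (ht : t ∈ Δ.Sbar) (hst : s ≠ t)
    (hx : x ∈ s) (hx' : x ∈ t) (hy : y ∈ s) (hy' : y ∈ t) : x = y := by
  by_contra h
  exact hst (Sbar_eq_of_two hs ht h hx hx' hy hy')

theorem three (hs : s ∈ Δ.Sbar) (ht : t ∈ Δ.Sbar) (hst : s ≠ t) (hx : x ∈ s) (hx' : x ∈ t)
    {r : Set Pt} (hr : r ∈ Δ.Sbar) (hxr : x ∈ r) : r = s ∨ r = t := by
  by_contra h
  push Not at h
  exact Δ.no_three_concurrent s hs t ht r hr hst h.1.symm h.2.symm ⟨x, hx, hx', hxr⟩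

theorem Sbar_fin (Δ : TBA) : Δ.Sbar.Finite :=
  Δ.finS.union (by simp [triEdges])

theorem S_of_sep (hs : s ∈ Δ.Sbar) (hx : x ∈ Δ.tri) (hy : y ∈ Δ.tri) (h : ln s x * ln s y < 0) :
    s ∈ Δ.S := by
  rcases hs with hs | hs
  · exact hs
  · exact absurd (edge_sign hs hx hy) (not_le.2 h)

theorem Cor.edge_ne (h : Cor Δ X Y Z) : segment ℝ X Y ≠ segment ℝ X Z := by
  intro e
  have hz : Z ∈ segment ℝ X Y := e ▸ right_mem_segment ℝ X Z
  obtain ⟨t, -, -, rfl⟩ := mem_seg.1 hz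
  exact h.ne (cr_mv _ _ _)

theorem Cor.perm (h : Cor Δ X Y Z) : Cor Δ Y X Z ∧ Cor Δ Z Y X ∧ Cor Δ X Z Y ∧ Cor Δ Y Z X ∧
    Cor Δ Z X Y :=
  ⟨h.swap, h.rot.swap.rot.rot.rot, h.swap.rot, h.rot, h.rot.rot⟩

theorem Cor.not_mem (h : Cor Δ X Y Z) (hs : s ∈ Δ.S) : X ∉ s := by
  intro hX
  have h1 := h.b12
  have h2 := h.perm.2.2.1.b12
  rcases three h1 h2 h.edge_ne (left_mem_segment ℝ X Y) (left_mem_segment ℝ X Z) (Or.inl hs) hX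
    with e | e
  · exact S_ne_edge hs h.e12 e
  · exact S_ne_edge hs h.perm.2.2.1.e12 e

theorem Cor.ln_ne (h : Cor Δ X Y Z) (hs : s ∈ Δ.S) : ln s X ≠ 0 := fun h0 =>
  h.not_mem hs (mem_of_ln (Or.inl hs) h.mem_tri h0)

/-- A segment of `S` meets the boundary only at its endpoints, which lie on edges;
general form: every initial segment has two endpoints, each lying on an edge other than it. -/
theorem Sbar_ends (hs : s ∈ Δ.Sbar) : ∃ a b : Pt, a ≠ b ∧ s = segment ℝ a b ∧
    (∃ κ ∈ triEdges Δ.x1 Δ.x2 Δ.x3, κ ≠ s ∧ a ∈ κ) ∧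
    (∃ κ ∈ triEdges Δ.x1 Δ.x2 Δ.x3, κ ≠ s ∧ b ∈ κ) := by
  rcases hs with hs | hs
  · obtain ⟨a, b, hab, e, ha, hb, -⟩ := Δ.seg_wf s (Or.inl hs)
    obtain ⟨κ, hκ, h1⟩ := mem_bdry.1 ha
    obtain ⟨κ', hκ', h2⟩ := mem_bdry.1 hb
    exact ⟨a, b, hab, e, ⟨κ, hκ, (S_ne_edge hs hκ).symm, h1⟩,
      ⟨κ', hκ', (S_ne_edge hs hκ').symm, h2⟩⟩
  · obtain ⟨X, Y, Z, hc, rfl⟩ := edge_cor hs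
    refine ⟨X, Y, hc.ne12, rfl, ⟨_, hc.perm.2.2.1.e12, hc.edge_ne.symm, left_mem_segment _ _ _⟩,
      ⟨_, hc.rot.e12, ?_, left_mem_segment _ _ _⟩⟩
    rw [segment_symm ℝ X Y]; exact hc.swap.edge_ne.symm

theorem S_inter_not_bdry {s' : Set Pt} (hs : s ∈ Δ.S) (hs' : s' ∈ Δ.S) (hne : s ≠ s')
    (hx : x ∈ s) (hx' : x ∈ s') : x ∉ Δ.bdry := by
  intro h
  obtain ⟨κ, hκ, h1⟩ := mem_bdry.1 h
  rcases three (Or.inl hs) (Or.inl hs') hne hx hx' (Or.inr hκ) h1 with e | e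
  · exact S_ne_edge hs hκ e.symm
  · exact S_ne_edge hs' hκ e.symm

end TBA

namespace TBA

variable {Δ : TBA} {X Y Z : Pt} {s t β β' : Set Pt} {x y v p d : Pt}

theorem blk_sub (hβ : β ∈ Δ.B) : β ⊆ Δ.tri := S_sub (Or.inr hβ)

theorem blk_convex (hβ : β ∈ Δ.B) : Convex ℝ β := by
  obtain ⟨a, b, -, rfl, -⟩ := Δ.seg_wf β (Or.inr hβ); exact convex_segment _ _

theorem blk_second (hβ : β ∈ Δ.B) (hs : s ∈ Δ.Sbar) (hx : x ∈ β) (hx' : x ∈ s) :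
    ∃ s' ∈ Δ.Sbar, s' ≠ s ∧ x ∈ s' := by
  obtain ⟨s', ⟨h1, h2, h3⟩, -⟩ := Δ.second_segment s hs β hβ x hx' hx
  exact ⟨s', h1, h2, h3⟩

theorem Sbar_convex (hs : s ∈ Δ.Sbar) : Convex ℝ s := by
  obtain ⟨a, b, -, rfl⟩ := Sbar_wf hs; exact convex_segment _ _

/-- A blocking segment meets an initial segment in at most one point. -/
theorem blk_unique (hβ : β ∈ Δ.B) (hs : s ∈ Δ.Sbar) (hx : x ∈ β) (hx' : x ∈ s)
    (hy : y ∈ β) (hy' : y ∈ s) : x = y := by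
  by_contra hxy
  have hz : ∀ r : Icc (0 : ℝ) 1, ∃ s' ∈ Δ.Sbar, s' ≠ s ∧ mv x y r ∈ s' := fun r =>
    blk_second hβ hs (mv_mem (blk_convex hβ) hx hy r.2.1 r.2.2)
      (mv_mem (Sbar_convex hs) hx' hy' r.2.1 r.2.2)
  choose g hg hg' hg'' using hz
  have : Finite Δ.Sbar := Δ.Sbar_fin
  have hinf : Infinite (Icc (0 : ℝ) 1) := (Icc_infinite (by norm_num)).to_subtype
  obtain ⟨r, r', hne, he⟩ := Finite.exists_ne_map_eq_of_infinite
    (fun r : Icc (0 : ℝ) 1 => (⟨g r, hg r⟩ : Δ.Sbar))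
  have he' : g r = g r' := congrArg Subtype.val he
  have hp : mv x y r = mv x y r' := inter_unique (hg r) hs (hg' r) (hg'' r)
    (mv_mem (Sbar_convex hs) hx' hy' r.2.1 r.2.2) (he' ▸ hg'' r')
    (mv_mem (Sbar_convex hs) hx' hy' r'.2.1 r'.2.2)
  exact hne (Subtype.ext (mv_inj hxy hp))

theorem blk_ex (hs : s ∈ Δ.S) (ht : t ∈ Δ.Sbar) (hst : s ≠ t) (hx : x ∈ s) (hx' : x ∈ t) :
    ∃ β ∈ Δ.B, x ∈ β := by
  obtain ⟨β, ⟨h1, h2⟩, -⟩ := Δ.block_exists s (Or.inl hs) t ht hst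
    (fun h => S_ne_edge hs h.1 rfl) x hx hx'
  exact ⟨β, h1, h2⟩

theorem blk_eq (hs : s ∈ Δ.Sbar) (hβ : β ∈ Δ.B) (hβ' : β' ∈ Δ.B)
    (hx : x ∈ s) (hx1 : x ∈ β) (hx2 : x ∈ β') : β = β' := by
  obtain ⟨s', h1, h2, h3⟩ := blk_second hβ hs hx1 hx
  exact Δ.block_unique s hs s' h1 h2.symm x hx h3 β hβ β' hβ' hx1 hx2

/-- From `v` through an interior point `p`, a blocking segment reaches the boundary beyond `p`. -/
theorem blk_extend (hβ : β ∈ Δ.B) (hv : v ∈ β) (hp : p ∈ β) (hvp : v ≠ p) (hpb : p ∉ Δ.bdry) :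
    ∃ τ : ℝ, 1 < τ ∧ mv v p τ ∈ β ∧ mv v p τ ∈ Δ.bdry := by
  obtain ⟨a, b, hab, rfl, ha, hb, -⟩ := Δ.seg_wf β (Or.inr hβ)
  obtain ⟨t₁, h0, h1, rfl⟩ := mem_seg.1 hv
  obtain ⟨t₂, h0', h1', rfl⟩ := mem_seg.1 hp
  have hne : t₁ ≠ t₂ := fun h => hvp (by rw [h])
  have h2 : t₂ ≠ 0 := fun h => hpb (by rw [h, mv_zero]; exact ha)
  have h3 : t₂ ≠ 1 := fun h => hpb (by rw [h, mv_one]; exact hb)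
  have h2' : 0 < t₂ := lt_of_le_of_ne h0' (Ne.symm h2)
  have h3' : t₂ < 1 := lt_of_le_of_ne h1' h3
  have key : ∀ e : ℝ, mv (mv a b t₁) (mv a b t₂) ((e - t₁) / (t₂ - t₁)) = mv a b e := by
    intro e
    have : t₂ - t₁ ≠ 0 := sub_ne_zero.2 hne.symm
    ext <;> simp only [mv] <;> field_simp <;> ring
  rcases lt_or_gt_of_ne hne with hlt | hgt
  · refine ⟨(1 - t₁) / (t₂ - t₁), ?_, ?_⟩
    · rw [lt_div_iff₀ (by linarith)]; linarith
    · rw [key, mv_one]; exact ⟨right_mem_segment _ _ _, hb⟩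
  · refine ⟨(0 - t₁) / (t₂ - t₁), ?_, ?_⟩
    · rw [lt_div_iff_of_neg (by linarith)]; linarith
    · rw [key, mv_zero]; exact ⟨left_mem_segment _ _ _, ha⟩

/-- `p` is a point of the triangle on no initial segment. -/
def Gen (Δ : TBA) (p : Pt) : Prop := p ∈ Δ.tri ∧ ∀ s ∈ Δ.Sbar, ln s p ≠ 0

/-- The minimal region around `p`. -/
def R (Δ : TBA) (p : Pt) : Set Pt := {x | ∀ s ∈ Δ.Sbar, 0 ≤ ln s p * ln s x}

/-- The open minimal region around `p`. -/
def C (Δ : TBA) (p : Pt) : Set Pt := {x | ∀ s ∈ Δ.Sbar, 0 < ln s p * ln s x}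

theorem sign_trans {a b c : ℝ} (ha : a ≠ 0) (h1 : 0 ≤ a * b) (h2 : 0 ≤ a * c) : 0 ≤ b * c := by
  have : 0 < a * a := mul_self_pos.2 ha
  by_contra h
  push Not at h
  nlinarith [mul_nonneg h1 h2]

theorem Cor.mem_of_edges (h : Cor Δ X Y Z) (hp : p ∈ Δ.tri) (hp0 : ln (segment ℝ X Y) p ≠ 0)
    (hx : 0 ≤ ln (segment ℝ X Y) p * ln (segment ℝ X Y) x) : 0 ≤ cr X Y Z * cr X Y x := by
  obtain ⟨k, hk, e⟩ := h.ln_edge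
  rw [e] at hp0
  rw [e, e] at hx
  have h1 := (h.mem.1 hp).1
  have h2 : cr X Y p ≠ 0 := fun h0 => hp0 (by rw [h0, mul_zero])
  have hkk : 0 < k * k := mul_self_pos.2 hk
  have h3 : 0 ≤ cr X Y p * cr X Y x := by
    by_contra hn
    push Not at hn
    nlinarith
  exact sign_trans h2 (by linarith) h3

theorem R_sub (hp : Gen Δ p) : R Δ p ⊆ Δ.tri := by
  intro x hx
  have h := cor_base Δ
  refine h.mem.2 ⟨h.mem_of_edges hp.1 (hp.2 _ h.b12) (hx _ h.b12), ?_, ?_⟩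
  · have := h.rot.mem_of_edges hp.1 (hp.2 _ h.rot.b12) (hx _ h.rot.b12)
    rwa [cr_cyc] at this
  · have := h.rot.rot.mem_of_edges hp.1 (hp.2 _ h.rot.rot.b12) (hx _ h.rot.rot.b12)
    rwa [cr_cyc, cr_cyc] at this

theorem C_sub_R : C Δ p ⊆ R Δ p := fun _ hx s hs => (hx s hs).le

theorem mem_C_self (hp : Gen Δ p) : p ∈ C Δ p := fun s hs => mul_self_pos.2 (hp.2 s hs)

theorem ln_continuous (s : Set Pt) : Continuous (ln s) := by
  obtain ⟨A, B, C, h⟩ := ln_form s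
  rw [show ln s = fun x : Pt => A * x.1 + B * x.2 + C from funext h]
  fun_prop

theorem C_open : IsOpen (C Δ p) := by
  have : C Δ p = ⋂ s ∈ Δ.Sbar, {x | 0 < ln s p * ln s x} := by
    ext x; simp only [C, mem_iInter, mem_ofPred_eq]
  rw [this]
  exact Δ.Sbar_fin.isOpen_biInter fun s _ =>
    isOpen_lt continuous_const (continuous_const.mul (ln_continuous s))

theorem R_closed : IsClosed (R Δ p) := by
  have : R Δ p = ⋂ s ∈ Δ.Sbar, {x | 0 ≤ ln s p * ln s x} := by
    ext x; simp only [R, mem_iInter, mem_ofPred_eq]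
  rw [this]
  exact isClosed_biInter fun s _ =>
    isClosed_le continuous_const (continuous_const.mul (ln_continuous s))

theorem R_convex : Convex ℝ (R Δ p) := by
  rw [convex_iff_segment_subset]
  intro x hx y hy z hz s hs
  obtain ⟨t, h0, h1, rfl⟩ := mem_seg.1 hz
  rw [ln_mv]
  nlinarith [mul_nonneg (sub_nonneg.2 h1) (hx s hs), mul_nonneg h0 (hy s hs)]

theorem mv_C (hp : Gen Δ p) (hx : x ∈ R Δ p) {t : ℝ} (h0 : 0 < t) (h1 : t ≤ 1) :
    mv x p t ∈ C Δ p := by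
  intro s hs
  rw [ln_mv]
  have := mul_pos h0 (mem_C_self hp s hs)
  nlinarith [mul_nonneg (sub_nonneg.2 h1) (hx s hs)]

theorem C_convex : Convex ℝ (C Δ p) := by
  rw [convex_iff_segment_subset]
  intro x hx y hy z hz s hs
  obtain ⟨t, h0, h1, rfl⟩ := mem_seg.1 hz
  rw [ln_mv]
  rcases h0.eq_or_lt with rfl | h0
  · simpa using hx s hs
  · nlinarith [mul_nonneg (sub_nonneg.2 h1) (hx s hs).le, mul_pos h0 (hy s hs)]

theorem closure_C (hp : Gen Δ p) : closure (C Δ p) = R Δ p := by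
  apply subset_antisymm (closure_minimal C_sub_R R_closed)
  intro x hx
  have h : openSegment ℝ x p ⊆ C Δ p := by
    intro z hz
    obtain ⟨t, h0, h1, rfl⟩ := mem_openSeg.1 hz
    exact mv_C hp hx h0 h1.le
  refine closure_mono h ?_
  rw [closure_openSegment]
  exact left_mem_segment _ _ _

theorem interior_R (hp : Gen Δ p) : interior (R Δ p) = C Δ p := by
  apply subset_antisymm _ (interior_maximal C_sub_R C_open)
  intro x hx s hs
  refine lt_of_le_of_ne (interior_subset hx s hs) fun h0 => ?_
  have hx0 : ln s x = 0 := (mul_eq_zero.1 h0.symm).resolve_left (hp.2 s hs)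
  have hc : Continuous (mv p x) := by
    unfold mv; fun_prop
  have hn : mv p x ⁻¹' interior (R Δ p) ∈ nhds (1 : ℝ) :=
    hc.continuousAt.preimage_mem_nhds (isOpen_interior.mem_nhds (by simpa using hx))
  obtain ⟨ε, hε, hb⟩ := Metric.mem_nhds_iff.1 hn
  have hm : (1 + ε / 2) ∈ Metric.ball (1 : ℝ) ε := by
    rw [Metric.mem_ball, Real.dist_eq]
    rw [abs_of_pos (by linarith)]; linarith
  have h1 := interior_subset (hb hm) s hs
  rw [ln_mv, hx0] at h1
  nlinarith [mem_C_self hp s hs]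

theorem C_sub_compl (hp : Gen Δ p) : C Δ p ⊆ Δ.tri \ ⋃₀ Δ.Sbar := by
  intro x hx
  refine ⟨R_sub hp (C_sub_R hx), ?_⟩
  rintro ⟨s, hs, hxs⟩
  have := hx s hs
  rw [ln_of_mem hs hxs] at this
  simp at this

theorem R_minRegion (hp : Gen Δ p) : Δ.IsMinRegion (R Δ p) := by
  have hpm := C_sub_compl hp (mem_C_self hp)
  refine ⟨p, hpm, ?_⟩
  rw [← closure_C hp]
  congr 1
  apply subset_antisymm
  · exact C_convex.isPreconnected.subset_connectedComponentIn (mem_C_self hp)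
      (C_sub_compl hp)
  · intro x hx s hs
    by_contra hn
    push Not at hn
    have hpre : IsPreconnected (connectedComponentIn (Δ.tri \ ⋃₀ Δ.Sbar) p) :=
      isPreconnected_connectedComponentIn
    have hpK := mem_connectedComponentIn hpm
    have hiv := hpre.intermediate_value hx hpK
      (f := fun x => ln s p * ln s x) (by
        exact (continuous_const.mul (ln_continuous s)).continuousOn)
    obtain ⟨z, hz, hz0⟩ := hiv ⟨hn, (mem_C_self hp s hs).le⟩
    have hz' := connectedComponentIn_subset _ _ hz
    have : ln s z = 0 := (mul_eq_zero.1 hz0).resolve_left (hp.2 s hs)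
    exact hz'.2 ⟨s, hs, mem_of_ln hs hz'.1 this⟩

end TBA

namespace TBA

variable {Δ : TBA} {X Y Z : Pt} {s s' t β β' : Set Pt} {x y z u w v p d : Pt}

theorem ppos {a b c : ℝ} (h1 : 0 < a * b) (h2 : 0 < a * c) : 0 < b * c := by
  have ha : a ≠ 0 := by rintro rfl; simp at h1
  have : 0 < a * a := mul_self_pos.2 ha
  by_contra h
  push Not at h
  nlinarith [mul_pos h1 h2]

theorem nneg_of_pos {a b c : ℝ} (h1 : 0 < a * b) (h2 : 0 ≤ b * c) : 0 ≤ a * c := by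
  have hb : b ≠ 0 := by rintro rfl; simp at h1
  exact sign_trans hb (by linarith [mul_comm a b]) h2

theorem npos {a b c : ℝ} (h1 : 0 < a * b) (h2 : a * c < 0) : b * c < 0 := by
  have := ppos h1 (c := -c) (by linarith)
  linarith

theorem nn {a b c : ℝ} (h1 : a * b < 0) (h2 : a * c < 0) : 0 < b * c := by
  have := ppos (a := a) (b := -b) (c := -c) (by linarith) (by linarith)
  linarith

/-- First exit from the region of `p` on the way from `x` to `y`. -/
theorem hit (hp : Gen Δ p) (hx : x ∈ R Δ p)
    (hdir : ∀ s ∈ Δ.Sbar, ln s x = 0 → 0 ≤ ln s p * ln s y)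
    (hex : ∃ s ∈ Δ.Sbar, ln s x ≠ 0 ∧ ln s p * ln s y ≤ 0) :
    ∃ t : ℝ, 0 < t ∧ t ≤ 1 ∧ mv x y t ∈ R Δ p ∧
      ∃ s ∈ Δ.Sbar, ln s x ≠ 0 ∧ ln s (mv x y t) = 0 := by
  set F : Set (Set Pt) := {s ∈ Δ.Sbar | ln s x ≠ 0 ∧ ln s p * ln s y ≤ 0} with hF
  have hfin : F.Finite := Δ.Sbar_fin.subset fun s hs => hs.1
  set g : Set Pt → ℝ := fun s => (ln s p * ln s x) / (ln s p * ln s x - ln s p * ln s y) with hg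
  have hpos : ∀ s ∈ Δ.Sbar, ln s x ≠ 0 → 0 < ln s p * ln s x := fun s hs h0 =>
    lt_of_le_of_ne (hx s hs) (mul_ne_zero (hp.2 s hs) h0).symm
  obtain ⟨s₀, hs₀, hmin⟩ := exists_min_image F g hfin (by
    obtain ⟨s, h1, h2, h3⟩ := hex; exact ⟨s, h1, h2, h3⟩)
  have h0 := hpos s₀ hs₀.1 hs₀.2.1
  have h0' := hs₀.2.2
  have hden : 0 < ln s₀ p * ln s₀ x - ln s₀ p * ln s₀ y := by linarith
  have ht0 : 0 < g s₀ := div_pos h0 hden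
  have ht1 : g s₀ ≤ 1 := by rw [hg]; simp only; rw [div_le_one hden]; linarith
  refine ⟨g s₀, ht0, ht1, ?_, s₀, hs₀.1, hs₀.2.1, ?_⟩
  · intro s hs
    rw [ln_mv]
    by_cases h : ln s x = 0
    · rw [h]
      nlinarith [mul_nonneg ht0.le (hdir s hs h)]
    · have ha := hpos s hs h
      rcases le_or_gt (ln s p * ln s y) 0 with hb | hb
      · have hle := hmin s ⟨hs, h, hb⟩
        have hd : 0 < ln s p * ln s x - ln s p * ln s y := by linarith
        have : g s₀ * (ln s p * ln s x - ln s p * ln s y) ≤ ln s p * ln s x := by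
          rw [← le_div_iff₀ hd]; exact hle
        nlinarith
      · nlinarith [mul_nonneg (sub_nonneg.2 ht1) ha.le, mul_pos ht0 hb]
  · have : ln s₀ p * ln s₀ (mv x y (g s₀)) = 0 := by
      have hg' : g s₀ * (ln s₀ p * ln s₀ x - ln s₀ p * ln s₀ y) = ln s₀ p * ln s₀ x :=
        div_mul_cancel₀ _ hden.ne'
      rw [ln_mv]; linear_combination -hg'
    exact (mul_eq_zero.1 this).resolve_left (hp.2 s₀ hs₀.1)

theorem isVertex (hs : s ∈ Δ.Sbar) (ht : t ∈ Δ.Sbar) (h : s ≠ t) (hx : x ∈ s) (hx' : x ∈ t) :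
    Δ.IsVertex x := ⟨s, hs, t, ht, h, hx, hx'⟩

theorem on_chord (hs : s ∈ Δ.Sbar) (hxy : x ≠ y) (hx : x ∈ s) (hy : y ∈ s) (hz : z ∈ s) :
    ∃ τ, z = mv x y τ := by
  obtain ⟨k, hk, e⟩ := ln_eq_cr' hs hxy (ln_of_mem hs hx) (ln_of_mem hs hy)
  have := ln_of_mem hs hz
  rw [e] at this
  exact exists_mv_of_cr hxy ((mul_eq_zero.1 this).resolve_left hk)

/-- Walking from the vertex `d` of a minimal region along the chord `s`, one reaches
another vertex of the region. -/
theorem step (hp : Gen Δ p) (hd : d ∈ R Δ p) (hs : s ∈ Δ.Sbar) (hs' : s' ∈ Δ.Sbar)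
    (hne : s ≠ s') (hds : d ∈ s) (hds' : d ∈ s') :
    ∃ y ∈ R Δ p, y ≠ d ∧ y ∈ s ∧ ∃ f ∈ Δ.Sbar, f ≠ s ∧ f ≠ s' ∧ y ∈ f := by
  have hdT := R_sub hp hd
  have hend : ∃ y ∈ s, 0 < ln s' p * ln s' y ∧ ∃ κ ∈ Δ.Sbar, κ ≠ s ∧ y ∈ κ := by
    obtain ⟨a, b, hab, e, ⟨κ, hκ, hκs, haκ⟩, ⟨κ', hκ', hκs', hbκ'⟩⟩ := Sbar_ends hs
    have ha : a ∈ s := e ▸ left_mem_segment ℝ a b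
    have hb : b ∈ s := e ▸ right_mem_segment ℝ a b
    have hends : ∀ a b : Pt, a ≠ b → a ∈ s → b ∈ s → ∀ κ ∈ triEdges Δ.x1 Δ.x2 Δ.x3, κ ≠ s →
        a ∈ κ → d = a → 0 < ln s' p * ln s' b := by
      rintro a b hab ha hb κ hκ hκs haκ rfl
      have : κ = s' := (three hs hs' hne hds hds' (Or.inr hκ) haκ).resolve_left hκs
      subst this
      have h1 := edge_sign hκ hp.1 (Sbar_sub hs hb)
      refine lt_of_le_of_ne h1 (mul_ne_zero (hp.2 _ hs') ?_).symm
      intro h0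
      exact hab (inter_unique hs hs' hne hds hds' hb (mem_of_ln hs' (Sbar_sub hs hb) h0))
    by_cases hda : d = a
    · exact ⟨b, hb, hends a b hab ha hb κ hκ hκs haκ hda, κ', Or.inr hκ', hκs', hbκ'⟩
    by_cases hdb : d = b
    · exact ⟨a, ha, hends b a hab.symm hb ha κ' hκ' hκs' hbκ' hdb, κ, Or.inr hκ, hκs, haκ⟩
    obtain ⟨t, h0, h1, rfl⟩ := mem_seg.1 (e ▸ hds)
    have h0' : 0 < t := lt_of_le_of_ne h0 fun h => hda (by rw [← h, mv_zero])
    have h1' : t < 1 := lt_of_le_of_ne h1 fun h => hdb (by rw [h, mv_one])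
    have hz := ln_of_mem hs' hds'
    rw [ln_mv] at hz
    have hna : ln s' a ≠ 0 := fun h =>
      hda (inter_unique hs hs' hne hds hds' ha (mem_of_ln hs' (Sbar_sub hs ha) h))
    have hpa : ln s' p * ln s' a ≠ 0 := mul_ne_zero (hp.2 _ hs') hna
    have hz' : (1 - t) * (ln s' p * ln s' a) + t * (ln s' p * ln s' b) = 0 := by
      linear_combination ln s' p * hz
    rcases lt_or_gt_of_ne hpa with h | h
    · refine ⟨b, hb, ?_, κ', Or.inr hκ', hκs', hbκ'⟩
      by_contra hn
      push Not at hn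
      nlinarith [mul_neg_of_pos_of_neg (sub_pos.2 h1') h, mul_nonneg h0'.le (neg_nonneg.2 hn)]
    · exact ⟨a, ha, h, κ, Or.inr hκ, hκs, haκ⟩
  obtain ⟨y, hys, hpos, κ, hκ, hκs, hyκ⟩ := hend
  have hyd : y ≠ d := by
    rintro rfl
    rw [ln_of_mem hs' hds'] at hpos; simp at hpos
  obtain ⟨t, ht0, ht1, hR, f, hf, hfd, hf0⟩ := hit (y := y) hp hd (by
    intro r hr hr0
    rcases three hs hs' hne hds hds' hr (mem_of_ln hr hdT hr0) with rfl | rfl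
    · rw [ln_of_mem hr hys, mul_zero]
    · exact hpos.le) ⟨κ, hκ, by
      intro h0
      exact hyd (inter_unique hs hκ hκs.symm hys hyκ hds (mem_of_ln hκ hdT h0)), by
      rw [ln_of_mem hκ hyκ, mul_zero]⟩
  refine ⟨_, hR, ?_, ?_, f, hf, ?_, ?_, mem_of_ln hf (R_sub hp hR) hf0⟩
  · intro h; rw [h] at hf0; exact hfd hf0
  · exact mem_of_ln hs (R_sub hp hR) (by rw [ln_mv, ln_of_mem hs hds, ln_of_mem hs hys]; ring)
  · rintro rfl; exact hfd (ln_of_mem hf hds)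
  · rintro rfl; exact hfd (ln_of_mem hf hds')

theorem seg_frontier (hp : Gen Δ p) (hs : s ∈ Δ.Sbar) (hx : x ∈ R Δ p) (hy : y ∈ R Δ p)
    (hxs : x ∈ s) (hys : y ∈ s) : segment ℝ x y ⊆ frontier (R Δ p) := by
  intro z hz
  rw [frontier, interior_R hp, R_closed.closure_eq]
  refine ⟨R_convex.segment_subset hx hy hz, fun h => ?_⟩
  have := h s hs
  rw [ln_of_mem hs ((Sbar_convex hs).segment_subset hxs hys hz)] at this
  simp at this

theorem region_vertex (hp : Gen Δ p) (hx : x ∈ R Δ p) (hv : Δ.IsVertex x) :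
    Δ.IsRegionVertex (R Δ p) x := by
  obtain ⟨s, hs, t, ht, hst, hxs, hxt⟩ := hv
  refine ⟨hx, s, hs, t, ht, hst, hxs, hxt, ?_, ?_⟩
  · obtain ⟨y, hy, hne, hys, -⟩ := step hp hx hs ht hst hxs hxt
    exact ⟨x, y, hne.symm, subset_inter ((Sbar_convex hs).segment_subset hxs hys)
      (seg_frontier hp hs hx hy hxs hys)⟩
  · obtain ⟨y, hy, hne, hys, -⟩ := step hp hx ht hs hst.symm hxt hxs
    exact ⟨x, y, hne.symm, subset_inter ((Sbar_convex ht).segment_subset hxt hys)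
      (seg_frontier hp ht hx hy hxt hys)⟩

theorem consec (hp : Gen Δ p) (hx : x ∈ R Δ p) (hy : y ∈ R Δ p) (hvx : Δ.IsVertex x)
    (hvy : Δ.IsVertex y) (hne : x ≠ y) (hs : s ∈ Δ.Sbar) (hxs : x ∈ s) (hys : y ∈ s) :
    Δ.Consec (R Δ p) x y :=
  ⟨hne, region_vertex hp hx hvx, region_vertex hp hy hvy, seg_frontier hp hs hx hy hxs hys⟩

theorem span_ln (hx : ln s x = 0) (hy : ln s y = 0)
    (hz : z ∈ affineSpan ℝ ({x, y} : Set Pt)) : ln s z = 0 := by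
  obtain ⟨r, rfl⟩ := (mem_affineSpan_pair_iff_exists_lineMap_eq).1 hz
  have : AffineMap.lineMap x y r = mv x y r := by
    rw [AffineMap.lineMap_apply]; ext <;> simp [mv] <;> ring
  rw [this, ln_mv, hx, hy]; ring

theorem mem_span (hs : s ∈ Δ.Sbar) (hxy : x ≠ y) (hx : x ∈ s) (hy : y ∈ s) (hz : z ∈ s) :
    z ∈ affineSpan ℝ ({x, y} : Set Pt) := by
  obtain ⟨r, rfl⟩ := on_chord hs hxy hx hy hz
  refine (mem_affineSpan_pair_iff_exists_lineMap_eq).2 ⟨r, ?_⟩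
  rw [AffineMap.lineMap_apply]; ext <;> simp [mv] <;> ring

/-- Condition (A) for the region of a generic point. -/
theorem strong_five (hst : Δ.Strong) (hp : Gen Δ p) {v₁ v₂ v₃ v₄ v₅ : Pt} {s₁ s₂ s₃ s₄ : Set Pt}
    (hv : ∀ v ∈ [v₁, v₂, v₃, v₄, v₅], v ∈ R Δ p ∧ Δ.IsVertex v)
    (hne : List.Pairwise (· ≠ ·) [v₁, v₂, v₃, v₄, v₅])
    (h1 : s₁ ∈ Δ.Sbar) (h2 : s₂ ∈ Δ.Sbar) (h3 : s₃ ∈ Δ.Sbar) (h4 : s₄ ∈ Δ.Sbar)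
    (m11 : v₁ ∈ s₁) (m21 : v₂ ∈ s₁) (m22 : v₂ ∈ s₂) (m32 : v₃ ∈ s₂) (m33 : v₃ ∈ s₃)
    (m43 : v₄ ∈ s₃) (m44 : v₄ ∈ s₄) (m54 : v₅ ∈ s₄)
    (hβ : β ∈ Δ.B) (hvβ : v₃ ∈ β) (hpβ : p ∈ β) (hx : x ∈ β) (hx1 : x ∈ s₁) : x ∈ s₄ := by
  simp only [List.mem_cons, List.not_mem_nil, or_false, forall_eq_or_imp, forall_eq] at hv
  obtain ⟨⟨r1, w1⟩, ⟨r2, w2⟩, ⟨r3, w3⟩, ⟨r4, w4⟩, ⟨r5, w5⟩⟩ := hv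
  have hne' := hne
  simp only [List.pairwise_cons, List.mem_cons, List.not_mem_nil, or_false, forall_eq_or_imp,
    forall_eq] at hne
  obtain ⟨⟨n12, n13, n14, n15⟩, ⟨n23, n24, n25⟩, ⟨n34, n35⟩, n45, -⟩ := hne
  obtain ⟨q, hq, hq1, hq4⟩ := hst (R Δ p) (R_minRegion hp) v₁ v₂ v₃ v₄ v₅ hne'
    (consec hp r1 r2 w1 w2 n12 h1 m11 m21) (consec hp r2 r3 w2 w3 n23 h2 m22 m32)
    (consec hp r3 r4 w3 w4 n34 h3 m33 m43) (consec hp r4 r5 w4 w5 n45 h4 m44 m54)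
    β hβ hvβ ⟨p, hpβ, by rw [interior_R hp]; exact mem_C_self hp⟩
    ⟨x, blk_sub hβ hx, mem_span h1 n12 m11 m21 hx1, hx⟩
  have hqT := blk_sub hβ hq
  have e1 := mem_of_ln h1 hqT (span_ln (ln_of_mem h1 m11) (ln_of_mem h1 m21) hq1)
  have e4 := mem_of_ln h4 hqT (span_ln (ln_of_mem h4 m44) (ln_of_mem h4 m54) hq4)
  rwa [blk_unique hβ h1 hx hx1 hq e1]

/-- On an edge of a minimal region there are no vertices other than its endpoints. -/
theorem face (hp : Gen Δ p) (hs : s ∈ Δ.Sbar) (hu : u ∈ R Δ p) (hw : w ∈ R Δ p) (hz : z ∈ R Δ p)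
    (hus : u ∈ s) (hws : w ∈ s) (hzs : z ∈ s) (huw : u ≠ w)
    {t₁ t₂ t₃ : Set Pt} (h1 : t₁ ∈ Δ.Sbar) (h2 : t₂ ∈ Δ.Sbar) (h3 : t₃ ∈ Δ.Sbar)
    (n1 : t₁ ≠ s) (n2 : t₂ ≠ s) (n3 : t₃ ≠ s) (hu1 : u ∈ t₁) (hw2 : w ∈ t₂) (hz3 : z ∈ t₃) :
    z = u ∨ z = w := by
  obtain ⟨τ, rfl⟩ := on_chord hs huw hus hws hzs
  have e1 : ln t₁ w ≠ 0 := fun h =>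
    huw (inter_unique hs h1 n1.symm hus hu1 hws (mem_of_ln h1 (R_sub hp hw) h))
  have e2 : ln t₂ u ≠ 0 := fun h =>
    huw (inter_unique hs h2 n2.symm hus (mem_of_ln h2 (R_sub hp hu) h) hws hw2)
  have f1 : 0 < ln t₁ p * ln t₁ w := lt_of_le_of_ne (hw t₁ h1) (mul_ne_zero (hp.2 _ h1) e1).symm
  have f2 : 0 < ln t₂ p * ln t₂ u := lt_of_le_of_ne (hu t₂ h2) (mul_ne_zero (hp.2 _ h2) e2).symm
  have g1 := hz t₁ h1
  have g2 := hz t₂ h2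
  rw [ln_mv, ln_of_mem h1 hu1] at g1
  rw [ln_mv, ln_of_mem h2 hw2] at g2
  have hτ0 : 0 ≤ τ := by by_contra h; push Not at h; nlinarith
  have hτ1 : τ ≤ 1 := by by_contra h; push Not at h; nlinarith
  rcases hτ0.eq_or_lt with rfl | hτ0
  · left; simp
  rcases hτ1.eq_or_lt with rfl | hτ1
  · right; simp
  exfalso
  have hz0 := ln_of_mem h3 hz3
  rw [ln_mv] at hz0
  have k1 := hu t₃ h3
  have k2 := hw t₃ h3
  have k3 : (1 - τ) * (ln t₃ p * ln t₃ u) + τ * (ln t₃ p * ln t₃ w) = 0 := by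
    linear_combination ln t₃ p * hz0
  have k4 : ln t₃ p * ln t₃ u = 0 := by nlinarith [mul_nonneg hτ0.le k2]
  have k5 : ln t₃ p * ln t₃ w = 0 := by nlinarith [mul_nonneg (sub_nonneg.2 hτ1.le) k1]
  have k4' := (mul_eq_zero.1 k4).resolve_left (hp.2 _ h3)
  have k5' := (mul_eq_zero.1 k5).resolve_left (hp.2 _ h3)
  exact huw (inter_unique hs h3 n3.symm hus (mem_of_ln h3 (R_sub hp hu) k4') hws
    (mem_of_ln h3 (R_sub hp hw) k5'))

/-- Two distinct chords through `w` give coordinates on the plane. -/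
theorem decomp (hs : s ∈ Δ.Sbar) (hs' : s' ∈ Δ.Sbar) (hne : s ≠ s') (hws : w ∈ s) (hws' : w ∈ s')
    (hus : u ∈ s) (hu : u ≠ w) (hvs : v ∈ s') (hv : v ≠ w) (t : Set Pt) :
    ∃ A B : ℝ, ∀ x, ln t x = ln t w + A * ln s x + B * ln s' x := by
  have e1 : ln s v ≠ 0 := fun h =>
    hv (inter_unique hs hs' hne (mem_of_ln hs (Sbar_sub hs' hvs) h) hvs hws hws')
  have e2 : ln s' u ≠ 0 := fun h =>
    hu (inter_unique hs hs' hne hus (mem_of_ln hs' (Sbar_sub hs hus) h) hws hws')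
  refine ⟨(ln t v - ln t w) / ln s v, (ln t u - ln t w) / ln s' u, ?_⟩
  set A := (ln t v - ln t w) / ln s v with hA
  set B := (ln t u - ln t w) / ln s' u with hB
  have hA' : A * ln s v = ln t v - ln t w := by rw [hA]; field_simp
  have hB' : B * ln s' u = ln t u - ln t w := by rw [hB]; field_simp
  obtain ⟨a, b, c, h1⟩ := ln_form t
  obtain ⟨a', b', c', h2⟩ := ln_form s
  obtain ⟨a'', b'', c'', h3⟩ := ln_form s'
  have hform : ∀ x : Pt, ln t x - ln t w - A * ln s x - B * ln s' x =
      (a - A * a' - B * a'') * x.1 + (b - A * b' - B * b'') * x.2 +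
        (c - ln t w - A * c' - B * c'') := by
    intro x; rw [h1 x, h2 x, h3 x]; ring
  have zw := hform w
  have zu := hform u
  have zv := hform v
  rw [ln_of_mem hs hws, ln_of_mem hs' hws'] at zw
  rw [ln_of_mem hs hus, hB'] at zu
  rw [ln_of_mem hs' hvs, hA'] at zv
  obtain ⟨k, hk⟩ := form_eq_cr hu.symm (by rw [← zw]; ring) (by rw [← zu]; ring)
  obtain ⟨k', hk'⟩ := ln_eq_cr hu.symm (ln_of_mem hs hws) (ln_of_mem hs hus)
  have hcr : cr w u v ≠ 0 := fun h => e1 (by rw [hk', h, mul_zero])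
  have hk0 : k = 0 := by
    have := hk v
    rw [← zv] at this
    exact (mul_eq_zero.1 (this.symm.trans (by ring))).resolve_right hcr
  intro x
  have := hform x
  rw [hk, hk0] at this
  linarith

/-- A closed polygon of edges of a minimal region exhausts its vertices. -/
theorem poly {n : ℕ} [NeZero n] (hp : Gen Δ p) (v : Fin n → Pt) (s : Fin n → Set Pt)
    (hv : ∀ i, v i ∈ R Δ p) (hs : ∀ i, s i ∈ Δ.Sbar) (h1 : ∀ i, v i ∈ s i)
    (h2 : ∀ i, v (i + 1) ∈ s i) (hne : ∀ i, s i ≠ s (i + 1)) (hvne : ∀ i, v i ≠ v (i + 1))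
    (hz : z ∈ R Δ p) (hzv : Δ.IsVertex z) : ∃ i, z = v i := by
  obtain ⟨t, ht, t', ht', htt, hzt, hzt'⟩ := hzv
  suffices ∃ i, t = s i by
    obtain ⟨i, rfl⟩ := this
    have e : i - 1 + 1 = i := sub_add_cancel i 1
    have hm := h2 (i - 1)
    have hn := hne (i - 1)
    rw [e] at hm hn
    rcases face hp (hs i) (hv i) (hv (i + 1)) hz (h1 i) (h2 i) hzt (hvne i) (hs (i - 1))
      (hs (i + 1)) ht' hn (hne i).symm htt.symm hm (h1 (i + 1)) hzt' with h | h
    · exact ⟨i, h⟩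
    · exact ⟨i + 1, h⟩
  obtain ⟨m, -, hm⟩ := Finset.exists_min_image Finset.univ (fun i => ln t p * ln t (v i))
    ⟨0, Finset.mem_univ _⟩
  obtain ⟨j, rfl⟩ : ∃ j, m = j + 1 := ⟨m - 1, (sub_add_cancel m 1).symm⟩
  obtain ⟨A, B, hAB⟩ := decomp (hs j) (hs (j + 1)) (hne j) (h2 j) (h1 (j + 1)) (h1 j) (hvne j)
    (h2 (j + 1)) (hvne (j + 1)).symm t
  have hu := hm j (Finset.mem_univ _)
  have hw := hm (j + 1 + 1) (Finset.mem_univ _)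
  rw [hAB (v j), ln_of_mem (hs j) (h1 j)] at hu
  rw [hAB (v (j + 1 + 1)), ln_of_mem (hs (j + 1)) (h2 (j + 1))] at hw
  have pos1 : 0 < ln (s (j + 1)) p * ln (s (j + 1)) (v j) := by
    refine lt_of_le_of_ne (hv j _ (hs _)) (mul_ne_zero (hp.2 _ (hs _)) ?_).symm
    intro h
    exact hvne j (inter_unique (hs j) (hs (j + 1)) (hne j) (h1 j)
      (mem_of_ln (hs _) (R_sub hp (hv j)) h) (h2 j) (h1 (j + 1)))
  have pos2 : 0 < ln (s j) p * ln (s j) (v (j + 1 + 1)) := by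
    refine lt_of_le_of_ne (hv _ _ (hs _)) (mul_ne_zero (hp.2 _ (hs _)) ?_).symm
    intro h
    exact hvne (j + 1) (inter_unique (hs j) (hs (j + 1)) (hne j) (h2 j) (h1 (j + 1))
      (mem_of_ln (hs _) (R_sub hp (hv _)) h) (h2 (j + 1)))
  have q1 : 0 ≤ (ln t p * B) * ln (s (j + 1)) z := by
    refine sign_trans (a := ln (s (j + 1)) (v j)) ?_ (by linarith) ?_
    · rintro h; rw [h] at pos1; simp at pos1
    · exact sign_trans (hp.2 _ (hs _)) pos1.le (hz _ (hs _))
  have q2 : 0 ≤ (ln t p * A) * ln (s j) z := by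
    refine sign_trans (a := ln (s j) (v (j + 1 + 1))) ?_ (by linarith) ?_
    · rintro h; rw [h] at pos2; simp at pos2
    · exact sign_trans (hp.2 _ (hs _)) pos2.le (hz _ (hs _))
  have q3 := hv (j + 1) t ht
  have q4 := ln_of_mem ht hzt
  have q5 : ln t p * ln t (v (j + 1)) + (ln t p * A) * ln (s j) z +
      (ln t p * B) * ln (s (j + 1)) z = 0 := by
    rw [hAB z] at q4; linear_combination ln t p * q4
  have q6 : ln t p * ln t (v (j + 1)) = 0 := by linarith
  have q7 := mem_of_ln ht (R_sub hp (hv _)) ((mul_eq_zero.1 q6).resolve_left (hp.2 t ht))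
  rcases three (hs j) (hs (j + 1)) (hne j) (h2 j) (h1 (j + 1)) ht q7 with h | h
  · exact ⟨_, h⟩
  · exact ⟨_, h⟩

/-- No chord separates `x` and `y`. -/
def Uns (Δ : TBA) (x y : Pt) : Prop := ∀ t ∈ Δ.Sbar, 0 ≤ ln t x * ln t y

theorem Uns.symm (h : Uns Δ x y) : Uns Δ y x := fun t ht => by rw [mul_comm]; exact h t ht

/-- A generic point of a blocking segment close to `d`. -/
theorem near (hβ : β ∈ Δ.B) (hd : d ∈ β) (hx : x ∈ β) (hxd : x ≠ d) :
    ∃ p, Gen Δ p ∧ p ∈ β ∧ (∀ s ∈ Δ.Sbar, d ∈ s → 0 < ln s p * ln s x) ∧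
      (∀ s ∈ Δ.Sbar, d ∉ s → 0 < ln s p * ln s d) := by
  have hdT := blk_sub hβ hd
  have hev : ∀ᶠ ε in nhdsWithin (0 : ℝ) (Ioi 0), ∀ s ∈ Δ.Sbar, d ∉ s →
      0 < ln s (mv d x ε) * ln s d := by
    rw [Filter.eventually_all_finite Δ.Sbar_fin]
    intro s hs
    by_cases hds : d ∈ s
    · exact Filter.Eventually.of_forall fun ε h => absurd hds h
    have h0 : ln s d ≠ 0 := fun h => hds (mem_of_ln hs hdT h)
    have hc : Continuous fun ε : ℝ => ln s (mv d x ε) * ln s d := by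
      simp only [ln_mv]; fun_prop
    have h1 : ∀ᶠ ε in nhds (0 : ℝ), 0 < ln s (mv d x ε) * ln s d := by
      refine hc.continuousAt.eventually (lt_mem_nhds ?_)
      simp only [mv_zero]; exact mul_self_pos.2 h0
    exact (h1.filter_mono nhdsWithin_le_nhds).mono fun ε h _ => h
  have hlt : ∀ᶠ ε in nhdsWithin (0 : ℝ) (Ioi 0), ε ∈ Ioo (0 : ℝ) 1 :=
    Ioo_mem_nhdsGT (by norm_num)
  obtain ⟨ε, h1, h2, h3⟩ := (hev.and hlt).exists
  have hmem : mv d x ε ∈ β := mv_mem (blk_convex hβ) hd hx h2.le h3.le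
  have hon : ∀ s ∈ Δ.Sbar, d ∈ s → 0 < ln s (mv d x ε) * ln s x := by
    intro s hs hds
    have h0 : ln s x ≠ 0 := fun h =>
      hxd (blk_unique hβ hs hx (mem_of_ln hs (blk_sub hβ hx) h) hd hds)
    rw [ln_mv, ln_of_mem hs hds]
    nlinarith [mul_self_pos.2 h0]
  refine ⟨mv d x ε, ⟨blk_sub hβ hmem, fun s hs h => ?_⟩, hmem, hon, h1⟩
  by_cases hds : d ∈ s
  · have := hon s hs hds; rw [h] at this; simp at this
  · have := h1 s hs hds; rw [h] at this; simp at this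

/-- A blocking segment entering a minimal region at `v` leaves it at another vertex. -/
theorem blk_exit (hβ : β ∈ Δ.B) (hp : Gen Δ p) (hpβ : p ∈ β) (hv : v ∈ β) (hvp : v ≠ p) :
    ∃ z ∈ R Δ p, z ∈ β ∧ Δ.IsVertex z ∧ ∀ s ∈ Δ.Sbar, v ∈ s → 0 < ln s p * ln s z := by
  have hpb : p ∉ Δ.bdry := by
    intro h
    obtain ⟨κ, hκ, hpκ⟩ := mem_bdry.1 h
    exact hp.2 κ (Or.inr hκ) (ln_of_mem (Or.inr hκ) hpκ)
  obtain ⟨τ, hτ, heβ, heb⟩ := blk_extend hβ hv hpβ hvp hpb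
  obtain ⟨κ, hκ, heκ⟩ := mem_bdry.1 heb
  obtain ⟨t, ht0, ht1, hR, f, hf, -, hf0⟩ := hit (y := mv v p τ) hp (C_sub_R (mem_C_self hp))
    (fun s hs h => absurd h (hp.2 s hs))
    ⟨κ, Or.inr hκ, hp.2 _ (Or.inr hκ), by rw [ln_of_mem (Or.inr hκ) heκ, mul_zero]⟩
  have hmem : mv p (mv v p τ) t ∈ β := mv_mem (blk_convex hβ) hpβ heβ ht0.le ht1
  have hzf := mem_of_ln hf (R_sub hp hR) hf0
  obtain ⟨f', hf', hff', hzf'⟩ := blk_second hβ hf hmem hzf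
  refine ⟨_, hR, hmem, ⟨f, hf, f', hf', hff'.symm, hzf, hzf'⟩, ?_⟩
  intro s hs hvs
  rw [ln_mv, ln_mv, ln_of_mem hs hvs]
  have h1 := mem_C_self hp s hs
  have h2 := mul_pos ht0 (sub_pos.2 hτ)
  nlinarith [mul_pos h2 h1]

theorem near_mem {d : Pt}
    (h1 : ∀ s ∈ Δ.Sbar, d ∈ s → 0 < ln s p * ln s x)
    (h2 : ∀ s ∈ Δ.Sbar, d ∉ s → 0 < ln s p * ln s d) (hw : Uns Δ d w)
    {a b : Set Pt} (ha : a ∈ Δ.Sbar) (hb : b ∈ Δ.Sbar) (hab : a ≠ b) (hda : d ∈ a) (hdb : d ∈ b)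
    (hxa : 0 ≤ ln a x * ln a w) (hxb : 0 ≤ ln b x * ln b w) : w ∈ R Δ p := by
  intro s hs
  by_cases hds : d ∈ s
  · rcases three ha hb hab hda hdb hs hds with rfl | rfl
    · exact nneg_of_pos (h1 _ hs hds) hxa
    · exact nneg_of_pos (h1 _ hs hds) hxb
  · exact nneg_of_pos (h2 s hs hds) (hw s hs)

end TBA

namespace TBA

variable {Δ : TBA} {X Y Z : Pt} {s s' t β β' : Set Pt} {x y z u w v p d : Pt}

theorem not_mem_of_pos {s : Set Pt} (hs : s ∈ Δ.Sbar) {a : ℝ} (h : 0 < a * ln s w) : w ∉ s :=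
  fun hw => by rw [ln_of_mem hs hw] at h; simp at h

/-- A blocking segment entering a polygon at `d` leaves it at a vertex off the two chords
through `d`. -/
theorem blk_poly {n : ℕ} [NeZero n] (v : Fin n → Pt) (s : Fin n → Set Pt)
    (hs : ∀ i, s i ∈ Δ.Sbar) (h1 : ∀ i, v i ∈ s i)
    (h2 : ∀ i, v (i + 1) ∈ s i) (hne : ∀ i, s i ≠ s (i + 1)) (hvne : ∀ i, v i ≠ v (i + 1))
    {a b : Set Pt} (ha : a ∈ Δ.Sbar) (hb : b ∈ Δ.Sbar) (hab : a ≠ b) (hda : d ∈ a) (hdb : d ∈ b)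
    (hβ : β ∈ Δ.B) (hd : d ∈ β) (hx : x ∈ β) (hxd : x ≠ d)
    (hU : ∀ i, Uns Δ d (v i) ∧ (v i ∈ a ∨ 0 < ln a x * ln a (v i)) ∧
      (v i ∈ b ∨ 0 < ln b x * ln b (v i))) :
    ∃ p, Gen Δ p ∧ p ∈ β ∧ (∀ i, v i ∈ R Δ p) ∧ ∃ i, v i ∈ β ∧ v i ∉ a ∧ v i ∉ b := by
  obtain ⟨p, hp, hpβ, n1, n2⟩ := near hβ hd hx hxd
  have hR : ∀ i, v i ∈ R Δ p := by
    intro i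
    obtain ⟨g1, g2, g3⟩ := hU i
    refine near_mem n1 n2 g1 ha hb hab hda hdb ?_ ?_
    · rcases g2 with g2 | g2
      · rw [ln_of_mem ha g2, mul_zero]
      · exact g2.le
    · rcases g3 with g3 | g3
      · rw [ln_of_mem hb g3, mul_zero]
      · exact g3.le
  have hdp : d ≠ p := by rintro rfl; exact hp.2 a ha (ln_of_mem ha hda)
  obtain ⟨z, hz, hzβ, hzv, hpos⟩ := blk_exit hβ hp hpβ hd hdp
  obtain ⟨i, rfl⟩ := poly hp v s hR hs h1 h2 hne hvne hz hzv
  exact ⟨p, hp, hpβ, hR, i, hzβ, not_mem_of_pos ha (hpos a ha hda),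
    not_mem_of_pos hb (hpos b hb hdb)⟩

/-- Triangles: a blocking segment does not enter a minimal triangle at a vertex. -/
theorem tri_block {a b h : Set Pt} {c : Pt} (ha : a ∈ Δ.Sbar) (hb : b ∈ Δ.Sbar) (hh : h ∈ Δ.Sbar)
    (ca : c ∈ a) (cb : c ∈ b) (ua : u ∈ a) (uh : u ∈ h) (vb : v ∈ b) (vh : v ∈ h)
    (hu : Uns Δ c u) (hv : Uns Δ c v) (hβ : β ∈ Δ.B) (hc : c ∈ β) (hx : x ∈ β)
    (h1 : 0 < ln b x * ln b u) (h2 : 0 < ln a x * ln a v) : False := by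
  have ub := not_mem_of_pos hb h1
  have va := not_mem_of_pos ha h2
  have hab : a ≠ b := by rintro rfl; exact ub ua
  have hxc : x ≠ c := by rintro rfl; rw [ln_of_mem ha ca] at h2; simp at h2
  have hUc : Uns Δ c c := fun t _ => mul_self_nonneg _
  obtain ⟨-, -, -, -, i, -, h3, h4⟩ := blk_poly ![c, u, v] ![a, h, b]
    (by intro i; fin_cases i; exacts [ha, hh, hb])
    (by intro i; fin_cases i; exacts [ca, uh, vb])
    (by intro i; fin_cases i; exacts [ua, vh, cb])
    (by intro i; fin_cases i
        exacts [fun e : a = h => va (e ▸ vh), fun e : h = b => ub (e ▸ uh), hab.symm])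
    (by intro i; fin_cases i
        exacts [fun e : c = u => ub (e ▸ cb), fun e : u = v => ub (e ▸ vb),
          fun e : v = c => va (e ▸ ca)]) ha hb hab ca cb hβ hc hx hxc
    (by intro i; fin_cases i
        exacts [⟨hUc, Or.inl ca, Or.inl cb⟩, ⟨hu, Or.inl ua, Or.inr h1⟩,
          ⟨hv, Or.inr h2, Or.inl vb⟩])
  fin_cases i
  exacts [h3 ca, h3 ua, h4 vb]

/-- Quadrilaterals: a blocking segment entering at `d` leaves at the opposite vertex. -/
theorem quad_block {a h b k : Set Pt} {d e e' d' : Pt} (ha : a ∈ Δ.Sbar) (hh : h ∈ Δ.Sbar)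
    (hb : b ∈ Δ.Sbar) (hk : k ∈ Δ.Sbar) (hbk : b ≠ k) (da : d ∈ a) (dh : d ∈ h)
    (eh : e ∈ h) (eb : e ∈ b) (eb' : e' ∈ b) (ek' : e' ∈ k) (dk' : d' ∈ k) (da' : d' ∈ a)
    (u1 : Uns Δ d e) (u2 : Uns Δ d e') (u3 : Uns Δ d d') (hβ : β ∈ Δ.B) (hd : d ∈ β) (hx : x ∈ β)
    (h1 : 0 < ln a x * ln a e) (h2 : 0 < ln a x * ln a e') (h3 : 0 < ln h x * ln h e')
    (h4 : 0 < ln h x * ln h d') : e' ∈ β := by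
  have ea := not_mem_of_pos ha h1
  have ea' := not_mem_of_pos ha h2
  have eh' := not_mem_of_pos hh h3
  have dh' := not_mem_of_pos hh h4
  have hah : a ≠ h := by rintro rfl; exact ea eh
  have hxd : x ≠ d := by rintro rfl; rw [ln_of_mem ha da] at h2; simp at h2
  have hUd : Uns Δ d d := fun t _ => mul_self_nonneg _
  obtain ⟨-, -, -, -, i, h5, h6, h7⟩ := blk_poly ![d, e, e', d'] ![h, b, k, a]
    (by intro i; fin_cases i; exacts [hh, hb, hk, ha])
    (by intro i; fin_cases i; exacts [dh, eb, ek', da'])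
    (by intro i; fin_cases i; exacts [eh, eb', dk', da])
    (by intro i; fin_cases i
        exacts [fun q : h = b => eh' (q ▸ eb'), hbk, fun q : k = a => ea' (q ▸ ek'), hah])
    (by intro i; fin_cases i
        exacts [fun q : d = e => ea (q ▸ da), fun q : e = e' => eh' (q ▸ eh),
          fun q : e' = d' => ea' (q ▸ da'), fun q : d' = d => dh' (q ▸ dh)])
    ha hh hah da dh hβ hd hx hxd
    (by intro i; fin_cases i
        exacts [⟨hUd, Or.inl da, Or.inl dh⟩, ⟨u1, Or.inr h1, Or.inl eh⟩,
          ⟨u2, Or.inr h2, Or.inr h3⟩, ⟨u3, Or.inl da', Or.inr h4⟩])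
  fin_cases i
  exacts [absurd da h6, absurd eh h7, h5, absurd da' h6]

/-- Pentagons: in a strong arrangement no blocking segment enters a minimal pentagon at a
vertex. -/
theorem pent_block (hst : Δ.Strong) {s₁ s₂ s₃ s₄ s₅ : Set Pt} {v₁ v₂ v₃ v₄ v₅ : Pt}
    (m1 : s₁ ∈ Δ.Sbar) (m2 : s₂ ∈ Δ.Sbar) (m3 : s₃ ∈ Δ.Sbar) (m4 : s₄ ∈ Δ.Sbar) (m5 : s₅ ∈ Δ.Sbar)
    (n15 : s₁ ≠ s₅) (n45 : s₄ ≠ s₅) (n14 : s₁ ≠ s₄)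
    (i11 : v₁ ∈ s₁) (i21 : v₂ ∈ s₁) (i22 : v₂ ∈ s₂) (i32 : v₃ ∈ s₂) (i33 : v₃ ∈ s₃) (i43 : v₄ ∈ s₃)
    (i44 : v₄ ∈ s₄) (i54 : v₅ ∈ s₄) (i55 : v₅ ∈ s₅) (i15 : v₁ ∈ s₅)
    (u1 : Uns Δ v₃ v₁) (u2 : Uns Δ v₃ v₂) (u4 : Uns Δ v₃ v₄) (u5 : Uns Δ v₃ v₅)
    (hβ : β ∈ Δ.B) (hv : v₃ ∈ β) (hx : x ∈ β)
    (a1 : 0 < ln s₃ x * ln s₃ v₁) (a2 : 0 < ln s₃ x * ln s₃ v₂) (a5 : 0 < ln s₃ x * ln s₃ v₅)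
    (b1 : 0 < ln s₂ x * ln s₂ v₁) (b4 : 0 < ln s₂ x * ln s₂ v₄) (b5 : 0 < ln s₂ x * ln s₂ v₅) :
    False := by
  have c31 := not_mem_of_pos m3 a1
  have c32 := not_mem_of_pos m3 a2
  have c35 := not_mem_of_pos m3 a5
  have c21 := not_mem_of_pos m2 b1
  have c24 := not_mem_of_pos m2 b4
  have c25 := not_mem_of_pos m2 b5
  have e23 : s₂ ≠ s₃ := by rintro rfl; exact c32 i22
  have hxd : x ≠ v₃ := by rintro rfl; rw [ln_of_mem m3 i33] at a1; simp at a1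
  have hUd : Uns Δ v₃ v₃ := fun t _ => mul_self_nonneg _
  have k14 : v₁ ∉ s₄ := fun h => by
    rcases three m1 m5 n15 i11 i15 m4 h with h | h
    · exact n14 h.symm
    · exact n45 h
  have k51 : v₅ ∉ s₁ := fun h => by
    rcases three m4 m5 n45 i54 i55 m1 h with h | h
    · exact n14 h
    · exact n15 h
  have w12 : v₁ ≠ v₂ := fun q => c21 (q ▸ i22)
  have w13 : v₁ ≠ v₃ := fun q => c21 (q ▸ i32)
  have w14 : v₁ ≠ v₄ := fun q => c31 (q ▸ i43)
  have w15 : v₁ ≠ v₅ := fun q => k14 (q ▸ i54)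
  have w23 : v₂ ≠ v₃ := fun q => c32 (q ▸ i33)
  have w24 : v₂ ≠ v₄ := fun q => c32 (q ▸ i43)
  have w25 : v₂ ≠ v₅ := fun q => c25 (q ▸ i22)
  have w34 : v₃ ≠ v₄ := fun q => c24 (q ▸ i32)
  have w35 : v₃ ≠ v₅ := fun q => c25 (q ▸ i32)
  have w45 : v₄ ≠ v₅ := fun q => c35 (q ▸ i43)
  obtain ⟨p, hp, hpβ, hR, i, h5, h6, h7⟩ := blk_poly ![v₁, v₂, v₃, v₄, v₅] ![s₁, s₂, s₃, s₄, s₅]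
    (by intro i; fin_cases i; exacts [m1, m2, m3, m4, m5])
    (by intro i; fin_cases i; exacts [i11, i22, i33, i44, i55])
    (by intro i; fin_cases i; exacts [i21, i32, i43, i54, i15])
    (by intro i; fin_cases i
        exacts [fun q : s₁ = s₂ => c21 (q ▸ i11), e23, fun q : s₃ = s₄ => c35 (q ▸ i54), n45,
          n15.symm])
    (by intro i; fin_cases i; exacts [w12, w23, w34, w45, w15.symm])
    m2 m3 e23 i32 i33 hβ hv hx hxd
    (by intro i; fin_cases i
        exacts [⟨u1, Or.inr b1, Or.inr a1⟩, ⟨u2, Or.inl i22, Or.inr a2⟩,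
          ⟨hUd, Or.inl i32, Or.inl i33⟩, ⟨u4, Or.inr b4, Or.inl i43⟩, ⟨u5, Or.inr b5, Or.inr a5⟩])
  have x1 : Δ.IsVertex v₁ := isVertex m1 m5 n15 i11 i15
  have x5 : Δ.IsVertex v₅ := isVertex m4 m5 n45 i54 i55
  have x3 : Δ.IsVertex v₃ := isVertex m2 m3 e23 i32 i33
  have x2 : Δ.IsVertex v₂ := isVertex m1 m2 (fun q => c21 (q ▸ i11)) i21 i22
  have x4 : Δ.IsVertex v₄ := isVertex m3 m4 (fun q => c35 (q ▸ i54)) i43 i44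
  have r1 : v₁ ∈ R Δ p := hR 0
  have r2 : v₂ ∈ R Δ p := hR 1
  have r3 : v₃ ∈ R Δ p := hR 2
  have r4 : v₄ ∈ R Δ p := hR 3
  have r5 : v₅ ∈ R Δ p := hR 4
  fin_cases i
  · refine k14 (strong_five hst hp (v₁ := v₁) (v₂ := v₂) (v₃ := v₃) (v₄ := v₄) (v₅ := v₅) ?_ ?_
      m1 m2 m3 m4 i11 i21 i22 i32 i33 i43 i44 i54 hβ hv hpβ h5 i11)
    · simp only [List.mem_cons, List.not_mem_nil, or_false, forall_eq_or_imp, forall_eq]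
      exact ⟨⟨r1, x1⟩, ⟨r2, x2⟩, ⟨r3, x3⟩, ⟨r4, x4⟩, ⟨r5, x5⟩⟩
    · simp [*]
  · exact h6 i22
  · exact h6 i32
  · exact h7 i43
  · refine k51 (strong_five hst hp (v₁ := v₅) (v₂ := v₄) (v₃ := v₃) (v₄ := v₂) (v₅ := v₁) ?_ ?_
      m4 m3 m2 m1 i54 i44 i43 i33 i32 i22 i21 i11 hβ hv hpβ h5 i54)
    · simp only [List.mem_cons, List.not_mem_nil, or_false, forall_eq_or_imp, forall_eq]
      exact ⟨⟨r5, x5⟩, ⟨r4, x4⟩, ⟨r3, x3⟩, ⟨r2, x2⟩, ⟨r1, x1⟩⟩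
    · simp [w12.symm, w13.symm, w14.symm, w15.symm, w23.symm, w24.symm, w25.symm, w34.symm,
        w35.symm, w45.symm]

/-- If `β(d)` runs inside a minimal region from `d` to a point `e'` on the line of the edge
beyond a neighbour `c` of `d`, then the edge following the other neighbour `d⁺` of `d` also
passes through `e'`. -/
theorem forced (hst : Δ.Strong) {a b h : Set Pt} {c e' : Pt} (ha : a ∈ Δ.Sbar) (hb : b ∈ Δ.Sbar)
    (hh : h ∈ Δ.Sbar) (hah : a ≠ h) (hab : a ≠ b) (hp : Gen Δ p) (hβ : β ∈ Δ.B) (hd : d ∈ β)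
    (hpβ : p ∈ β) (hdR : d ∈ R Δ p) (da : d ∈ a) (dh : d ∈ h) (hcR : c ∈ R Δ p) (hcd : c ≠ d)
    (ca : c ∈ a) (cb : c ∈ b) (heβ : e' ∈ β) (heb : e' ∈ b) :
    ∃ dp ∈ R Δ p, dp ≠ d ∧ dp ∈ h ∧ ∃ f ∈ Δ.Sbar, f ≠ h ∧ f ≠ b ∧ dp ∈ f ∧ e' ∈ f := by
  have hdp : d ≠ p := by rintro rfl; exact hp.2 a ha (ln_of_mem ha da)
  have db : d ∉ b := fun h => hcd (inter_unique ha hb hab ca cb da h)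
  have ch : c ∉ h := fun h => hcd (inter_unique ha hh hah ca h da dh)
  have hbh : b ≠ h := by rintro rfl; exact ch cb
  obtain ⟨v₁, r1, v1c, v1b, f₁, hf₁, f1b, f1a, v1f⟩ := step hp hcR hb ha hab.symm cb ca
  obtain ⟨dp, rp, dpd, dph, f, hf, fh, fa, dpf⟩ := step hp hdR hh ha hah.symm dh da
  have dpa : dp ∉ a := fun h => dpd (inter_unique ha hh hah h dph da dh)
  have v1a : v₁ ∉ a := fun h => v1c (inter_unique ha hb hab h v1b ca cb)
  obtain ⟨z, zR, zβ, zv, zpos⟩ := blk_exit hβ hp hpβ hd hdp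
  have za := not_mem_of_pos ha (zpos a ha da)
  have zh := not_mem_of_pos hh (zpos h hh dh)
  have dpb : dp ∉ b := by
    intro dpb
    obtain ⟨i, rfl⟩ := poly hp ![d, c, dp] ![a, b, h]
      (by intro i; fin_cases i; exacts [hdR, hcR, rp])
      (by intro i; fin_cases i; exacts [ha, hb, hh])
      (by intro i; fin_cases i; exacts [da, cb, dph])
      (by intro i; fin_cases i; exacts [ca, dpb, dh])
      (by intro i; fin_cases i; exacts [hab, hbh, hah.symm])
      (by intro i; fin_cases i
          exacts [hcd.symm, fun q : c = dp => ch (q ▸ dph), dpd]) zR zv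
    fin_cases i
    exacts [za da, za ca, zh dph]
  have fb : f ≠ b := by rintro rfl; exact dpb dpf
  refine ⟨dp, rp, dpd, dph, f, hf, fh, fb, dpf, ?_⟩
  obtain ⟨v₅, r5, v5p, v5f, f₅, hf₅, f5f, f5h, v5f5⟩ := step hp rp hf hh fh dpf dph
  by_cases h15 : v₁ = v₅
  · subst h15
    obtain ⟨i, rfl⟩ := poly hp ![d, c, v₁, dp] ![a, b, f, h]
      (by intro i; fin_cases i; exacts [hdR, hcR, r1, rp])
      (by intro i; fin_cases i; exacts [ha, hb, hf, hh])
      (by intro i; fin_cases i; exacts [da, cb, v5f, dph])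
      (by intro i; fin_cases i; exacts [ca, v1b, dpf, dh])
      (by intro i; fin_cases i; exacts [hab, fb.symm, fh, hah.symm])
      (by intro i; fin_cases i
          exacts [hcd.symm, v1c.symm, fun q : v₁ = dp => dpb (q ▸ v1b), dpd]) zR zv
    fin_cases i
    · exact absurd da za
    · exact absurd ca za
    · rwa [blk_unique hβ hb heβ heb zβ v1b]
    · exact absurd dph zh
  · have cf : c ∉ f := fun h => by
      rcases three ha hb hab ca cb hf h with q | q
      · exact fa q
      · exact fb q
    have df : d ∉ f := fun h => by
      rcases three ha hh hah da dh hf h with q | q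
      · exact fa q
      · exact fh q
    refine strong_five hst hp (v₁ := v₁) (v₂ := c) (v₃ := d) (v₄ := dp) (v₅ := v₅) ?_ ?_
      hb ha hh hf v1b cb ca da dh dph dpf v5f hβ hd hpβ heβ heb
    · simp only [List.mem_cons, List.not_mem_nil, or_false, forall_eq_or_imp, forall_eq]
      exact ⟨⟨r1, isVertex hb hf₁ f1b.symm v1b v1f⟩, ⟨hcR, isVertex ha hb hab ca cb⟩,
        ⟨hdR, isVertex ha hh hah da dh⟩, ⟨rp, isVertex hh hf fh.symm dph dpf⟩,
        ⟨r5, isVertex hf hf₅ f5f.symm v5f v5f5⟩⟩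
    · have k1 : v₁ ≠ d := fun q => db (q ▸ v1b)
      have k2 : v₁ ≠ dp := fun q => dpb (q ▸ v1b)
      have k3 : c ≠ dp := fun q => ch (q ▸ dph)
      have k4 : c ≠ v₅ := fun q => cf (q ▸ v5f)
      have k5 : d ≠ v₅ := fun q => df (q ▸ v5f)
      simp [v1c, k1, k2, h15, hcd, k3, k4, dpd.symm, k5, v5p.symm]

theorem blk_ne (hβ : β ∈ Δ.B) (d : Pt) : ∃ x ∈ β, x ≠ d := by
  obtain ⟨a, b, hab, rfl, -⟩ := Δ.seg_wf β (Or.inr hβ)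
  by_cases h : a = d
  · exact ⟨b, right_mem_segment _ _ _, fun q => hab (h.trans q.symm)⟩
  · exact ⟨a, left_mem_segment _ _ _, h⟩

theorem blk_ln_ne (hβ : β ∈ Δ.B) (hs : s ∈ Δ.Sbar) (hd : d ∈ β) (hds : d ∈ s) (hx : x ∈ β)
    (hxd : x ≠ d) : ln s x ≠ 0 := fun h =>
  hxd (blk_unique hβ hs hx (mem_of_ln hs (blk_sub hβ hx) h) hd hds)

/-- A blocking segment continues beyond an interior vertex. -/
theorem blk_opp (hβ : β ∈ Δ.B) (hd : d ∈ β) (hdb : d ∉ Δ.bdry) (hx : x ∈ β) (hxd : x ≠ d) :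
    ∃ y ∈ β, y ≠ d ∧ ∀ s ∈ Δ.Sbar, d ∈ s → ln s x * ln s y < 0 := by
  obtain ⟨τ, hτ, h1, h2⟩ := blk_extend hβ hx hd hxd hdb
  refine ⟨_, h1, fun h => hdb (h ▸ h2), fun s hs hds => ?_⟩
  rw [ln_mv, ln_of_mem hs hds]
  have := mul_self_pos.2 (blk_ln_ne hβ hs hd hds hx hxd)
  nlinarith [mul_pos (sub_pos.2 hτ) this]

theorem blk_side (hβ : β ∈ Δ.B) (hd : d ∈ β) (hdb : d ∉ Δ.bdry) (hs : s ∈ Δ.Sbar) (hds : d ∈ s)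
    {r : ℝ} (hr : r ≠ 0) : ∃ x ∈ β, x ≠ d ∧ 0 < r * ln s x := by
  obtain ⟨x, hx, hxd⟩ := blk_ne hβ d
  obtain ⟨y, hy, hyd, hxy⟩ := blk_opp hβ hd hdb hx hxd
  have h0 := blk_ln_ne hβ hs hd hds hx hxd
  rcases lt_or_gt_of_ne (mul_ne_zero hr h0) with h | h
  · exact ⟨y, hy, hyd, nn (by rw [mul_comm]; exact h) (hxy s hs hds)⟩
  · exact ⟨x, hx, hxd, h⟩

/-- At an interior vertex outside the entering quadrant and its opposite. -/
theorem blk_turn {a h : Set Pt} (hβ : β ∈ Δ.B) (hd : d ∈ β) (ha : a ∈ Δ.S) (hh : h ∈ Δ.S)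
    (hah : a ≠ h) (da : d ∈ a) (dh : d ∈ h) {r q : ℝ} (hr : r ≠ 0) (hq : q ≠ 0)
    (hno : ∀ x ∈ β, 0 < ln h x * r → 0 < ln a x * q → False) :
    ∃ x ∈ β, ∃ y ∈ β, x ≠ d ∧ y ≠ d ∧ ln h x * r < 0 ∧ 0 < ln a x * q ∧ 0 < ln h y * r ∧
      ln a y * q < 0 := by
  have hdb := S_inter_not_bdry ha hh hah da dh
  obtain ⟨y, hy, hyd, h1⟩ := blk_side hβ hd hdb (Or.inl hh) dh hr
  obtain ⟨x, hx, hxd, h2⟩ := blk_opp hβ hd hdb hy hyd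
  have h3 := h2 h (Or.inl hh) dh
  have h4 := h2 a (Or.inl ha) da
  have h0 := blk_ln_ne hβ (Or.inl ha) hd da hy hyd
  have h5 : ln a y * q < 0 := by
    rcases lt_or_gt_of_ne (mul_ne_zero h0 hq) with h | h
    · exact h
    · exact (hno y hy (by linarith) h).elim
  refine ⟨x, hx, y, hy, hxd, hyd, ?_, nn h4 h5, by linarith, h5⟩
  exact npos (a := ln h y) (b := r) (c := ln h x) (by linarith) h3 |> fun q => by linarith

/-- A minimal triangle `(c, d, e)` next to a minimal quadrilateral `(d, e, e', d')`:
the chord `k = e'd'` crosses the common chord `h` beyond `d`. -/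
theorem tri_quad_half (hst : Δ.Strong) {a b h k : Set Pt} {c d e e' d' : Pt}
    (ha : a ∈ Δ.S) (hb : b ∈ Δ.Sbar) (hh : h ∈ Δ.S) (hk : k ∈ Δ.Sbar) (hbk : b ≠ k)
    (ca : c ∈ a) (cb : c ∈ b) (da : d ∈ a) (dh : d ∈ h) (eb : e ∈ b) (eh : e ∈ h)
    (eb' : e' ∈ b) (ek' : e' ∈ k) (da' : d' ∈ a) (dk' : d' ∈ k)
    (u1 : Uns Δ d c) (u2 : Uns Δ d e) (u3 : Uns Δ d e') (u4 : Uns Δ d d')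
    (h1 : ln h c * ln h e' < 0) (h2 : ln h c * ln h d' < 0) (h3 : 0 < ln a e * ln a e') :
    ∃ z ∈ h, z ∈ k ∧ ln a z * ln a e < 0 := by
  have ha' : a ∈ Δ.Sbar := Or.inl ha
  have hh' : h ∈ Δ.Sbar := Or.inl hh
  have hce : ln h c ≠ 0 := by intro q; rw [q] at h1; simp at h1
  have hae : ln a e ≠ 0 := by intro q; rw [q] at h3; simp at h3
  have hah : a ≠ h := by rintro rfl; exact hae (ln_of_mem ha' eh)
  obtain ⟨β, hβ, hd⟩ := blk_ex ha hh' hah da dh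
  obtain ⟨x, hx, y, hy, hxd, hyd, x1, x2, y1, y2⟩ := blk_turn hβ hd ha hh hah da dh hce hae
    (fun x hx q1 q2 => tri_block ha' hh' hb da dh ca cb eh eb u1 u2 hβ hd hx q1 q2)
  have heβ : e' ∈ β := quad_block ha' hh' hb hk hbk da dh eh eb eb' ek' dk' da' u2 u3 u4 hβ hd hx
    x2 (ppos (a := ln a e) (by linarith) h3)
    (nn (a := ln h c) (by linarith) h1) (nn (a := ln h c) (by linarith) h2)
  obtain ⟨p, hp, hpβ, n1, n2⟩ := near hβ hd hy hyd
  have hcd : c ≠ d := by rintro rfl; exact hce (ln_of_mem hh' dh)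
  have hab : a ≠ b := by rintro rfl; exact hae (ln_of_mem ha' eb)
  have hdR : d ∈ R Δ p := near_mem n1 n2 (fun _ _ => mul_self_nonneg _) ha' hh' hah da dh
    (by rw [ln_of_mem ha' da, mul_zero]) (by rw [ln_of_mem hh' dh, mul_zero])
  have hcR : c ∈ R Δ p := near_mem n1 n2 u1 ha' hh' hah da dh
    (by rw [ln_of_mem ha' ca, mul_zero]) y1.le
  obtain ⟨z, zR, zd, zh, f, hf, fh, fb, zf, ef⟩ := forced hst ha' hb hh' hah hab hp hβ hd hpβ hdR
    da dh hcR hcd ca cb heβ eb'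
  have hfk : f = k := (three hb hk hbk eb' ek' hf ef).resolve_left fb
  subst hfk
  refine ⟨z, zh, zf, ?_⟩
  have hza : ln a z ≠ 0 := fun q =>
    zd (inter_unique ha' hh' hah (mem_of_ln ha' (R_sub hp zR) q) zh da dh)
  have q1 : 0 < ln a p * ln a z := lt_of_le_of_ne (zR a ha') (mul_ne_zero (hp.2 _ ha') hza).symm
  have q2 := n1 a ha' da
  exact npos (ppos q2 q1) y2

theorem tri_quad (hst : Δ.Strong) {a b h k : Set Pt} {c d e e' d' : Pt}
    (ha : a ∈ Δ.S) (hb : b ∈ Δ.S) (hh : h ∈ Δ.S) (hk : k ∈ Δ.Sbar) (hak : a ≠ k) (hbk : b ≠ k)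
    (ca : c ∈ a) (cb : c ∈ b) (da : d ∈ a) (dh : d ∈ h) (eb : e ∈ b) (eh : e ∈ h)
    (eb' : e' ∈ b) (ek' : e' ∈ k) (da' : d' ∈ a) (dk' : d' ∈ k)
    (u1 : Uns Δ d c) (u2 : Uns Δ d e) (u3 : Uns Δ d e') (u4 : Uns Δ d d')
    (w1 : Uns Δ e c) (w3 : Uns Δ e d') (w4 : Uns Δ e e')
    (h1 : ln h c * ln h e' < 0) (h2 : ln h c * ln h d' < 0) (h3 : 0 < ln a e * ln a e')
    (h4 : 0 < ln b d * ln b d') : False := by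
  obtain ⟨z, zh, zk, z1⟩ := tri_quad_half hst ha (Or.inl hb) hh hk hbk ca cb da dh eb eh eb' ek'
    da' dk' u1 u2 u3 u4 h1 h2 h3
  obtain ⟨z', zh', zk', z2⟩ := tri_quad_half hst hb (Or.inl ha) hh hk hak cb ca eb eh da dh da' dk'
    eb' ek' w1 u2.symm w3 w4 h2 h1 h4
  have hhk : h ≠ k := by
    rintro rfl; rw [ln_of_mem (Or.inl hh) ek'] at h1; simp at h1
  obtain rfl := inter_unique (Or.inl hh) hk hhk zh zk zh' zk'
  have hde : d ≠ e := by
    rintro rfl; rw [ln_of_mem (Or.inl ha) da] at h3; simp at h3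
  obtain ⟨τ, rfl⟩ := on_chord (Or.inl hh) hde dh eh zh
  rw [ln_mv, ln_of_mem (Or.inl ha) da] at z1
  rw [ln_mv, ln_of_mem (Or.inl hb) eb] at z2
  have k1 : τ < 0 := by
    by_contra q; push Not at q; nlinarith [mul_nonneg q (mul_self_nonneg (ln a e))]
  have k2 : 1 - τ < 0 := by
    by_contra q; push Not at q; nlinarith [mul_nonneg q (mul_self_nonneg (ln b d))]
  linarith

end TBA

namespace TBA

variable {Δ : TBA} {X Y Z : Pt} {s s' t β β' : Set Pt} {x y z u w v p d : Pt}

/-- `z` lies strictly between `x` and `y`. -/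
def Btw (x y z : Pt) : Prop := ∃ τ : ℝ, 0 < τ ∧ τ < 1 ∧ z = mv x y τ

theorem Btw.symm (h : Btw x y z) : Btw y x z := by
  obtain ⟨τ, h0, h1, rfl⟩ := h
  exact ⟨1 - τ, by linarith, by linarith, mv_symm _ _ _⟩

theorem Btw.mem {K : Set Pt} (h : Btw x y z) (hK : Convex ℝ K) (hx : x ∈ K) (hy : y ∈ K) :
    z ∈ K := by
  obtain ⟨τ, h0, h1, rfl⟩ := h
  exact mv_mem hK hx hy h0.le h1.le

theorem Btw.pos1 (h : Btw x y z) {r : ℝ} (h1 : 0 < r * ln t x) (h2 : 0 ≤ r * ln t y) :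
    0 < r * ln t z := by
  obtain ⟨τ, h3, h4, rfl⟩ := h
  rw [ln_mv]
  nlinarith [mul_pos (sub_pos.2 h4) h1, mul_nonneg h3.le h2]

theorem Btw.pos2 (h : Btw x y z) {r : ℝ} (h1 : 0 ≤ r * ln t x) (h2 : 0 < r * ln t y) :
    0 < r * ln t z := h.symm.pos1 h2 h1

theorem Btw.nonneg (h : Btw x y z) {r : ℝ} (h1 : 0 ≤ r * ln t x) (h2 : 0 ≤ r * ln t y) :
    0 ≤ r * ln t z := by
  obtain ⟨τ, h3, h4, rfl⟩ := h
  rw [ln_mv]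
  nlinarith [mul_nonneg (sub_pos.2 h4).le h1, mul_nonneg h3.le h2]

theorem Btw.sep (h : Btw x y z) (hz : ln t x * ln t z < 0) : ln t x * ln t y < 0 := by
  by_contra q
  push Not at q
  exact absurd (h.nonneg (mul_self_nonneg (ln t x)) q) (not_le.2 hz)

/-- A chord separates the endpoints of a segment as soon as it meets it strictly inside. -/
theorem Btw.sep_of_zero (h : Btw x y z) (h0 : ln t z = 0) (hx : ln t x ≠ 0) :
    ln t x * ln t y < 0 := by
  by_contra q
  push Not at q
  have := h.pos1 (mul_self_pos.2 hx) q
  rw [h0] at this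
  simp at this

theorem exists_btw (hs : s ∈ Δ.Sbar) (ht : t ∈ Δ.Sbar) (hx : x ∈ s) (hy : y ∈ s)
    (h : ln t x * ln t y < 0) : ∃ z ∈ t, z ∈ s ∧ Btw x y z := by
  have hd : ln t x - ln t y ≠ 0 := by
    exact fun q => absurd h (not_lt.2 (by rw [sub_eq_zero.1 q]; exact mul_self_nonneg _))
  have e : Btw x y (mv x y (ln t x / (ln t x - ln t y))) := by
    refine ⟨_, ?_, ?_, rfl⟩
    · rcases pos_of_mul h with ⟨h1, h2⟩ | ⟨h1, h2⟩
      · exact div_pos_of_neg_of_neg h1 (by linarith)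
      · exact div_pos h1 (by linarith)
    · rcases pos_of_mul h with ⟨h1, h2⟩ | ⟨h1, h2⟩
      · rw [div_lt_one_of_neg (by linarith)]; linarith
      · rw [div_lt_one (by linarith)]; linarith
  have hz := e.mem (Sbar_convex hs) hx hy
  refine ⟨_, mem_of_ln ht (Sbar_sub hs hz) ?_, hz, e⟩
  rw [ln_mv]
  field_simp
  ring

/-- Among the chords separating two points of a chord `s`, the one met first. -/
theorem nearest (hs : s ∈ Δ.Sbar) (hx : x ∈ s) (hy : y ∈ s)
    (h : ∃ t ∈ Δ.Sbar, ln t x * ln t y < 0) :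
    ∃ t ∈ Δ.Sbar, ln t x * ln t y < 0 ∧ ∃ z ∈ t, z ∈ s ∧ Btw x y z ∧ Uns Δ x z := by
  obtain ⟨t, ⟨ht, htx⟩, hmin⟩ := Set.exists_min_image {t ∈ Δ.Sbar | ln t x * ln t y < 0}
    (fun t => ln t x / (ln t x - ln t y)) ((Sbar_fin Δ).subset (sep_subset _ _)) h
  obtain ⟨z, hzt, hzs, hz⟩ := exists_btw hs ht hx hy htx
  refine ⟨t, ht, htx, z, hzt, hzs, hz, fun r hr => ?_⟩
  by_contra q
  push Not at q
  have hq := hz.sep q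
  have hm := hmin r ⟨hr, hq⟩
  obtain ⟨τ, h0, h1, rfl⟩ := hz
  have e1 : ln t (mv x y τ) = 0 := ln_of_mem ht hzt
  rw [ln_mv] at e1 q
  have hd : ln t x - ln t y ≠ 0 := by
    exact fun q => absurd htx (not_lt.2 (by rw [sub_eq_zero.1 q]; exact mul_self_nonneg _))
  have e2 : ln t x / (ln t x - ln t y) = τ := by
    rw [div_eq_iff hd]; linarith
  simp only [e2] at hm
  rcases pos_of_mul hq with ⟨h1, h2⟩ | ⟨h1, h2⟩
  · rw [le_div_iff_of_neg (by linarith)] at hm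
    nlinarith
  · rw [le_div_iff₀ (by linarith)] at hm
    nlinarith

theorem Uns.of_via (h1 : Uns Δ z x) (h2 : Uns Δ z y) (hs : s ∈ Δ.Sbar) (hs' : s' ∈ Δ.Sbar)
    (hne : s ≠ s') (hz : z ∈ s) (hz' : z ∈ s') (hx : x ∈ s ∨ y ∈ s) (hy : x ∈ s' ∨ y ∈ s') :
    Uns Δ x y := by
  intro t ht
  by_cases h0 : ln t z = 0
  · have hzT := Sbar_sub hs hz
    have : x ∈ t ∨ y ∈ t := by
      rcases three hs hs' hne hz hz' ht (mem_of_ln ht hzT h0) with rfl | rfl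
      exacts [hx, hy]
    rcases this with h | h <;> rw [ln_of_mem ht h] <;> simp
  · exact sign_trans h0 (h1 t ht) (h2 t ht)

/-- The inductive configuration: a minimal triangle `(y₀, y₁, q₂)` next to the triangle
`(q', q₂, κ)`. -/
theorem crossing_single_core (hst : Δ.Strong) {a g₁ g₂ g₃ : Set Pt} {y₀ y₁ q₂ q' κ : Pt}
    (ha : a ∈ Δ.S) (hg₁ : g₁ ∈ Δ.S) (hg₂ : g₂ ∈ Δ.S) (hg₃ : g₃ ∈ Δ.S)
    (y₀a : y₀ ∈ a) (y₀g : y₀ ∈ g₁) (y₁g₁ : y₁ ∈ g₁) (y₁g₂ : y₁ ∈ g₂) (q₂a : q₂ ∈ a) (q₂g : q₂ ∈ g₂)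
    (q'a : q' ∈ a) (q'g : q' ∈ g₃) (κg₁ : κ ∈ g₁) (κg₃ : κ ∈ g₃)
    (u01 : Uns Δ y₀ y₁) (u20 : Uns Δ q₂ y₀) (u21 : Uns Δ q₂ y₁) (u1 : Uns Δ y₁ κ)
    (p1 : 0 < ln g₁ q₂ * ln g₁ q') (n1 : ln g₂ y₀ * ln g₂ q' < 0) (n2 : ln g₂ y₀ * ln g₂ κ < 0)
    (p2 : 0 < ln a y₁ * ln a κ)
    (hXI : (∀ t ∈ Δ.Sbar, ln t q' * ln t q₂ < 0 ↔ ln t q' * ln t κ < 0) →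
      ∀ t ∈ Δ.Sbar, ∀ t' ∈ Δ.Sbar, ln t q' * ln t q₂ < 0 → ln t' q' * ln t' q₂ < 0 → t = t') :
    False := by
  have ha' : a ∈ Δ.Sbar := Or.inl ha
  have hg₁' : g₁ ∈ Δ.Sbar := Or.inl hg₁
  have hg₂' : g₂ ∈ Δ.Sbar := Or.inl hg₂
  have hg₃' : g₃ ∈ Δ.Sbar := Or.inl hg₃
  have κa : κ ∉ a := not_mem_of_pos ha' p2
  have y₁a : y₁ ∉ a := not_mem_of_pos ha' (by rwa [mul_comm] at p2)
  have q'g₁ : q' ∉ g₁ := not_mem_of_pos hg₁' p1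
  have q₂g₁ : q₂ ∉ g₁ := not_mem_of_pos hg₁' (by rwa [mul_comm] at p1)
  have q'g₂ : q' ∉ g₂ := fun h => by rw [ln_of_mem hg₂' h] at n1; simp at n1
  have κg₂ : κ ∉ g₂ := fun h => by rw [ln_of_mem hg₂' h] at n2; simp at n2
  have y₀g₂ : y₀ ∉ g₂ := fun h => by rw [ln_of_mem hg₂' h] at n2; simp at n2
  have e31 : g₁ ≠ g₃ := by rintro rfl; exact q'g₁ q'g
  have e3a : a ≠ g₃ := by rintro rfl; exact κa κg₃
  have e32 : g₂ ≠ g₃ := by rintro rfl; exact κg₂ κg₃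
  have e12 : g₁ ≠ g₂ := by rintro rfl; exact y₀g₂ y₀g
  have e1a : g₁ ≠ a := by rintro rfl; exact q₂g₁ q₂a
  have e2a : g₂ ≠ a := by rintro rfl; exact y₁a y₁g₂
  have p3 : 0 < ln g₂ q' * ln g₂ κ := nn n1 n2
  have uq : Uns Δ q₂ κ :=
    Uns.of_via u21.symm u1 hg₁' hg₂' e12 y₁g₁ y₁g₂ (Or.inr κg₁) (Or.inl q₂g)
  have H : ∀ t ∈ Δ.Sbar, ln t q' * ln t q₂ < 0 ↔ ln t q' * ln t κ < 0 := by
    intro t ht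
    constructor
    · intro h
      have h1 := uq t ht
      rcases lt_trichotomy (ln t q' * ln t κ) 0 with h2 | h2 | h2
      · exact h2
      · have h3 : κ ∈ t := mem_of_ln ht (Sbar_sub hg₁' κg₁) (by
          rcases mul_eq_zero.1 h2 with h2 | h2
          · rw [h2] at h; simp at h
          · exact h2)
        rcases three hg₁' hg₃' e31 κg₁ κg₃ ht h3 with rfl | rfl
        · linarith
        · rw [ln_of_mem ht q'g] at h; simp at h
      · have := npos h2 h
        rw [mul_comm] at this; linarith
    · intro h
      have h1 := uq t ht
      rcases lt_trichotomy (ln t q' * ln t q₂) 0 with h2 | h2 | h2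
      · exact h2
      · have h3 : q₂ ∈ t := mem_of_ln ht (Sbar_sub ha' q₂a) (by
          rcases mul_eq_zero.1 h2 with h2 | h2
          · rw [h2] at h; simp at h
          · exact h2)
        rcases three ha' hg₂' e2a.symm q₂a q₂g ht h3 with rfl | rfl
        · rw [ln_of_mem ht q'a] at h; simp at h
        · linarith
      · have := npos h2 h
        linarith
  have hone := hXI H
  by_cases hG : ∃ t ∈ Δ.Sbar, ln t q' * ln t q₂ < 0
  · obtain ⟨l, hl, hlq⟩ := hG
    have hlk := (H l hl).1 hlq
    have q'l : q' ∉ l := fun h => by rw [ln_of_mem hl h] at hlq; simp at hlq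
    obtain ⟨v₁, v₁l, v₁a, b1⟩ := exists_btw ha' hl q'a q₂a hlq
    obtain ⟨v₅, v₅l, v₅g, b5⟩ := exists_btw hg₃' hl q'g κg₃ hlk
    have w1 : Uns Δ q₂ v₁ := by
      intro t ht
      by_contra q
      push Not at q
      have h1 := b1.symm.sep q
      rw [mul_comm] at h1
      rw [hone t ht l hl h1 hlq, ln_of_mem hl v₁l] at q
      simp at q
    have w5 : Uns Δ κ v₅ := by
      intro t ht
      by_contra q
      push Not at q
      have h1 := b5.symm.sep q
      rw [mul_comm] at h1
      rw [hone t ht l hl ((H t ht).2 h1) hlq, ln_of_mem hl v₅l] at q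
      simp at q
    obtain ⟨β, hβ, hy⟩ := blk_ex hg₁ hg₂' e12 y₁g₁ y₁g₂
    have r0 : ln g₂ y₀ ≠ 0 := fun h => by rw [h] at n1; simp at n1
    have s0 : ln g₁ q₂ ≠ 0 := fun h => by rw [h] at p1; simp at p1
    obtain ⟨x, hx, -, -, -, -, x1, x2, -, -⟩ := blk_turn hβ hy hg₁ hg₂ e12 y₁g₁ y₁g₂ r0 s0
      (fun x hx k1 k2 => tri_block hg₁' hg₂' ha' y₁g₁ y₁g₂ y₀g y₀a q₂g q₂a u01.symm u21.symm hβ hy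
        hx k1 k2)
    have x3 : 0 < ln g₂ x * ln g₂ q' := nn (a := ln g₂ y₀) (by linarith) n1
    have x4 : 0 < ln g₂ x * ln g₂ κ := nn (a := ln g₂ y₀) (by linarith) n2
    have x5 : 0 < ln g₁ x * ln g₁ q' := ppos (a := ln g₁ q₂) (by linarith) p1
    exact pent_block hst ha' hg₂' hg₁' hg₃' hl (by rintro rfl; exact q'l q'a)
      (by rintro rfl; exact q'l q'g) e3a v₁a q₂a q₂g y₁g₂ y₁g₁ κg₁ κg₃ v₅g v₅l v₁l
      (Uns.of_via u21 w1 hg₂' ha' e2a q₂g q₂a (Or.inl y₁g₂) (Or.inr v₁a)) u21.symm u1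
      (Uns.of_via u1.symm w5 hg₁' hg₃' e31 κg₁ κg₃ (Or.inl y₁g₁) (Or.inr v₅g)) hβ hy hx
      (b1.pos1 x5 x2.le) x2 (b5.pos1 x5 (by rw [ln_of_mem hg₁' κg₁]; simp))
      (b1.pos1 x3 (by rw [ln_of_mem hg₂' q₂g]; simp)) x4 (b5.pos1 x3 x4.le)
  · push Not at hG
    have w0 : Uns Δ q₂ q' := fun t ht => by rw [mul_comm]; exact hG t ht
    exact tri_quad hst hg₁ ha hg₂ hg₃' e31 e3a y₀g y₀a y₁g₁ y₁g₂ q₂a q₂g q'a q'g κg₁ κg₃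
      u01.symm u21.symm (Uns.of_via u21 w0 hg₂' ha' e2a q₂g q₂a (Or.inl y₁g₂) (Or.inr q'a)) u1
      u20 uq w0 n1 n2 p1 p2

end TBA

namespace TBA

variable {Δ : TBA} {X Y Z : Pt} {s s' t β β' : Set Pt} {x y z u w v p d : Pt}

theorem neg_mul_of_nonneg {a b c : ℝ} (h : a * b < 0) (h' : 0 ≤ b * c) (h0 : c ≠ 0) :
    a * c < 0 := by
  rcases lt_trichotomy (a * c) 0 with h1 | h1 | h1
  · exact h1
  · rcases mul_eq_zero.1 h1 with h1 | h1
    · rw [h1] at h; simp at h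
    · exact absurd h1 h0
  · have := npos h1 h
    linarith

/-- The chords separating `x` from `y`. -/
def Sp (Δ : TBA) (x y : Pt) : Set (Set Pt) := {t ∈ Δ.Sbar | ln t x * ln t y < 0}

theorem half_convex (t : Set Pt) (k : ℝ) : Convex ℝ {y | 0 ≤ k * ln t y} := by
  rw [convex_iff_segment_subset]
  intro x hx y hy z hz
  obtain ⟨τ, h0, h1, rfl⟩ := mem_seg.1 hz
  simp only [mem_ofPred_eq] at hx hy ⊢
  rw [ln_mv]
  nlinarith [mul_nonneg (sub_nonneg.2 h1) hx, mul_nonneg h0 hy]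

theorem hull_pair {c : Pt} (h1 : 0 ≤ ln t c * ln t u) (h2 : 0 ≤ ln t c * ln t v)
    (h3 : 0 ≤ ln t u * ln t v) (hx : x ∈ convexHull ℝ {c, u, v}) (hy : y ∈ convexHull ℝ {c, u, v}) :
    0 ≤ ln t x * ln t y := by
  have key : ∀ k : ℝ, 0 ≤ k * ln t c → 0 ≤ k * ln t u → 0 ≤ k * ln t v →
      ∀ x ∈ convexHull ℝ {c, u, v}, 0 ≤ k * ln t x := by
    intro k k1 k2 k3 x hx
    refine convexHull_min ?_ (half_convex t k) hx
    rintro z (rfl | rfl | rfl) <;> assumption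
  refine key _ ?_ ?_ ?_ y hy
  · rw [mul_comm]; exact key _ (mul_self_nonneg _) h1 h2 x hx
  · rw [mul_comm]; exact key _ (by rwa [mul_comm]) (mul_self_nonneg _) h3 x hx
  · rw [mul_comm]; exact key _ (by rwa [mul_comm]) (by rwa [mul_comm]) (mul_self_nonneg _) x hx

theorem Btw.of_sign {c : Pt} (h1 : Btw c v x) (h2 : Btw c v y) (h0 : ln t y = 0)
    (hpos : 0 < ln t c * ln t x) : Btw c y x := by
  obtain ⟨τ, a0, a1, rfl⟩ := h1
  obtain ⟨σ, b0, b1, rfl⟩ := h2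
  rw [ln_mv] at h0 hpos
  have hc : ln t c ≠ 0 := by intro h; rw [h] at hpos; simp at hpos
  have hlt : τ < σ := by
    by_contra q
    push Not at q
    have e : σ * ((1 - τ) * ln t c + τ * ln t v) = (σ - τ) * ln t c := by
      linear_combination τ * h0
    have : 0 < σ * (ln t c * ((1 - τ) * ln t c + τ * ln t v)) := mul_pos b0 hpos
    have e' : σ * (ln t c * ((1 - τ) * ln t c + τ * ln t v)) = (σ - τ) * (ln t c * ln t c) := by
      linear_combination ln t c * e
    nlinarith [mul_self_nonneg (ln t c)]
  refine ⟨τ / σ, div_pos a0 b0, (div_lt_one b0).2 hlt, ?_⟩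
  ext
  · simp only [mv]; field_simp; ring
  · simp only [mv]; field_simp; ring

/-- Reduction of the triangle statement `triangle_uns` to `crossing_single`. -/
theorem triangle_aux (hst : Δ.Strong) {a b κ : Set Pt} {c u v : Pt} (ha : a ∈ Δ.S) (hb : b ∈ Δ.S)
    (hκ : κ ∈ Δ.Sbar) (hab : a ≠ b) (ca : c ∈ a) (cb : c ∈ b) (ua : u ∈ a) (uκ : u ∈ κ)
    (vb : v ∈ b) (vκ : v ∈ κ) (cκ : c ∉ κ) (huv : Uns Δ u v)
    (hone : (∀ t ∈ Δ.Sbar, ln t c * ln t u < 0 ↔ ln t c * ln t v < 0) →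
      ∀ t ∈ Δ.Sbar, ∀ t' ∈ Δ.Sbar, ln t c * ln t u < 0 → ln t' c * ln t' u < 0 → t = t') :
    Uns Δ c u ∧ Uns Δ c v := by
  have ha' : a ∈ Δ.Sbar := Or.inl ha
  have hb' : b ∈ Δ.Sbar := Or.inl hb
  have aκ : a ≠ κ := by rintro rfl; exact cκ ca
  have bκ : b ≠ κ := by rintro rfl; exact cκ cb
  have H : ∀ t ∈ Δ.Sbar, ln t c * ln t u < 0 ↔ ln t c * ln t v < 0 := by
    intro t ht
    constructor
    · intro h
      refine neg_mul_of_nonneg h (huv t ht) fun h0 => ?_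
      rcases three hb' hκ bκ vb vκ ht (mem_of_ln ht (Sbar_sub hb' vb) h0) with rfl | rfl
      · rw [ln_of_mem ht cb] at h; simp at h
      · rw [ln_of_mem ht uκ] at h; simp at h
    · intro h
      refine neg_mul_of_nonneg h (huv.symm t ht) fun h0 => ?_
      rcases three ha' hκ aκ ua uκ ht (mem_of_ln ht (Sbar_sub ha' ua) h0) with rfl | rfl
      · rw [ln_of_mem ht ca] at h; simp at h
      · rw [ln_of_mem ht vκ] at h; simp at h
  have hone := hone H
  by_cases hG : ∃ t ∈ Δ.Sbar, ln t c * ln t u < 0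
  · exfalso
    obtain ⟨h, hh, h2⟩ := hG
    have h1 := (H h hh).1 h2
    obtain ⟨d, dh, da, bd⟩ := exists_btw ha' hh ca ua h2
    obtain ⟨e, eh, eb, be⟩ := exists_btw hb' hh cb vb h1
    have ucd : Uns Δ c d := by
      intro t ht
      by_contra q
      push Not at q
      rw [hone t ht h hh (bd.sep q) h2, ln_of_mem hh dh] at q
      simp at q
    have uce : Uns Δ c e := by
      intro t ht
      by_contra q
      push Not at q
      rw [hone t ht h hh ((H t ht).2 (be.sep q)) h2, ln_of_mem hh eh] at q
      simp at q
    have uud : Uns Δ u d := by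
      intro t ht
      by_contra q
      push Not at q
      have q' := bd.symm.sep q
      rw [mul_comm] at q'
      rw [hone t ht h hh q' h2, ln_of_mem hh dh] at q
      simp at q
    have uve : Uns Δ v e := by
      intro t ht
      by_contra q
      push Not at q
      have q' := be.symm.sep q
      rw [mul_comm] at q'
      rw [hone t ht h hh ((H t ht).2 q') h2, ln_of_mem hh eh] at q
      simp at q
    have hah : a ≠ h := by rintro rfl; rw [ln_of_mem hh ca] at h2; simp at h2
    have hbh : b ≠ h := by rintro rfl; rw [ln_of_mem hh cb] at h2; simp at h2
    have ude : Uns Δ d e := Uns.of_via ucd uce ha' hb' hab ca cb (Or.inl da) (Or.inr eb)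
    have udv : Uns Δ d v := Uns.of_via ude.symm uve.symm hh hb' hbh.symm eh eb (Or.inl dh)
      (Or.inr vb)
    have ueu : Uns Δ e u := Uns.of_via ude uud.symm hh ha' hah.symm dh da (Or.inl eh) (Or.inr ua)
    have va : v ∉ a := fun q => cκ (by rwa [inter_unique ha' hb' hab ca cb q vb])
    have ub : u ∉ b := fun q => cκ (by rwa [inter_unique ha' hb' hab ca cb ua q])
    have va0 : ln a v ≠ 0 := fun q => va (mem_of_ln ha' (Sbar_sub hb' vb) q)
    have ub0 : ln b u ≠ 0 := fun q => ub (mem_of_ln hb' (Sbar_sub ha' ua) q)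
    refine tri_quad hst ha hb (S_of_sep hh (Sbar_sub ha' ca) (Sbar_sub ha' ua) h2) hκ aκ bκ ca cb
      da dh eb eh vb vκ ua uκ ucd.symm ude udv uud.symm uce.symm ueu uve.symm h1 h2 ?_ ?_
    · rw [mul_comm]
      exact be.pos2 (by rw [ln_of_mem ha' ca]; simp) (mul_self_pos.2 va0)
    · rw [mul_comm]
      exact bd.pos2 (by rw [ln_of_mem hb' cb]; simp) (mul_self_pos.2 ub0)
  · push Not at hG
    refine ⟨hG, fun t ht => ?_⟩
    by_contra q
    push Not at q
    exact absurd ((H t ht).2 q) (not_lt.2 (hG t ht))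

theorem crossing_single_aux (hst : Δ.Strong) (n : ℕ) : ∀ {a b : Set Pt} {c u v : Pt}, a ∈ Δ.S → b ∈ Δ.S → a ≠ b →
    c ∈ a → c ∈ b → u ∈ a → v ∈ b → (Sp Δ c u).ncard ≤ n →
    (∀ t ∈ Δ.Sbar, ln t c * ln t u < 0 ↔ ln t c * ln t v < 0) →
    ∀ t ∈ Δ.Sbar, ∀ t' ∈ Δ.Sbar, ln t c * ln t u < 0 → ln t' c * ln t' u < 0 → t = t' := by
  have fin : ∀ x y, (Sp Δ x y).Finite := fun x y => (Sbar_fin Δ).subset (sep_subset _ _)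
  induction n with
  | zero =>
    intro a b c u v _ _ _ _ _ _ _ hn _ t ht _ _ h _
    rw [Nat.le_zero, Set.ncard_eq_zero (fin _ _)] at hn
    have : t ∈ Sp Δ c u := ⟨ht, h⟩
    rw [hn] at this
    exact this.elim
  | succ n ih =>
    intro a b c u v ha hb hab ca cb ua vb hn H t ht t' ht' h h'
    by_contra hne
    have ha' : a ∈ Δ.Sbar := Or.inl ha
    have hb' : b ∈ Δ.Sbar := Or.inl hb
    have hcK : c ∈ convexHull ℝ {c, u, v} := subset_convexHull ℝ _ (by simp)
    have huK : u ∈ convexHull ℝ {c, u, v} := subset_convexHull ℝ _ (by simp)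
    have hvK : v ∈ convexHull ℝ {c, u, v} := subset_convexHull ℝ _ (by simp)
    have hK : Convex ℝ (convexHull ℝ {c, u, v}) := convex_convexHull ℝ _
    have hull : ∀ g ∈ Δ.Sbar, ∀ x ∈ convexHull ℝ {c, u, v}, ∀ y ∈ convexHull ℝ {c, u, v},
        ln g x * ln g y < 0 → ln g c * ln g u < 0 := by
      intro g hg x hx y hy hxy
      by_contra q
      have q' := mt (H g hg).2 q
      push Not at q q'
      refine absurd (hull_pair q q' ?_ hx hy) (not_le.2 hxy)
      by_cases h0 : ln g c = 0
      · rcases three ha' hb' hab ca cb hg (mem_of_ln hg (Sbar_sub ha' ca) h0) with rfl | rfl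
        · rw [ln_of_mem hg ua]; simp
        · rw [ln_of_mem hg vb]; simp
      · exact sign_trans h0 q q'
    have hsub : ∀ g ∈ Δ.Sbar, ln g c * ln g u < 0 → ∀ x ∈ convexHull ℝ {c, u, v},
        ∀ y ∈ convexHull ℝ {c, u, v}, 0 ≤ ln g x * ln g y → (Sp Δ x y).ncard ≤ n := by
      intro g hg hgc x hx y hy hxy
      have : Sp Δ x y ⊂ Sp Δ c u := by
        refine ⟨fun r hr => ⟨hr.1, hull r hr.1 x hx y hy hr.2⟩, fun q => ?_⟩
        exact absurd (q (⟨hg, hgc⟩ : g ∈ Sp Δ c u)).2 (not_lt.2 hxy)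
      have := Set.ncard_lt_ncard this (fin _ _)
      omega
    have hS : ∀ g ∈ Δ.Sbar, ln g c * ln g u < 0 → g ∈ Δ.S := fun g hg hgc =>
      S_of_sep hg (Sbar_sub ha' ca) (Sbar_sub ha' ua) hgc
    obtain ⟨g₁, hg₁', hn₁, y₀, y₀g, y₀a, b₀, U₀⟩ := nearest ha' ua ca ⟨t, ht, by rwa [mul_comm]⟩
    rw [mul_comm] at hn₁
    have hg₁ := hS g₁ hg₁' hn₁
    have cg₁ : ln g₁ c ≠ 0 := fun q => by rw [q] at hn₁; simp at hn₁
    have e1a : g₁ ≠ a := by rintro rfl; exact cg₁ (ln_of_mem hg₁' ca)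
    have key : ∀ g ∈ Δ.Sbar, g ≠ g₁ → ln g c * ln g u < 0 → ln g c * ln g y₀ < 0 := by
      intro g hg hgg hgc
      refine neg_mul_of_nonneg hgc (U₀ g hg) fun h0 => ?_
      rcases three ha' hg₁' e1a.symm y₀a y₀g hg (mem_of_ln hg (Sbar_sub ha' y₀a) h0) with rfl | q
      · rw [ln_of_mem hg ca] at hgc; simp at hgc
      · exact hgg q
    obtain ⟨p₁, p₁g, p₁b, bp₁⟩ := exists_btw hb' hg₁' cb vb ((H g₁ hg₁').1 hn₁)
    have hy₀K := b₀.mem hK huK hcK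
    have hp₁K := bp₁.mem hK hcK hvK
    by_cases hA : ∃ g ∈ Δ.Sbar, ln g y₀ * ln g p₁ < 0
    swap
    · push Not at hA
      obtain ⟨w1, -⟩ := triangle_aux hst ha hb hg₁' hab ca cb y₀a y₀g p₁b p₁g
        (fun q => cg₁ (ln_of_mem hg₁' q)) hA
        (ih ha hb hab ca cb y₀a p₁b (hsub g₁ hg₁' hn₁ _ hcK _ hy₀K
          (by rw [ln_of_mem hg₁' y₀g]; simp)))
      have : ∃ g ∈ Δ.Sbar, g ≠ g₁ ∧ ln g c * ln g u < 0 := by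
        by_cases q : t = g₁
        · exact ⟨t', ht', fun q' => hne (q.trans q'.symm), h'⟩
        · exact ⟨t, ht, q, h⟩
      obtain ⟨g, hg, hgg, hgc⟩ := this
      exact absurd (w1 g hg) (not_le.2 (key g hg hgg hgc))
    obtain ⟨g₂, hg₂', hn₂, y₁, y₁g₂, y₁g₁, by₁, U₁⟩ := nearest hg₁' y₀g p₁g hA
    have hy₁K := by₁.mem hK hy₀K hp₁K
    have hc₂ := hull g₂ hg₂' _ hy₀K _ hp₁K hn₂
    have hg₂ := hS g₂ hg₂' hc₂
    have e12 : g₁ ≠ g₂ := by rintro rfl; rw [ln_of_mem hg₁' y₀g] at hn₂; simp at hn₂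
    have hcy := key g₂ hg₂' e12.symm hc₂
    obtain ⟨q₂, q₂g, q₂a, bq₂⟩ := exists_btw ha' hg₂' ca y₀a hcy
    have hq₂K := bq₂.mem hK hcK hy₀K
    have e2a : g₂ ≠ a := by rintro rfl; rw [ln_of_mem hg₂' ca] at hc₂; simp at hc₂
    have P₁ : 0 < ln g₁ c * ln g₁ q₂ :=
      bq₂.pos1 (mul_self_pos.2 cg₁) (by rw [ln_of_mem hg₁' y₀g]; simp)
    have q₂g₁ := not_mem_of_pos hg₁' P₁
    obtain ⟨u20, u21⟩ := triangle_aux hst ha hg₂ hg₁' e2a.symm q₂a q₂g y₀a y₀g y₁g₂ y₁g₁ q₂g₁ U₁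
      (ih ha hg₂ e2a.symm q₂a q₂g y₀a y₁g₂ (hsub g₂ hg₂' hc₂ _ hq₂K _ hy₀K
        (by rw [ln_of_mem hg₂' q₂g]; simp)))
    have hcp₁ : 0 < ln g₂ c * ln g₂ p₁ := nn (by linarith) hn₂
    have p₁a0 : ln a p₁ ≠ 0 := fun q => by
      have := inter_unique ha' hb' hab ca cb (mem_of_ln ha' (Sbar_sub hb' p₁b) q) p₁b
      exact cg₁ (ln_of_mem hg₁' (this ▸ p₁g))
    have A₁ : 0 < ln a p₁ * ln a y₁ :=
      by₁.pos2 (by rw [ln_of_mem ha' y₀a]; simp) (mul_self_pos.2 p₁a0)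
    obtain ⟨p₂, p₂g, p₂b, bp₂⟩ := exists_btw hb' hg₂' cb vb ((H g₂ hg₂').1 hc₂)
    have hp₂K := bp₂.mem hK hcK hvK
    have e1b : g₁ ≠ b := by rintro rfl; exact cg₁ (ln_of_mem hg₁' cb)
    by_cases hB : ∃ g ∈ Δ.Sbar, ln g y₁ * ln g p₂ < 0
    swap
    · push Not at hB
      obtain ⟨w1, -⟩ := triangle_aux hst hg₁ hb hg₂' e1b p₁g p₁b y₁g₁ y₁g₂ p₂b p₂g
        (not_mem_of_pos hg₂' hcp₁) hB
        (ih hg₁ hb e1b p₁g p₁b y₁g₁ p₂b (hsub g₁ hg₁' hn₁ _ hp₁K _ hy₁K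
          (by rw [ln_of_mem hg₁' p₁g]; simp)))
      exact crossing_single_core hst ha hg₁ hg₂ hb y₀a y₀g y₁g₁ y₁g₂ q₂a q₂g ca cb p₁g p₁b U₁ u20 u21 w1.symm
        (by linarith) (by linarith) hn₂ (by linarith)
        (ih ha hb hab ca cb q₂a p₁b (hsub g₂ hg₂' hc₂ _ hcK _ hq₂K
          (by rw [ln_of_mem hg₂' q₂g]; simp)))
    obtain ⟨g₃, hg₃', hn₃, y₂, y₂g₃, y₂g₂, by₂, U₂⟩ := nearest hg₂' y₁g₂ p₂g hB
    have hc₃ := hull g₃ hg₃' _ hy₁K _ hp₂K hn₃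
    have hg₃ := hS g₃ hg₃' hc₃
    have e13 : g₁ ≠ g₃ := by rintro rfl; rw [ln_of_mem hg₁' y₁g₁] at hn₃; simp at hn₃
    have e23 : g₂ ≠ g₃ := by rintro rfl; rw [ln_of_mem hg₂' y₁g₂] at hn₃; simp at hn₃
    have e3a : g₃ ≠ a := by rintro rfl; rw [ln_of_mem hg₃' ca] at hc₃; simp at hc₃
    have hcy₃ := key g₃ hg₃' e13.symm hc₃
    have cg₃ : ln g₃ c ≠ 0 := fun q => by rw [q] at hc₃; simp at hc₃
    have y₁g₃ : ln g₃ y₁ ≠ 0 := fun q => by rw [q] at hn₃; simp at hn₃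
    have c₃y₁ : ln g₃ c * ln g₃ y₁ < 0 := neg_mul_of_nonneg hcy₃ (U₁ g₃ hg₃') y₁g₃
    have c₃p₂ : 0 < ln g₃ c * ln g₃ p₂ := nn (a := ln g₃ y₁) (by linarith) hn₃
    have c₃p₁ : 0 < ln g₃ c * ln g₃ p₁ :=
      (bp₁.of_sign bp₂ (ln_of_mem hg₂' p₂g) hcp₁).pos1 (mul_self_pos.2 cg₃) c₃p₂.le
    obtain ⟨κ, κg₃, κg₁, bκ⟩ := exists_btw hg₁' hg₃' y₁g₁ p₁g
      (npos c₃p₁ c₃y₁ |> fun q => by linarith)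
    have hκK := bκ.mem hK hy₁K hp₁K
    have c₃q₂ : ln g₃ c * ln g₃ q₂ < 0 := by
      refine neg_mul_of_nonneg hcy₃ (u20.symm g₃ hg₃') fun h0 => ?_
      rcases three ha' hg₂' e2a.symm q₂a q₂g hg₃' (mem_of_ln hg₃' (Sbar_sub ha' q₂a) h0) with q | q
      · exact e3a q
      · exact e23 q.symm
    obtain ⟨q', q'g, q'a, bq'⟩ := exists_btw ha' hg₃' ca q₂a c₃q₂
    have hq'K := bq'.mem hK hcK hq₂K
    have pκ : 0 < ln g₂ p₁ * ln g₂ κ :=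
      bκ.pos2 (by rw [ln_of_mem hg₂' y₁g₂]; simp) (mul_self_pos.2 fun q => by
        rw [q] at hcp₁; simp at hcp₁)
    obtain ⟨w1, -⟩ := triangle_aux hst hg₁ hg₃ hg₂' e13 κg₁ κg₃ y₁g₁ y₁g₂ y₂g₃ y₂g₂
      (not_mem_of_pos hg₂' pκ) U₂
      (ih hg₁ hg₃ e13 κg₁ κg₃ y₁g₁ y₂g₃ (hsub g₁ hg₁' hn₁ _ hκK _ hy₁K
        (by rw [ln_of_mem hg₁' κg₁]; simp)))
    have cq' : 0 < ln g₂ c * ln g₂ q' :=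
      bq'.pos1 (mul_self_pos.2 fun q => by rw [q] at hcy; simp at hcy)
        (by rw [ln_of_mem hg₂' q₂g]; simp)
    refine crossing_single_core hst ha hg₁ hg₂ hg₃ y₀a y₀g y₁g₁ y₁g₂ q₂a q₂g q'a q'g κg₁ κg₃ U₁ u20 u21 w1.symm
      (bq'.pos2 (by linarith) (mul_self_pos.2 fun q => by rw [q] at P₁; simp at P₁))
      (npos cq' hcy |> fun q => by linarith) ?_ (bκ.pos1 (mul_self_pos.2 fun q => by
        rw [q] at A₁; simp at A₁) (by linarith))
      (ih ha hg₃ e3a.symm q'a q'g q₂a κg₃ (hsub g₂ hg₂' hc₂ _ hq'K _ hq₂K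
          (by rw [ln_of_mem hg₂' q₂g]; simp)))
    have := npos pκ (c := ln g₂ y₀) (by linarith)
    linarith

/-- Two points on two crossing chords which are separated from the crossing by the same chords
are separated from it by at most one chord. -/
theorem crossing_single (hst : Δ.Strong) {a b : Set Pt} {c u v : Pt} (ha : a ∈ Δ.S) (hb : b ∈ Δ.S) (hab : a ≠ b)
    (ca : c ∈ a) (cb : c ∈ b) (ua : u ∈ a) (vb : v ∈ b)
    (H : ∀ t ∈ Δ.Sbar, ln t c * ln t u < 0 ↔ ln t c * ln t v < 0) :
    ∀ t ∈ Δ.Sbar, ∀ t' ∈ Δ.Sbar, ln t c * ln t u < 0 → ln t' c * ln t' u < 0 → t = t' :=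
  crossing_single_aux hst _ ha hb hab ca cb ua vb le_rfl H

/-- A triangle with an undivided side is minimal. -/
theorem triangle_uns (hst : Δ.Strong) {a b κ : Set Pt} {c u v : Pt} (ha : a ∈ Δ.S) (hb : b ∈ Δ.S)
    (hκ : κ ∈ Δ.Sbar) (hab : a ≠ b) (ca : c ∈ a) (cb : c ∈ b) (ua : u ∈ a) (uκ : u ∈ κ)
    (vb : v ∈ b) (vκ : v ∈ κ) (cκ : c ∉ κ) (huv : Uns Δ u v) : Uns Δ c u ∧ Uns Δ c v :=
  triangle_aux hst ha hb hκ hab ca cb ua uκ vb vκ cκ huv (crossing_single hst ha hb hab ca cb ua vb)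

end TBA

namespace TBA

variable {Δ : TBA} {X Y Z : Pt} {s s' t β β' : Set Pt} {x y z u w v p d : Pt}

theorem edge_mem_Sbar (h : s ∈ triEdges Δ.x1 Δ.x2 Δ.x3) : s ∈ Δ.Sbar := Or.inr h

theorem not_edge_of_S (hs : s ∈ Δ.S) (hs' : s' ∈ Δ.S) (hne : s ≠ s') (hx : x ∈ s) (hx' : x ∈ s')
    (ht : t ∈ triEdges Δ.x1 Δ.x2 Δ.x3) : x ∉ t := fun h =>
  S_inter_not_bdry hs hs' hne hx hx' (mem_bdry.2 ⟨t, ht, h⟩)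

theorem edge_pos (ht : t ∈ triEdges Δ.x1 Δ.x2 Δ.x3) (hx : x ∈ Δ.tri) (hy : y ∈ Δ.tri) (hxt : x ∉ t)
    (hyt : y ∉ t) : 0 < ln t x * ln t y := by
  refine lt_of_le_of_ne (edge_sign ht hx hy) (mul_ne_zero ?_ ?_).symm
  · exact fun h => hxt (mem_edge ht hx h)
  · exact fun h => hyt (mem_edge ht hy h)

/-- Two points of a chord are comparable on the ray from an end of the chord. -/
theorem ray (hs : s ∈ Δ.Sbar) (ht : t ∈ triEdges Δ.x1 Δ.x2 Δ.x3) (hu : u ∈ s) (hut : u ∈ t)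
    (hx : x ∈ s) (hy : y ∈ s) (hxt : x ∉ t) (hyt : y ∉ t) : x = y ∨ Btw u x y ∨ Btw u y x := by
  have hux : u ≠ x := by rintro rfl; exact hxt hut
  obtain ⟨τ, rfl⟩ := on_chord hs hux hu hx hy
  have h := edge_pos ht (Sbar_sub hs hx) (Sbar_sub hs hy) hxt hyt
  rw [ln_mv, ln_of_mem (edge_mem_Sbar ht) hut] at h
  have h0 : 0 < τ := by
    by_contra q
    push Not at q
    nlinarith [mul_nonneg (neg_nonneg.2 q) (mul_self_nonneg (ln t x))]
  rcases lt_trichotomy τ 1 with h1 | h1 | h1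
  · exact Or.inr (Or.inl ⟨τ, h0, h1, rfl⟩)
  · left; subst h1; exact (mv_one _ _).symm
  · refine Or.inr (Or.inr ⟨1 / τ, by positivity, (div_lt_one h0).2 h1, ?_⟩)
    ext
    · simp only [mv]; field_simp; ring
    · simp only [mv]; field_simp; ring

theorem Uns.of_via_edge (h1 : Uns Δ z x) (h2 : Uns Δ z y) (hs : s ∈ Δ.Sbar)
    (hs' : s' ∈ triEdges Δ.x1 Δ.x2 Δ.x3) (hne : s ≠ s') (hz : z ∈ s) (hz' : z ∈ s')
    (hx : x ∈ s ∨ y ∈ s) (hxT : x ∈ Δ.tri) (hyT : y ∈ Δ.tri) : Uns Δ x y := by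
  intro t ht
  by_cases h0 : ln t z = 0
  · rcases three hs (edge_mem_Sbar hs') hne hz hz' ht (mem_of_ln ht (Sbar_sub hs hz) h0) with
      rfl | rfl
    · rcases hx with h | h <;> rw [ln_of_mem ht h] <;> simp
    · exact edge_sign hs' hxT hyT
  · exact sign_trans h0 (h1 t ht) (h2 t ht)

/-- A chord crosses at most one of the two chords starting at the two feet next to its own. -/
theorem psi (hst : Δ.Strong) {κ b f f' : Set Pt} {b₁ f₁ f₁' c' x : Pt}
    (hκ : κ ∈ triEdges Δ.x1 Δ.x2 Δ.x3) (hb : b ∈ Δ.S) (hf : f ∈ Δ.S) (hf' : f' ∈ Δ.S)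
    (hbf : b ≠ f) (hbf' : b ≠ f') (hff' : f ≠ f') (b₁b : b₁ ∈ b) (b₁κ : b₁ ∈ κ) (f₁f : f₁ ∈ f)
    (f₁κ : f₁ ∈ κ) (f₁f' : f₁' ∈ f') (f₁κ' : f₁' ∈ κ) (hB : Btw b₁ f₁' f₁) (U1 : Uns Δ b₁ f₁)
    (U2 : Uns Δ f₁ f₁') (c'b : c' ∈ b) (c'f : c' ∈ f) (xb : x ∈ b) (xf : x ∈ f') : False := by
  have hκ' : κ ∈ Δ.Sbar := edge_mem_Sbar hκ
  have hb' : b ∈ Δ.Sbar := Or.inl hb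
  have hfS : f ∈ Δ.Sbar := Or.inl hf
  have hfS' : f' ∈ Δ.Sbar := Or.inl hf'
  have bκ : b ≠ κ := S_ne_edge hb hκ
  have fκ : f ≠ κ := S_ne_edge hf hκ
  have fκ' : f' ≠ κ := S_ne_edge hf' hκ
  have c'κ : c' ∉ κ := not_edge_of_S hb hf hbf c'b c'f hκ
  have xκ : x ∉ κ := not_edge_of_S hb hf' hbf' xb xf hκ
  have b₁f : b₁ ∉ f := fun h => by
    rcases three hb' hκ' bκ b₁b b₁κ hfS h with q | q
    exacts [hbf q.symm, fκ q]
  have f₁b : f₁ ∉ b := fun h => by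
    rcases three hfS hκ' fκ f₁f f₁κ hb' h with q | q
    exacts [hbf q, bκ q]
  have f₁b' : f₁' ∉ b := fun h => by
    rcases three hfS' hκ' fκ' f₁f' f₁κ' hb' h with q | q
    exacts [hbf' q, bκ q]
  have f₁'f : f₁' ∉ f := fun h => by
    rcases three hfS' hκ' fκ' f₁f' f₁κ' hfS h with q | q
    exacts [hff' q, fκ q]
  have f₁f'' : f₁ ∉ f' := fun h => by
    rcases three hfS hκ' fκ f₁f f₁κ hfS' h with q | q
    exacts [hff' q.symm, fκ' q]
  have c'T := Sbar_sub hb' c'b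
  have f₁T := Sbar_sub hfS f₁f
  have f₁T' := Sbar_sub hfS' f₁f'
  have xT := Sbar_sub hb' xb
  obtain ⟨W1, W2⟩ := triangle_uns hst hb hf hκ' hbf c'b c'f b₁b b₁κ f₁f f₁κ c'κ U1
  have hdis : ∀ y ∈ f, y ∉ f' := by
    intro y yf yf'
    have yκ : y ∉ κ := not_edge_of_S hf hf' hff' yf yf' hκ
    obtain ⟨V1, -⟩ := triangle_uns hst hf hf' hκ' hff' yf yf' f₁f f₁κ f₁f' f₁κ' yκ U2
    rcases ray hfS hκ f₁f f₁κ c'f yf c'κ yκ with rfl | h | h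
    · rcases three hb' hfS hbf c'b c'f hfS' yf' with q | q
      exacts [hbf' q.symm, hff' q.symm]
    · have := h.sep_of_zero (ln_of_mem hfS' yf') fun q => f₁f'' (mem_of_ln hfS' f₁T q)
      exact absurd (W2.symm f' hfS') (not_le.2 this)
    · have := h.sep_of_zero (ln_of_mem hb' c'b) fun q => f₁b (mem_of_ln hb' f₁T q)
      exact absurd (V1.symm b hb') (not_le.2 this)
  have hside : ∀ y ∈ f', ∀ y' ∈ f', 0 < ln f y * ln f y' := by
    intro y hy y' hy'
    have h1 : ln f y ≠ 0 := fun h => hdis y (mem_of_ln hfS (Sbar_sub hfS' hy) h) hy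
    have h2 : ln f y' ≠ 0 := fun h => hdis y' (mem_of_ln hfS (Sbar_sub hfS' hy') h) hy'
    rcases lt_or_gt_of_ne (mul_ne_zero h1 h2) with h | h
    · obtain ⟨z, hz, hz', -⟩ := exists_btw hfS' hfS hy hy' h
      exact (hdis z hz hz').elim
    · exact h
  have h1 : ln f b₁ * ln f f₁' < 0 := hB.sep_of_zero (ln_of_mem hfS f₁f)
    fun h => b₁f (mem_of_ln hfS (Sbar_sub hb' b₁b) h)
  have h2 : ln f b₁ * ln f x < 0 := by
    have := npos (hside f₁' f₁f' x xf) (c := ln f b₁) (by linarith)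
    linarith
  have h3 : 0 < ln b f₁ * ln b f₁' := by
    rw [mul_comm]
    exact hB.pos2 (by rw [ln_of_mem hb' b₁b]; simp) (mul_self_pos.2 fun h =>
      f₁b' (mem_of_ln hb' f₁T' h))
  have ucf : Uns Δ c' f₁' := W2.symm.of_via_edge U2 hfS hκ fκ f₁f f₁κ (Or.inl c'f) c'T f₁T'
  have H : ∀ t ∈ Δ.Sbar, ln t x * ln t c' < 0 ↔ ln t x * ln t f₁' < 0 := by
    intro t ht
    constructor
    · intro h
      refine neg_mul_of_nonneg h (ucf t ht) fun h0 => ?_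
      rcases three hfS' hκ' fκ' f₁f' f₁κ' ht (mem_of_ln ht f₁T' h0) with rfl | rfl
      · rw [ln_of_mem ht xf] at h; simp at h
      · exact absurd (edge_sign hκ xT c'T) (not_le.2 h)
    · intro h
      refine neg_mul_of_nonneg h (ucf.symm t ht) fun h0 => ?_
      rcases three hb' hfS hbf c'b c'f ht (mem_of_ln ht c'T h0) with rfl | rfl
      · rw [ln_of_mem ht xb] at h; simp at h
      · exact absurd (hside x xf f₁' f₁f') (not_lt.2 h.le)
  have hone := crossing_single hst hb hf' hbf' xb xf c'b f₁f' H
  by_cases hG : ∃ t ∈ Δ.Sbar, ln t x * ln t c' < 0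
  · obtain ⟨l, hl, hlc⟩ := hG
    have hlf := (H l hl).1 hlc
    have xl : x ∉ l := fun h => by rw [ln_of_mem hl h] at hlc; simp at hlc
    obtain ⟨v₄, v₄l, v₄b, b4⟩ := exists_btw hb' hl xb c'b hlc
    obtain ⟨v₅, v₅l, v₅f, b5⟩ := exists_btw hfS' hl xf f₁f' hlf
    have w4 : Uns Δ c' v₄ := by
      intro t ht
      by_contra q
      push Not at q
      have q' := b4.symm.sep q
      rw [mul_comm] at q'
      rw [hone t ht l hl q' hlc, ln_of_mem hl v₄l] at q
      simp at q
    have w5 : Uns Δ f₁' v₅ := by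
      intro t ht
      by_contra q
      push Not at q
      have q' := b5.symm.sep q
      rw [mul_comm] at q'
      rw [hone t ht l hl ((H t ht).2 q') hlc, ln_of_mem hl v₅l] at q
      simp at q
    obtain ⟨β, hβ, hc⟩ := blk_ex hb hfS hbf c'b c'f
    have r0 : ln f b₁ ≠ 0 := fun h => by rw [h] at h1; simp at h1
    have s0 : ln b f₁ ≠ 0 := fun h => by rw [h] at h3; simp at h3
    obtain ⟨e, he, -, -, -, -, e1, e2, -, -⟩ := blk_turn hβ hc hb hf hbf c'b c'f r0 s0
      (fun e he k1 k2 => tri_block hb' hfS hκ' c'b c'f b₁b b₁κ f₁f f₁κ W1 W2 hβ hc he k1 k2)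
    have e3 : 0 < ln f e * ln f f₁' := nn (a := ln f b₁) (by linarith) h1
    have e4 : 0 < ln f e * ln f x := nn (a := ln f b₁) (by linarith) h2
    have e5 : 0 < ln b e * ln b f₁' := ppos (a := ln b f₁) (by linarith) h3
    exact pent_block hst hκ' hfS hb' hl hfS' fκ'.symm (by rintro rfl; exact xl xf)
      (by rintro rfl; exact absurd (edge_sign hκ xT c'T) (not_le.2 hlc)) f₁κ' f₁κ f₁f c'f c'b v₄b
      v₄l v₅l v₅f f₁f' ucf W2 w4
      (ucf.symm.of_via_edge w5 hfS' hκ fκ' f₁f' f₁κ' (Or.inr v₅f) c'T (Sbar_sub hl v₅l)) hβ hc he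
      e5 e2 (b5.pos2 (by rw [ln_of_mem hb' xb]; simp) e5) e3
      (b4.pos1 e4 (by rw [ln_of_mem hfS c'f]; simp)) (b5.pos1 e4 e3.le)
  · push Not at hG
    have w0 : Uns Δ c' x := fun t ht => by rw [mul_comm]; exact hG t ht
    obtain ⟨z, zf, zf', -⟩ := tri_quad_half hst hb hκ' hf hfS' fκ'.symm b₁b b₁κ c'b c'f f₁κ f₁f
      f₁κ' f₁f' xb xf W1 W2 ucf w0 h1 h2 h3
    exact hdis z zf zf'

end TBA

namespace TBA

variable {Δ : TBA} {X Y Z : Pt} {s s' t β β' : Set Pt} {x y z u w v p d : Pt}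

/-- The parameter of the point where the line of `a` meets the line `XZ`. -/
def ft (a : Set Pt) (X Z : Pt) : ℝ := ln a X / (ln a X - ln a Z)

/-- The point where the line of `a` meets the line `XZ`. -/
def foot (a : Set Pt) (X Z : Pt) : Pt := mv X Z (ft a X Z)

/-- The proper initial segments separating `X` from `Z`. -/
def Across (Δ : TBA) (X Z : Pt) : Set (Set Pt) := {a | a ∈ Δ.S ∧ ln a X * ln a Z < 0}

theorem across_symm (h : s ∈ Across Δ X Z) : s ∈ Across Δ Z X :=
  ⟨h.1, by linarith [h.2, mul_comm (ln s X) (ln s Z)]⟩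

theorem sub_ne (h : ln s X * ln s Z < 0) : ln s X - ln s Z ≠ 0 := by
  intro h'
  nlinarith [sub_eq_zero.1 h' ▸ h, mul_self_nonneg (ln s Z)]

theorem sub_pos' (h : ln s X * ln s Z < 0) : 0 < ln s X * (ln s X - ln s Z) := by
  nlinarith [mul_self_nonneg (ln s X)]

theorem ft_pos (h : ln s X * ln s Z < 0) : 0 < ft s X Z ∧ ft s X Z < 1 := by
  have e : ft s X Z * (ln s X - ln s Z) = ln s X := div_mul_cancel₀ _ (sub_ne h)
  have hp := sub_pos' h
  have hX : ln s X ≠ 0 := by rintro h0; simp [h0] at h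
  have h2 : 0 < ln s X * ln s X := mul_self_pos.2 hX
  have e' : ft s X Z * (ln s X * (ln s X - ln s Z)) = ln s X * ln s X := by
    linear_combination ln s X * e
  constructor
  · by_contra hh
    nlinarith
  · by_contra hh
    nlinarith

theorem ft_symm (h : ln s X * ln s Z < 0) : ft s Z X = 1 - ft s X Z := by
  have := sub_ne h
  have h' : ln s Z - ln s X ≠ 0 := fun h0 => this (by linarith)
  unfold ft
  field_simp
  ring

theorem foot_symm (h : ln s X * ln s Z < 0) : foot s Z X = foot s X Z := by
  rw [foot, ft_symm h, ← mv_symm, foot]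

theorem ln_ft (h : ln s X * ln s Z < 0) (r : ℝ) :
    ln s (mv X Z r) = (ft s X Z - r) * (ln s X - ln s Z) := by
  have e : ft s X Z * (ln s X - ln s Z) = ln s X := div_mul_cancel₀ _ (sub_ne h)
  rw [ln_mv]
  linear_combination -e

theorem foot_seg (h : ln s X * ln s Z < 0) : foot s X Z ∈ segment ℝ X Z :=
  mem_seg.2 ⟨_, (ft_pos h).1.le, (ft_pos h).2.le, rfl⟩

theorem foot_tri (hc : Cor Δ X Y Z) (h : ln s X * ln s Z < 0) : foot s X Z ∈ Δ.tri :=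
  hc.perm.2.2.1.seg_sub (foot_seg h)

theorem foot_mem (hc : Cor Δ X Y Z) (h : s ∈ Across Δ X Z) : foot s X Z ∈ s :=
  mem_of_ln (Or.inl h.1) (foot_tri hc h.2) (by rw [foot, ln_ft h.2]; ring)

theorem foot_lt (ht : ln t X * ln t Z < 0) (h : ft s X Z < ft t X Z) :
    0 < ln t X * ln t (foot s X Z) := by
  rw [foot, ln_ft ht]
  have := mul_pos (sub_pos.2 h) (sub_pos' ht)
  linarith

theorem foot_gt (ht : ln t X * ln t Z < 0) (h : ft t X Z < ft s X Z) :
    ln t X * ln t (foot s X Z) < 0 := by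
  rw [foot, ln_ft ht]
  have := mul_pos (sub_pos.2 h) (sub_pos' ht)
  linarith

theorem ft_ne (hc : Cor Δ X Y Z) (hs : s ∈ Across Δ X Z) (ht : t ∈ Across Δ X Z) (hne : s ≠ t) :
    ft s X Z ≠ ft t X Z := by
  intro h
  have e : foot s X Z = foot t X Z := by rw [foot, h, foot]
  have h1 := foot_mem hc hs
  have h2 := e ▸ foot_mem hc ht
  exact not_edge_of_S hs.1 ht.1 hne h1 h2 hc.perm.2.2.1.e12 (foot_seg hs.2)

theorem exists_foot (hc : Cor Δ X Y Z) (hs : s ∈ Δ.S) (hx : x ∈ s) (hx' : x ∈ segment ℝ X Z) :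
    s ∈ Across Δ X Z ∧ x = foot s X Z := by
  have h0 := ln_of_mem (Or.inl hs) hx
  obtain ⟨r, r0, r1, rfl⟩ := mem_seg.1 hx'
  have hX := hc.ln_ne hs
  have hZ := hc.perm.2.1.ln_ne hs
  have e := ln_mv s X Z r
  rw [h0] at e
  have hr0 : 0 < r := by
    refine lt_of_le_of_ne r0 ?_
    rintro rfl
    apply hX
    linarith
  have hr1 : r < 1 := by
    refine lt_of_le_of_ne r1 ?_
    rintro rfl
    apply hZ
    linarith
  have h : ln s X * ln s Z < 0 := by
    have : 0 < ln s Z * ln s Z := mul_self_pos.2 hZ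
    have e2 : (1 - r) * (ln s X * ln s Z) = - (r * (ln s Z * ln s Z)) := by
      linear_combination -(ln s Z) * e
    have h1r : 0 < 1 - r := by linarith
    have : 0 < r * (ln s Z * ln s Z) := by positivity
    by_contra hh
    nlinarith [mul_nonneg h1r.le (not_lt.1 hh)]
  refine ⟨⟨hs, h⟩, ?_⟩
  have e3 := ln_ft h r
  rw [h0] at e3
  have := (mul_eq_zero.1 e3.symm).resolve_right (sub_ne h)
  rw [foot, sub_eq_zero.1 this]

/-- No proper initial segment has its foot on `XZ` strictly between those of `s` and `t`. -/
def Adj (Δ : TBA) (X Z : Pt) (s t : Set Pt) : Prop :=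
  ∀ g ∈ Across Δ X Z, 0 ≤ (ft g X Z - ft s X Z) * (ft g X Z - ft t X Z)

theorem Adj.symm (h : Adj Δ X Z s t) : Adj Δ X Z t s := fun g hg => by
  rw [mul_comm]; exact h g hg

theorem Adj.flip (h : Adj Δ X Z s t) (hs : s ∈ Across Δ X Z) (ht : t ∈ Across Δ X Z) :
    Adj Δ Z X s t := fun g hg => by
  have := h g (across_symm hg)
  rw [ft_symm hs.2, ft_symm ht.2, ft_symm (across_symm hg).2]
  linarith

theorem Adj.uns (hc : Cor Δ X Y Z) (h : Adj Δ X Z s t) (hs : s ∈ Across Δ X Z)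
    (ht : t ∈ Across Δ X Z) : Uns Δ (foot s X Z) (foot t X Z) := by
  intro g hg
  by_contra hn
  push Not at hn
  have hgS := S_of_sep hg (foot_tri hc hs.2) (foot_tri hc ht.2) hn
  have hX := hc.ln_ne hgS
  have hs' := ft_pos hs.2
  have ht' := ft_pos ht.2
  have hXZ : ln g X * ln g Z < 0 := by
    by_contra hh
    push Not at hh
    have h1 : ∀ r : ℝ, 0 < r → r < 1 → 0 < ln g X * ln g (mv X Z r) := by
      intro r h0 h1
      rw [ln_mv]
      have := mul_self_pos.2 hX
      nlinarith [mul_pos (sub_pos.2 h1) this, mul_nonneg h0.le hh]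
    exact absurd (ppos (h1 _ hs'.1 hs'.2) (h1 _ ht'.1 ht'.2)) (not_lt.2 hn.le)
  have := h g ⟨hgS, hXZ⟩
  rw [foot, foot, ln_ft hXZ, ln_ft hXZ] at hn
  nlinarith [mul_nonneg this (mul_self_nonneg (ln g X - ln g Z))]

theorem next_ft {r : ℝ} (ht : t ∈ Across Δ X Z) (h : r < ft t X Z) :
    ∃ f ∈ Across Δ X Z, r < ft f X Z ∧ ft f X Z ≤ ft t X Z ∧
      ∀ g ∈ Across Δ X Z, r < ft g X Z → ft f X Z ≤ ft g X Z := by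
  have hfin : ({g | g ∈ Across Δ X Z ∧ r < ft g X Z}).Finite :=
    Δ.finS.subset fun g hg => hg.1.1
  obtain ⟨f, hf, hmin⟩ := Set.exists_min_image _ (fun g => ft g X Z) hfin ⟨t, ht, h⟩
  exact ⟨f, hf.1, hf.2, hmin t ⟨ht, h⟩, fun g hg hr => hmin g ⟨hg, hr⟩⟩

theorem next (ht : t ∈ Across Δ X Z) (h : ft s X Z < ft t X Z) :
    ∃ f ∈ Across Δ X Z, ft s X Z < ft f X Z ∧ ft f X Z ≤ ft t X Z ∧ Adj Δ X Z s f := by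
  obtain ⟨f, hf, h1, h2, h3⟩ := next_ft ht h
  refine ⟨f, hf, h1, h2, fun g hg => ?_⟩
  rcases lt_or_ge (ft s X Z) (ft g X Z) with h' | h'
  · exact mul_nonneg (by linarith) (by linarith [h3 g hg h'])
  · exact mul_nonneg_of_nonpos_of_nonpos (by linarith) (by linarith)

theorem prev (hs : s ∈ Across Δ X Z) (ht : t ∈ Across Δ X Z) (h : ft s X Z < ft t X Z) :
    ∃ f ∈ Across Δ X Z, ft f X Z < ft t X Z ∧ ft s X Z ≤ ft f X Z ∧ Adj Δ X Z f t := by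
  obtain ⟨f, hf, h1, h2, h3⟩ := next (across_symm hs) (s := t)
    (by rw [ft_symm hs.2, ft_symm ht.2]; linarith)
  rw [ft_symm ht.2, ft_symm (across_symm hf).2] at h1
  rw [ft_symm hs.2, ft_symm (across_symm hf).2] at h2
  exact ⟨f, across_symm hf, by linarith, by linarith, (h3.flip (across_symm ht) hf).symm⟩

theorem psi_ft (hst : Δ.Strong) (hc : Cor Δ X Y Z) {b f f' : Set Pt} (hb : b ∈ Across Δ X Z)
    (hf : f ∈ Across Δ X Z) (hf' : f' ∈ Across Δ X Z)
    (hlt : 0 < (ft f X Z - ft b X Z) * (ft f' X Z - ft f X Z))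
    (h1 : Adj Δ X Z b f) (h2 : Adj Δ X Z f f') (hbf : (b ∩ f).Nonempty) (hbf' : (b ∩ f').Nonempty) :
    False := by
  obtain ⟨c, cb, cf⟩ := hbf
  obtain ⟨x, xb, xf⟩ := hbf'
  refine psi hst hc.perm.2.2.1.e12 hb.1 hf.1 hf'.1 ?_ ?_ ?_ (foot_mem hc hb) (foot_seg hb.2)
    (foot_mem hc hf) (foot_seg hf.2) (foot_mem hc hf') (foot_seg hf'.2) ?_ (h1.uns hc hb hf)
    (h2.uns hc hf hf') cb cf xb xf
  · rintro rfl; simp at hlt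
  · rintro rfl
    nlinarith [mul_self_nonneg (ft f X Z - ft b X Z)]
  · rintro rfl; simp at hlt
  · have hne : ft f' X Z - ft b X Z ≠ 0 := by
      intro h0
      have : ft f' X Z = ft b X Z := by linarith
      rw [this] at hlt
      nlinarith [mul_self_nonneg (ft f X Z - ft b X Z)]
    refine ⟨(ft f X Z - ft b X Z) / (ft f' X Z - ft b X Z), ?_, ?_, ?_⟩
    · rcases lt_or_gt_of_ne hne with h | h
      · apply div_pos_of_neg_of_neg _ h
        by_contra hh
        nlinarith
      · apply div_pos _ h
        by_contra hh
        nlinarith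
    · rcases lt_or_gt_of_ne hne with h | h
      · rw [div_lt_one_of_neg h]
        by_contra hh
        nlinarith
      · rw [div_lt_one h]
        by_contra hh
        nlinarith
    · unfold foot mv
      ext <;> simp <;> field_simp <;> ring

theorem between_feet {e e' : Set Pt} (he : e ∈ triEdges Δ.x1 Δ.x2 Δ.x3)
    (he' : e' ∈ triEdges Δ.x1 Δ.x2 Δ.x3) (hs : s ∈ Δ.S) (hu : u ∈ s) (hue : u ∈ e) (hv : v ∈ s)
    (hve : v ∈ e') (huv : u ≠ v) (hp : p ∈ s) : ∃ τ : ℝ, 0 ≤ τ ∧ τ ≤ 1 ∧ p = mv u v τ := by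
  obtain ⟨τ, rfl⟩ := on_chord (Or.inl hs) huv hu hv hp
  have hvT := Sbar_sub (Or.inl hs) hv
  have huT := Sbar_sub (Or.inl hs) hu
  have hpT := Sbar_sub (Or.inl hs) hp
  have key : ∀ {e : Set Pt} {u v : Pt}, e ∈ triEdges Δ.x1 Δ.x2 Δ.x3 → u ∈ s → u ∈ e → v ∈ s →
      u ≠ v → ln e v ≠ 0 := by
    intro e u v he hu hue hv huv h0
    exact S_ne_edge hs he (Sbar_eq_of_two (Or.inl hs) (edge_mem_Sbar he) huv hu hue hv
      (mem_edge he (Sbar_sub (Or.inl hs) hv) h0))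
  refine ⟨τ, ?_, ?_, rfl⟩
  · have h1 := edge_sign he hvT hpT
    rw [ln_mv, ln_of_mem (edge_mem_Sbar he) hue] at h1
    have := mul_self_pos.2 (key he hu hue hv huv)
    by_contra hh
    nlinarith
  · have h1 := edge_sign he' huT hpT
    rw [ln_mv, ln_of_mem (edge_mem_Sbar he') hve] at h1
    have := mul_self_pos.2 (key he' hv hve hu huv.symm)
    by_contra hh
    nlinarith

theorem sep_of_meets {e e' : Set Pt} (he : e ∈ triEdges Δ.x1 Δ.x2 Δ.x3)
    (he' : e' ∈ triEdges Δ.x1 Δ.x2 Δ.x3) (hs : s ∈ Δ.S) (hu : u ∈ s) (hue : u ∈ e) (hv : v ∈ s)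
    (hve : v ∈ e') (huv : u ≠ v) (ht : t ∈ Δ.S) (hst : s ≠ t) (h : (s ∩ t).Nonempty) :
    ln t u * ln t v < 0 := by
  obtain ⟨p, hp, hpt⟩ := h
  obtain ⟨τ, h0, h1, rfl⟩ := between_feet he he' hs hu hue hv hve huv hp
  have hu0 : ln t u ≠ 0 := fun h0 => not_edge_of_S hs ht hst hu
    (mem_of_ln (Or.inl ht) (Sbar_sub (Or.inl hs) hu) h0) he hue
  have hv0 : ln t v ≠ 0 := fun h0 => not_edge_of_S hs ht hst hv
    (mem_of_ln (Or.inl ht) (Sbar_sub (Or.inl hs) hv) h0) he' hve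
  have e := ln_of_mem (Or.inl ht) hpt
  rw [ln_mv] at e
  by_contra hh
  push Not at hh
  have hh' := lt_of_le_of_ne hh (mul_ne_zero hu0 hv0).symm
  have e2 : (1 - τ) * (ln t u * ln t u) + τ * (ln t u * ln t v) = 0 := by
    linear_combination (ln t u) * e
  have := mul_self_pos.2 hu0
  rcases h0.eq_or_lt with rfl | h0
  · nlinarith
  · nlinarith [mul_pos h0 hh', mul_nonneg (sub_nonneg.2 h1) this.le]

theorem meets_of_sep (hs : s ∈ Δ.Sbar) (ht : t ∈ Δ.Sbar) (hu : u ∈ s) (hv : v ∈ s)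
    (h : ln t u * ln t v < 0) : (s ∩ t).Nonempty := by
  obtain ⟨z, hz, hz', -⟩ := exists_btw hs ht hu hv h
  exact ⟨z, hz', hz⟩

/-- The proper initial segment `a` separates the corner `X` from the other two. -/
def Cut (Δ : TBA) (X Y Z : Pt) (a : Set Pt) : Prop :=
  a ∈ Δ.S ∧ ln a X * ln a Y < 0 ∧ ln a X * ln a Z < 0

theorem Cut.swap (h : Cut Δ X Y Z s) : Cut Δ X Z Y s := ⟨h.1, h.2.2, h.2.1⟩

theorem Cut.acrossZ (h : Cut Δ X Y Z s) : s ∈ Across Δ X Z := ⟨h.1, h.2.2⟩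

theorem Cut.acrossY (h : Cut Δ X Y Z s) : s ∈ Across Δ X Y := ⟨h.1, h.2.1⟩

theorem across_cases (hc : Cor Δ X Y Z) (hs : s ∈ Across Δ X Z) :
    Cut Δ X Y Z s ∨ Cut Δ Z Y X s := by
  have hY := hc.rot.ln_ne hs.1
  have h := hs.2
  rcases lt_or_ge (ln s X * ln s Y) 0 with h1 | h1
  · exact Or.inl ⟨hs.1, h1, h⟩
  · refine Or.inr ⟨hs.1, ?_, (across_symm hs).2⟩
    exact neg_mul_of_nonneg (across_symm hs).2 h1 hY

theorem cut_cases (hc : Cor Δ X Y Z) (hs : s ∈ Δ.S) :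
    Cut Δ X Y Z s ∨ Cut Δ Y X Z s ∨ Cut Δ Z Y X s := by
  have hX := hc.ln_ne hs
  have hY := hc.rot.ln_ne hs
  have hZ := hc.rot.rot.ln_ne hs
  rcases lt_or_ge (ln s X * ln s Z) 0 with h1 | h1
  · rcases across_cases hc ⟨hs, h1⟩ with h | h
    · exact Or.inl h
    · exact Or.inr (Or.inr h)
  · refine Or.inr (Or.inl ?_)
    have hXX := mul_self_pos.2 hX
    have key : ln s X * ln s Y < 0 := by
      by_contra hh
      push Not at hh
      obtain ⟨a, b, -, e, -⟩ := Sbar_ends (Or.inl hs)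
      have ha : a ∈ s := e ▸ left_mem_segment ℝ a b
      have haT := Sbar_sub (Or.inl hs) ha
      have h1' := lt_of_le_of_ne h1 (mul_ne_zero hX hZ).symm
      have hh' := lt_of_le_of_ne hh (mul_ne_zero hX hY).symm
      have hconv : Convex ℝ {x | 0 < ln s X * ln s x} := by
        intro x hx y hy α γ hα hγ hαγ
        have e : α • x + γ • y = mv x y γ := by
          rw [mv_eq_smul]; congr 2; linarith
        rw [e, mem_ofPred_eq, ln_mv]
        rw [mem_ofPred_eq] at hx hy
        have : 1 - γ = α := by linarith
        rw [this]
        rcases hα.eq_or_lt with rfl | hα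
        · nlinarith
        · nlinarith [mul_pos hα hx, mul_nonneg hγ hy.le]
      have hsub : Δ.tri ⊆ {x | 0 < ln s X * ln s x} := by
        rw [hc.tri]
        apply convexHull_min _ hconv
        rintro x (rfl | rfl | rfl)
        exacts [hXX, hh', h1']
      have := hsub haT
      rw [mem_ofPred_eq, ln_of_mem (Or.inl hs) ha] at this
      simp at this
    refine ⟨hs, by rwa [mul_comm], ?_⟩
    rw [mul_comm] at key
    exact neg_mul_of_nonneg key h1 hZ

end TBA

namespace TBA

variable {Δ : TBA} {X Y Z : Pt} {s s' t β β' a b : Set Pt} {x y z u w v p d : Pt}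

theorem foot_btw (h : ln s X * ln s Z < 0) : Btw X Z (foot s X Z) :=
  ⟨_, (ft_pos h).1, (ft_pos h).2, rfl⟩

theorem foot_ne (hc : Cor Δ X Y Z) (h : s ∈ Across Δ X Z) (h' : s ∈ Across Δ X Y) :
    foot s X Z ≠ foot s X Y := by
  intro e
  have h1 := foot_seg h.2
  have h2 := foot_seg h'.2
  rw [← e] at h2
  have h3 := inter_unique hc.b12 hc.perm.2.2.1.b12 hc.edge_ne h2 h1 (left_mem_segment ℝ X Y)
    (left_mem_segment ℝ X Z)
  exact hc.not_mem h.1 (h3 ▸ foot_mem hc h)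

theorem Cut.foot_far (ha : Cut Δ X Y Z a) (hb : b ∈ Across Δ Y Z) :
    ln a X * ln a (foot b Y Z) < 0 := by
  have := (foot_btw hb.2).pos1 (t := a) (r := - ln a X) (by linarith [ha.2.1])
    (by linarith [ha.2.2])
  linarith

theorem Cut.ne (ha : Cut Δ X Y Z a) (hb : Cut Δ Z Y X b) : a ≠ b := by
  rintro rfl
  exact absurd (nn ha.2.1 ha.2.2) (not_lt.2 (by linarith [hb.2.1, mul_comm (ln a Z) (ln a Y)]))

theorem Cut.meet (hc : Cor Δ X Y Z) (ha : Cut Δ X Y Z a) (hb : Cut Δ Z Y X b)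
    (h : ft b X Z < ft a X Z) : (b ∩ a).Nonempty := by
  have h1 := foot_lt ha.2.2 h
  have h2 := ha.foot_far (across_symm hb.acrossY)
  rw [foot_symm hb.2.1] at h2
  exact meets_of_sep (Or.inl hb.1) (Or.inl ha.1)
    (foot_mem hc (across_symm hb.acrossZ)) (foot_mem hc.perm.2.2.2.2 hb.acrossY)
    (npos h1 h2)

theorem Cut.lt_of_meet (hc : Cor Δ X Y Z) (ha : Cut Δ X Y Z a) (hb : Cut Δ Z Y X b)
    (h : (b ∩ a).Nonempty) : ft b X Z < ft a X Z := by
  have hne := ha.ne hb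
  have hZ := across_symm hb.acrossZ
  have h2 := ha.foot_far (across_symm hb.acrossY)
  rw [foot_symm hb.2.1] at h2
  by_contra hh
  have h1 := foot_gt ha.2.2 (lt_of_le_of_ne (not_lt.1 hh) (ft_ne hc ha.acrossZ hZ hne))
  have h3 := sep_of_meets hc.perm.2.2.1.e12 hc.perm.2.1.e12 hb.1
    (foot_mem hc hZ) (foot_seg hZ.2) (foot_mem hc.perm.2.2.2.2 hb.acrossY)
    (foot_seg hb.2.1) ?_ ha.1 hne.symm h
  · exact absurd (nn h1 h2) (not_lt.2 h3.le)
  · rw [foot_symm hb.2.2]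
    exact foot_ne hc.perm.2.1 hb.acrossZ hb.acrossY

theorem Cut.meet_same (hc : Cor Δ X Y Z) (hs : Cut Δ X Y Z s) (ht : Cut Δ X Y Z t)
    (h1 : ft s X Z < ft t X Z) (h2 : ft t X Y < ft s X Y) : (s ∩ t).Nonempty :=
  meets_of_sep (Or.inl hs.1) (Or.inl ht.1) (foot_mem hc hs.acrossZ)
    (foot_mem hc.perm.2.2.1 hs.acrossY) (npos (foot_lt ht.2.2 h1) (foot_gt ht.2.1 h2))

theorem Cut.lt_of_meet_same (hc : Cor Δ X Y Z) (hs : Cut Δ X Y Z s) (ht : Cut Δ X Y Z t)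
    (h1 : ft s X Z < ft t X Z) (h : (s ∩ t).Nonempty) : ft t X Y < ft s X Y := by
  have hne : s ≠ t := by rintro rfl; exact lt_irrefl _ h1
  by_contra hh
  have h2 := foot_lt ht.2.1
    (lt_of_le_of_ne (not_lt.1 hh) (ft_ne hc.perm.2.2.1 hs.acrossY ht.acrossY hne))
  have h3 := sep_of_meets hc.perm.2.2.1.e12 hc.e12 hs.1
    (foot_mem hc hs.acrossZ) (foot_seg hs.2.2) (foot_mem hc.perm.2.2.1 hs.acrossY)
    (foot_seg hs.2.1) (foot_ne hc hs.acrossZ hs.acrossY) ht.1 hne h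
  exact absurd (ppos (foot_lt ht.2.2 h1) h2) (not_lt.2 h3.le)

theorem Cut.left_adj (hst : Δ.Strong) (hc : Cor Δ X Y Z) (ha : Cut Δ X Y Z a)
    (hb : Cut Δ Z Y X b) (h : ft b X Z < ft a X Z) :
    ∃ b', Cut Δ Z Y X b' ∧ ft b X Z ≤ ft b' X Z ∧ ft b' X Z < ft a X Z ∧ Adj Δ X Z b' a := by
  have hfin : ({g | Cut Δ Z Y X g ∧ ft g X Z < ft a X Z}).Finite :=
    Δ.finS.subset fun g hg => hg.1.1
  obtain ⟨b', ⟨hb', hlt⟩, hmax⟩ := Set.exists_max_image _ (fun g => ft g X Z) hfin ⟨b, hb, h⟩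
  have hmax' : ∀ f ∈ Across Δ X Z, ft b' X Z < ft f X Z → ft f X Z ≤ ft a X Z →
      Cut Δ X Y Z f := by
    intro f hf h1 h2
    rcases h2.eq_or_lt with h2 | h2
    · by_cases e : f = a
      · exact e ▸ ha
      · exact absurd h2 (ft_ne hc hf ha.acrossZ e)
    · refine (across_cases hc hf).resolve_right fun hf' => ?_
      exact absurd (hmax f ⟨hf', h2⟩) (not_le.2 h1)
  have hbA := across_symm hb'.acrossZ
  refine ⟨b', hb', hmax b ⟨hb, h⟩, hlt, ?_⟩
  obtain ⟨f, hf, h1, h2, h3⟩ := next ha.acrossZ hlt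
  by_cases e : f = a
  · exact e ▸ h3
  obtain ⟨f', hf', k1, k2, k3⟩ :=
    next ha.acrossZ (lt_of_le_of_ne h2 (ft_ne hc hf ha.acrossZ e))
  exact (psi_ft hst hc hbA hf hf' (mul_pos (sub_pos.2 h1) (sub_pos.2 k1)) h3 k3
    ((hmax' f hf h1 h2).meet hc hb' h1)
    ((hmax' f' hf' (h1.trans k1) k2).meet hc hb' (h1.trans k1))).elim

theorem Cut.lean_off (hst : Δ.Strong) (hc : Cor Δ X Y Z) (ha : Cut Δ X Y Z a)
    (hb : Cut Δ Z Y X b) (h : ft b X Z < ft a X Z) (hβ : β ∈ Δ.B) (hd : foot a X Z ∈ β)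
    (hx : x ∈ β) (hxd : x ≠ foot a X Z) : ln a x * ln a X < 0 := by
  obtain ⟨b', hb', -, hlt, hadj⟩ := ha.left_adj hst hc hb h
  have hbA := across_symm hb'.acrossZ
  obtain ⟨c, cb, ca⟩ := ha.meet hc hb' hlt
  have hκ := hc.perm.2.2.1.e12
  have hda := foot_mem hc ha.acrossZ
  have hdκ := foot_seg ha.2.2
  have hcκ := not_edge_of_S ha.1 hb'.1 (ha.ne hb') ca cb hκ
  obtain ⟨u1, u2⟩ := triangle_uns hst ha.1 hb'.1 (edge_mem_Sbar hκ) (ha.ne hb') ca cb hda hdκ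
    (foot_mem hc hbA) (foot_seg hbA.2) hcκ (hadj.symm.uns hc ha.acrossZ hbA)
  have hκ0 := blk_ln_ne hβ (edge_mem_Sbar hκ) hd hdκ hx hxd
  have h1 := edge_pos hκ (blk_sub hβ hx) (Sbar_sub (Or.inl ha.1) ca)
    (fun h => hκ0 (ln_of_mem (edge_mem_Sbar hκ) h)) hcκ
  have h0 := blk_ln_ne hβ (Or.inl ha.1) hd hda hx hxd
  have hX := hc.ln_ne ha.1
  by_contra hh
  have h2 : 0 < ln a x * ln a X := lt_of_le_of_ne (not_lt.1 hh) (mul_ne_zero h0 hX).symm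
  have h3 := foot_lt ha.2.2 hlt
  rw [mul_comm] at h2
  exact tri_block (Or.inl ha.1) (edge_mem_Sbar hκ) (Or.inl hb'.1) hda hdκ ca cb (foot_seg hbA.2)
    (foot_mem hc hbA) u1.symm (hadj.symm.uns hc ha.acrossZ hbA) hβ hd hx h1 (ppos h2 h3)

theorem Cut.adj_aux (hst : Δ.Strong) (hc : Cor Δ X Y Z) {s t : Set Pt} (hs : Cut Δ X Y Z s)
    (ht : Cut Δ X Y Z t) (hlt : ft s X Z < ft t X Z) (hm : (s ∩ t).Nonempty) :
    Adj Δ X Z s t := by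
  by_contra hadj
  have hfin : ({g | Cut Δ X Y Z g ∧ ∃ t, Cut Δ X Y Z t ∧ ft g X Z < ft t X Z ∧ (g ∩ t).Nonempty ∧
      ¬ Adj Δ X Z g t}).Finite := Δ.finS.subset fun g hg => hg.1.1
  obtain ⟨g, ⟨hg, y', hy', hlt', hm', hna⟩, hmin⟩ :=
    Set.exists_min_image _ (fun g => ft g X Z) hfin ⟨s, hs, t, ht, hlt, hm, hadj⟩
  clear hadj hlt hm hs ht
  have hfin2 : ({y | Cut Δ X Y Z y ∧ ft g X Z < ft y X Z}).Finite :=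
    Δ.finS.subset fun g hg => hg.1.1
  obtain ⟨y, ⟨hy, hgy⟩, hymin⟩ :=
    Set.exists_min_image _ (fun y => ft y X Y) hfin2 ⟨y', hy', hlt'⟩
  have hc' := hc.perm.2.2.1
  have h2 := hg.lt_of_meet_same hc hy' hlt' hm'
  have hyy' := hymin y' ⟨hy', hlt'⟩
  have hygY : ft y X Y < ft g X Y := hyy'.trans_lt h2
  have cross : ∀ f ∈ Across Δ X Z, ft g X Z ≤ ft f X Z → ft f X Z < ft y X Z →
      (y ∩ f).Nonempty := by
    intro f hf h1 h3
    rw [inter_comm]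
    by_cases e : f = g
    · subst e
      exact hg.meet_same hc hy hgy hygY
    have h1' := lt_of_le_of_ne h1 (ft_ne hc hg.acrossZ hf (Ne.symm e))
    rcases across_cases hc hf with hf' | hf'
    · refine hf'.meet_same hc hy h3 ?_
      refine lt_of_le_of_ne (hymin f ⟨hf', h1'⟩) (ft_ne hc' hy.acrossY hf'.acrossY ?_)
      rintro rfl
      exact lt_irrefl _ h3
    · exact hy.meet hc hf' h3
  have hadj : Adj Δ X Z g y := by
    obtain ⟨f, hf, k1, k2, k3⟩ := prev hg.acrossZ hy.acrossZ hgy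
    by_cases e : f = g
    · exact e ▸ k3
    obtain ⟨f', hf', l1, l2, l3⟩ :=
      prev hg.acrossZ hf (lt_of_le_of_ne k2 (ft_ne hc hg.acrossZ hf (Ne.symm e)))
    exact (psi_ft hst hc hy.acrossZ hf hf'
      (mul_pos_of_neg_of_neg (by linarith) (by linarith)) k3.symm l3.symm
      (cross f hf k2 k1) (cross f' hf' l2 (l1.trans k1))).elim
  have hne : y ≠ y' := by
    rintro rfl
    exact hna hadj
  have hyy : ft y X Z < ft y' X Z := by
    by_contra hh
    have h5 := hadj y' hy'.acrossZ
    have := ft_ne hc hy.acrossZ hy'.acrossZ hne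
    have h6 := lt_of_le_of_ne (not_lt.1 hh) this.symm
    nlinarith
  have cross2 : ∀ f ∈ Across Δ X Y, ft y X Y ≤ ft f X Y → ft f X Y < ft g X Y →
      (g ∩ f).Nonempty := by
    intro f hf h1 h3
    have hfg : f ≠ g := by
      rintro rfl
      exact lt_irrefl _ h3
    rcases across_cases hc' hf with hf' | hf'
    · replace hf' := hf'.swap
      rcases lt_or_gt_of_ne (ft_ne hc hf'.acrossZ hg.acrossZ hfg) with h4 | h4
      · exfalso
        have hfy : y ≠ f := by
          rintro rfl
          linarith
        have h1' := lt_of_le_of_ne h1 (ft_ne hc' hy.acrossY hf'.acrossY hfy)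
        have h5 := hmin f ⟨hf', y, hy, h4.trans hgy, hf'.meet_same hc hy (h4.trans hgy) h1', ?_⟩
        · linarith
        · intro h6
          have := h6 g hg.acrossZ
          nlinarith
      · exact hg.meet_same hc hf' h4 h3
    · rw [inter_comm]
      exact hg.swap.meet hc' hf' h3
  obtain ⟨f, hf, k1, k2, k3⟩ := prev hy.acrossY hg.acrossY hygY
  have e : f ≠ y := by
    rintro rfl
    have h5 := k3 y' hy'.acrossY
    have := lt_of_le_of_ne hyy' (ft_ne hc' hf hy'.acrossY hne)
    nlinarith
  obtain ⟨f', hf', l1, l2, l3⟩ :=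
    prev hy.acrossY hf (lt_of_le_of_ne k2 (ft_ne hc' hy.acrossY hf e.symm))
  exact psi_ft hst hc' hg.acrossY hf hf'
      (mul_pos_of_neg_of_neg (by linarith) (by linarith)) k3.symm l3.symm
      (cross2 f hf k2 k1) (cross2 f' hf' l2 (l1.trans k1))

theorem Cut.adj (hst : Δ.Strong) (hc : Cor Δ X Y Z) {s t : Set Pt} (hs : Cut Δ X Y Z s)
    (ht : Cut Δ X Y Z t) (hne : s ≠ t) (hm : (s ∩ t).Nonempty) : Adj Δ X Z s t := by
  rcases lt_or_gt_of_ne (ft_ne hc hs.acrossZ ht.acrossZ hne) with h | h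
  · exact hs.adj_aux hst hc ht h hm
  · exact (ht.adj_aux hst hc hs h (inter_comm s t ▸ hm)).symm

end TBA

namespace TBA

variable {Δ : TBA} {X Y Z : Pt} {s s' t β β' a b : Set Pt} {x y z u w v p d : Pt}

theorem even_of_partner {α : Type*} (F : Set α) (hF : F.Finite) (r : α → α → Prop)
    (hs : ∀ x y, r x y → r y x) (hex : ∀ x ∈ F, ∃ y ∈ F, y ≠ x ∧ r x y)
    (hu : ∀ x ∈ F, ∀ y ∈ F, ∀ z ∈ F, r x y → r x z → y ≠ x → z ≠ x → y = z) :
    Even F.ncard := by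
  classical
  choose! f hfF hfne hfr using hex
  rw [ncard_eq_toFinset_card F hF]
  have h : ∑ x ∈ hF.toFinset, (1 : ZMod 2) = 0 := by
    refine Finset.sum_involution (fun x _ => f x) (fun _ _ => by decide) ?_ ?_ ?_
    · intro x hx _
      exact hfne x (hF.mem_toFinset.1 hx)
    · intro x hx
      exact hF.mem_toFinset.2 (hfF x (hF.mem_toFinset.1 hx))
    · intro x hx
      have hx := hF.mem_toFinset.1 hx
      have h1 := hfF x hx
      exact hu (f x) h1 _ (hfF _ h1) x hx (hfr _ h1) (hs _ _ (hfr x hx)) (hfne _ h1)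
        (hfne x hx).symm
  rw [Finset.sum_const, nsmul_eq_mul, mul_one] at h
  exact (ZMod.natCast_eq_zero_iff_even).1 h

theorem segment_btw (hx : x ∈ segment ℝ u v) (hy : y ∈ segment ℝ u v) (hz : z ∈ segment ℝ u v)
    (hxy : x ≠ y) (hxz : x ≠ z) (hyz : y ≠ z) : Btw x y z ∨ Btw y z x ∨ Btw x z y := by
  have key : ∀ q r m : ℝ, q < r → r < m → Btw (mv u v q) (mv u v m) (mv u v r) := by
    intro q r m h1 h2
    refine ⟨(r - q) / (m - q), div_pos (by linarith) (by linarith),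
      (div_lt_one (by linarith)).2 (by linarith), ?_⟩
    have : m - q ≠ 0 := by linarith
    unfold mv
    ext <;> simp <;> field_simp <;> ring
  obtain ⟨q, -, -, rfl⟩ := mem_seg.1 hx
  obtain ⟨r, -, -, rfl⟩ := mem_seg.1 hy
  obtain ⟨m, -, -, rfl⟩ := mem_seg.1 hz
  have h1 : q ≠ r := by rintro rfl; exact hxy rfl
  have h2 : q ≠ m := by rintro rfl; exact hxz rfl
  have h3 : r ≠ m := by rintro rfl; exact hyz rfl
  rcases lt_or_gt_of_ne h1 with h1 | h1 <;> rcases lt_or_gt_of_ne h2 with h2 | h2 <;>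
    rcases lt_or_gt_of_ne h3 with h3 | h3
  · exact Or.inr (Or.inr (key _ _ _ h1 h3))
  · exact Or.inl (key _ _ _ h2 h3)
  · linarith
  · exact Or.inr (Or.inl (key _ _ _ h2 h1).symm)
  · exact Or.inr (Or.inl (key _ _ _ h1 h2))
  · linarith
  · exact Or.inl (key _ _ _ h3 h2).symm
  · exact Or.inr (Or.inr (key _ _ _ h3 h1).symm)

/-- `v` are the corners and `s` the opposite sides of a triangle formed by initial segments. -/
structure Tri3 (Δ : TBA) (v : Fin 3 → Pt) (s : Fin 3 → Set Pt) : Prop where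
  hs : ∀ i, s i ∈ Δ.Sbar
  on : ∀ i j, i ≠ j → v j ∈ s i
  off : ∀ i, ln (s i) (v i) ≠ 0

/-- The open triangle with corners `v` and sides `s`. -/
def Ins (v : Fin 3 → Pt) (s : Fin 3 → Set Pt) : Set Pt :=
  {x | ∀ i, 0 < ln (s i) (v i) * ln (s i) x}

/-- Some blocking segment through `w` enters the open triangle. -/
def Enters (Δ : TBA) (v : Fin 3 → Pt) (s : Fin 3 → Set Pt) (w : Pt) : Prop :=
  ∃ β ∈ Δ.B, w ∈ β ∧ (β ∩ Ins v s).Nonempty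

namespace Tri3

variable {v : Fin 3 → Pt} {s : Fin 3 → Set Pt}

theorem on0 (h : Tri3 Δ v s) {i j : Fin 3} (hij : i ≠ j) : ln (s i) (v j) = 0 :=
  ln_of_mem (h.hs i) (h.on i j hij)

theorem ne_side (h : Tri3 Δ v s) {i j : Fin 3} (hij : i ≠ j) : s i ≠ s j := fun e =>
  h.off i (e ▸ h.on0 hij.symm)

theorem ne_corner (h : Tri3 Δ v s) {i j : Fin 3} (hij : i ≠ j) : v i ≠ v j := fun e =>
  h.off i (e ▸ h.on0 hij)

theorem bary (h : Tri3 Δ v s) (t : Set Pt) (x : Pt) : ∃ c : Fin 3 → ℝ,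
    (∀ i, ln (s i) x = c i * ln (s i) (v i)) ∧ ln t x = ∑ i, c i * ln t (v i) := by
  refine ⟨fun i => ln (s i) x / ln (s i) (v i), fun i => (div_mul_cancel₀ _ (h.off i)).symm, ?_⟩
  have hd := decomp (h.hs 0) (h.hs 1) (h.ne_side (by decide)) (h.on 0 2 (by decide))
    (h.on 1 2 (by decide)) (h.on 0 1 (by decide)) (h.ne_corner (by decide))
    (h.on 1 0 (by decide)) (h.ne_corner (by decide))
  have o0 := h.off 0
  have o1 := h.off 1
  have o2 := h.off 2
  obtain ⟨A, B, e⟩ := hd t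
  obtain ⟨A', B', e'⟩ := hd (s 2)
  have a0 := e (v 0)
  have a1 := e (v 1)
  have a0' := e' (v 0)
  have a1' := e' (v 1)
  have ax := e x
  have ax' := e' x
  rw [h.on0 (show (1 : Fin 3) ≠ 0 by decide)] at a0 a0'
  rw [h.on0 (show (0 : Fin 3) ≠ 1 by decide)] at a1 a1'
  rw [h.on0 (show (2 : Fin 3) ≠ 0 by decide)] at a0'
  rw [h.on0 (show (2 : Fin 3) ≠ 1 by decide)] at a1'
  have hA : A' = - ln (s 2) (v 2) / ln (s 0) (v 0) := by field_simp; linarith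
  have hB : B' = - ln (s 2) (v 2) / ln (s 1) (v 1) := by field_simp; linarith
  simp only [Fin.sum_univ_three]
  rw [ax, ax', a0, a1, hA, hB]
  field_simp
  ring

theorem ins_not_bdry (h : Tri3 Δ v s) (hx : x ∈ Ins v s) : x ∉ Δ.bdry := by
  intro hb
  obtain ⟨κ, hκ, hxκ⟩ := mem_bdry.1 hb
  obtain ⟨c, hc, hsum⟩ := h.bary κ x
  have hκ' := edge_mem_Sbar hκ
  rw [ln_of_mem hκ' hxκ] at hsum
  have hcp : ∀ i, 0 < c i := by
    intro i
    have h1 := hx i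
    rw [hc i] at h1
    have h2 := mul_self_pos.2 (h.off i)
    by_contra hh
    nlinarith
  have hvT : ∀ i, v i ∈ Δ.tri := fun i =>
    Sbar_sub (h.hs (i + 1)) (h.on _ _ (by fin_cases i <;> decide))
  have sg : ∀ i j, 0 ≤ ln κ (v i) * ln κ (v j) := fun i j => edge_sign hκ (hvT i) (hvT j)
  have hz : ∀ i, ln κ (v i) = 0 := by
    intro i
    have e : ∑ j, c j * (ln κ (v i) * ln κ (v j)) = 0 := by
      rw [← mul_zero (ln κ (v i)), hsum, Finset.mul_sum]
      exact Finset.sum_congr rfl fun j _ => by ring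
    have := (Finset.sum_eq_zero_iff_of_nonneg fun j _ => mul_nonneg (hcp j).le (sg i j)).1 e i
      (Finset.mem_univ i)
    have := (mul_eq_zero.1 this).resolve_left (hcp i).ne'
    exact mul_self_eq_zero.1 this
  have hm : ∀ i, v i ∈ κ := fun i => mem_edge hκ (hvT i) (hz i)
  have e := Sbar_eq_of_two (h.hs 2) hκ' (h.ne_corner (show (0 : Fin 3) ≠ 1 by decide))
    (h.on 2 0 (by decide)) (hm 0) (h.on 2 1 (by decide)) (hm 1)
  exact h.off 2 (e ▸ hz 2)

theorem two : ∀ i : Fin 3, ∃ j k, j ≠ i ∧ k ≠ i ∧ j ≠ k ∧ ∀ l, l = i ∨ l = j ∨ l = k := by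
  decide

theorem even_side {v : Fin 3 → Pt} {s : Fin 3 → Set Pt} (F : Set Pt) (hF : F.Finite)
    (K : Set (Set Pt))
    (hK : ∀ κ ∈ K, ∃ a b, κ = segment ℝ a b)
    (hex : ∀ x ∈ F, ∃ y ∈ F, y ≠ x ∧ ∃ κ ∈ K, x ∈ κ ∧ y ∈ κ)
    (hu : ∀ x ∈ F, ∀ κ ∈ K, ∀ κ' ∈ K, x ∈ κ → x ∈ κ' → κ = κ')
    (hs : ∀ x ∈ F, ∃ i, ln (s i) x = 0) (hn : ∀ x ∈ F, ∀ i, 0 ≤ ln (s i) (v i) * ln (s i) x)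
    (hv : ∀ i, ln (s i) (v i) ≠ 0)
    (h1 : ∀ κ ∈ K, ∀ i, ∀ x ∈ F, ∀ y ∈ F, x ∈ κ → y ∈ κ → ln (s i) x = 0 → ln (s i) y = 0 → x = y) :
    Even F.ncard := by
  refine even_of_partner F hF (fun x y => ∃ κ ∈ K, x ∈ κ ∧ y ∈ κ) ?_ hex ?_
  · rintro x y ⟨κ, hκ, hx, hy⟩
    exact ⟨κ, hκ, hy, hx⟩
  · rintro x hx y hy z hz ⟨κ, hκ, xκ, yκ⟩ ⟨κ', hκ', xκ', zκ⟩ hyx hzx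
    have e := hu x hx κ hκ κ' hκ' xκ xκ'
    subst e
    by_contra hyz
    have key : ∀ p ∈ F, ∀ q ∈ F, ∀ m ∈ F, p ∈ κ → q ∈ κ → m ∈ κ → m ≠ p → ¬ Btw p q m := by
      intro p hp q hq m hm pκ qκ mκ hne hB
      obtain ⟨i, hi⟩ := hs m hm
      have hp0 : ln (s i) p = 0 := by
        by_contra h0
        have h2 := hB.pos1 (lt_of_le_of_ne (hn p hp i) (mul_ne_zero (hv i) h0).symm) (hn q hq i)
        rw [hi] at h2
        simp at h2
      exact hne (h1 κ hκ i m hm p hp mκ pκ hi hp0)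
    obtain ⟨a, b, rfl⟩ := hK κ hκ
    rcases segment_btw xκ yκ zκ hyx.symm hzx.symm hyz with h | h | h
    · exact key x hx y hy z hz xκ yκ zκ hzx h
    · exact key y hy z hz x hx yκ zκ xκ hyx.symm h
    · exact key x hx z hz y hy xκ zκ yκ hyx h

/-- Vertices of the arrangement on the boundary of the triangle, other than its corners. -/
def sideVerts (Δ : TBA) (v : Fin 3 → Pt) (s : Fin 3 → Set Pt) : Set Pt :=
  {w | ∃ i, w ∈ s i ∧ (∀ j, j ≠ i → 0 < ln (s j) (v j) * ln (s j) w) ∧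
    ∃ t ∈ Δ.Sbar, (∀ j, t ≠ s j) ∧ w ∈ t}

theorem sideVerts_finite (h : Tri3 Δ v s) : (sideVerts Δ v s).Finite := by
  have hfin : (⋃ i, ⋃ t ∈ {t | t ∈ Δ.Sbar ∧ ∀ j, t ≠ s j}, (s i ∩ t)).Finite := by
    refine Set.finite_iUnion fun i => Set.Finite.biUnion ((Sbar_fin Δ).subset fun t ht => ht.1) ?_
    intro t ht
    apply Set.Subsingleton.finite
    intro x hx y hy
    exact inter_unique (h.hs i) ht.1 (ht.2 i).symm hx.1 hx.2 hy.1 hy.2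
  refine hfin.subset ?_
  rintro w ⟨i, hi, -, t, ht, hts, hwt⟩
  simp only [mem_iUnion]
  exact ⟨i, t, ⟨ht, hts⟩, hi, hwt⟩

theorem btw_corners (h : Tri3 Δ v s) {i j k : Fin 3} (hji : j ≠ i) (hki : k ≠ i) (hjk : j ≠ k)
    (hw : w ∈ s i)
    (hpos : ∀ l, l ≠ i → 0 < ln (s l) (v l) * ln (s l) w) : Btw (v j) (v k) w := by
  obtain ⟨τ, rfl⟩ := on_chord (h.hs i) (h.ne_corner hjk) (h.on i j hji.symm) (h.on i k hki.symm) hw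
  have h1 := hpos j hji
  have h2 := hpos k hki
  rw [ln_mv, h.on0 hjk] at h1
  rw [ln_mv, h.on0 hjk.symm] at h2
  have o1 := mul_self_pos.2 (h.off j)
  have o2 := mul_self_pos.2 (h.off k)
  refine ⟨τ, ?_, ?_, rfl⟩
  · by_contra hh; nlinarith
  · by_contra hh; nlinarith

theorem sideVerts_sep (h : Tri3 Δ v s) {i j k : Fin 3} (hji : j ≠ i) (hki : k ≠ i) (hjk : j ≠ k)
    (hw : w ∈ s i)
    (hpos : ∀ l, l ≠ i → 0 < ln (s l) (v l) * ln (s l) w) (ht : t ∈ Δ.Sbar) (hts : ∀ j, t ≠ s j)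
    (hwt : w ∈ t) : ln t (v j) * ln t (v k) < 0 := by
  have hB := h.btw_corners hji hki hjk hw hpos
  refine hB.sep_of_zero (ln_of_mem ht hwt) fun h0 => ?_
  have hvt := mem_of_ln ht (Sbar_sub (h.hs i) (h.on i j hji.symm)) h0
  have hwv : w ≠ v j := by
    rintro rfl
    have := hpos k hki
    rw [h.on0 hjk.symm] at this
    simp at this
  exact hts i (Sbar_eq_of_two ht (h.hs i) hwv hwt hw hvt (h.on i j hji.symm))

theorem sideVerts_even (h : Tri3 Δ v s) : Even (sideVerts Δ v s).ncard := by
  refine even_side (v := v) (s := s) _ h.sideVerts_finite {t | t ∈ Δ.Sbar ∧ ∀ j, t ≠ s j} ?_ ?_ ?_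
    ?_ ?_ h.off ?_
  · rintro κ ⟨hκ, -⟩
    obtain ⟨a, b, -, e⟩ := Sbar_wf hκ
    exact ⟨a, b, e⟩
  · rintro w ⟨i, hi, hpos, t, ht, hts, hwt⟩
    have main : ∀ j k, j ≠ i → k ≠ i → j ≠ k → (∀ l, l = i ∨ l = j ∨ l = k) →
        ln t (v i) * ln t (v j) < 0 → ∃ y ∈ sideVerts Δ v s, y ≠ w ∧
          ∃ κ ∈ {t | t ∈ Δ.Sbar ∧ ∀ j, t ≠ s j}, w ∈ κ ∧ y ∈ κ := by
      intro j k hji hki hjk hl hsep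
      obtain ⟨y, yt, ys, hB⟩ := exists_btw (h.hs k) ht (h.on k i hki) (h.on k j hjk.symm) hsep
      refine ⟨y, ⟨k, ys, ?_, t, ht, hts, yt⟩, ?_, t, ⟨ht, hts⟩, hwt, yt⟩
      · intro l hlk
        rcases hl l with rfl | rfl | rfl
        · exact hB.pos1 (mul_self_pos.2 (h.off l)) (by rw [h.on0 hji.symm]; simp)
        · exact hB.pos2 (by rw [h.on0 hji]; simp) (mul_self_pos.2 (h.off l))
        · exact absurd rfl hlk
      · rintro rfl
        have := hpos k hki
        rw [ln_of_mem (h.hs k) ys] at this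
        simp at this
    obtain ⟨j, k, hji, hki, hjk, hl⟩ := two i
    have hsep := h.sideVerts_sep hji hki hjk hi hpos ht hts hwt
    rcases lt_or_ge (ln t (v i) * ln t (v j)) 0 with h1 | h1
    · exact main j k hji hki hjk hl h1
    · refine main k j hki hji hjk.symm (fun l => by rcases hl l with h | h | h <;> simp [h]) ?_
      have h0 : ln t (v i) ≠ 0 := by
        intro h0
        have hm := mem_of_ln ht (Sbar_sub (h.hs k) (h.on k i hki)) h0
        rcases three (h.hs j) (h.hs k) (h.ne_side hjk) (h.on j i hji) (h.on k i hki)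
          ht hm with e | e
        · exact hts j e
        · exact hts k e
      rw [mul_comm] at hsep
      have := neg_mul_of_nonneg (c := ln t (v i)) hsep
        (by linarith [mul_comm (ln t (v i)) (ln t (v j))]) h0
      linarith [mul_comm (ln t (v i)) (ln t (v k))]
  · rintro x ⟨i, hi, -⟩ κ ⟨hκ, hκs⟩ κ' ⟨hκ', hκs'⟩ hx hx'
    exact ((three (h.hs i) hκ (hκs i).symm hi hx hκ' hx').resolve_left (hκs' i)).symm
  · rintro x ⟨i, hi, -⟩
    exact ⟨i, ln_of_mem (h.hs i) hi⟩
  · rintro x ⟨i, hi, hpos, -⟩ j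
    by_cases e : j = i
    · subst e
      rw [ln_of_mem (h.hs j) hi]
      simp
    · exact (hpos j e).le
  · rintro κ ⟨hκ, hκs⟩ i x ⟨_, -⟩ y - hx hy hx0 hy0
    exact inter_unique hκ (h.hs i) (hκs i) hx (mem_of_ln (h.hs i) (Sbar_sub hκ hx) hx0) hy
      (mem_of_ln (h.hs i) (Sbar_sub hκ hy) hy0)

end Tri3

end TBA

namespace TBA

variable {Δ : TBA} {X Y Z : Pt} {s s' t β β' a b : Set Pt} {x y z u w v p d : Pt}

namespace Tri3

variable {v : Fin 3 → Pt} {s : Fin 3 → Set Pt}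

/-- Boundary points of the triangle through which a blocking segment enters it. -/
def entries (Δ : TBA) (v : Fin 3 → Pt) (s : Fin 3 → Set Pt) : Set Pt :=
  {w | (∃ i, w ∈ s i) ∧ (∀ i, 0 ≤ ln (s i) (v i) * ln (s i) w) ∧ Enters Δ v s w}

theorem not_mem_ins (h : Tri3 Δ v s) {i : Fin 3} (hx : x ∈ s i) : x ∉ Ins v s := by
  intro h'
  have := h' i
  rw [ln_of_mem (h.hs i) hx] at this
  simp at this

theorem exit (h : Tri3 Δ v s) (hβ : β ∈ Δ.B) {i : Fin 3} (hwi : w ∈ s i)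
    (hwβ : w ∈ β) (hxβ : x ∈ β)
    (hx : x ∈ Ins v s) : ∃ y ∈ β, y ≠ w ∧ (∃ j, y ∈ s j) ∧
      ∀ i, 0 ≤ ln (s i) (v i) * ln (s i) y := by
  have hwx : w ≠ x := by
    rintro rfl
    exact h.not_mem_ins hwi hx
  obtain ⟨τ, hτ, heβ, heb⟩ := blk_extend hβ hwβ hxβ hwx (h.ins_not_bdry hx)
  let g : Fin 3 → ℝ → ℝ := fun i r => ln (s i) (v i) * ln (s i) (mv w x r)
  have hg : ∀ i, Continuous (g i) := by
    intro i
    simp only [g, ln_mv]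
    fun_prop
  let m : ℝ → ℝ := fun r => min (g 0 r) (min (g 1 r) (g 2 r))
  have hm : Continuous m := (hg 0).min ((hg 1).min (hg 2))
  have e1 : mv w x 1 = x := by unfold mv; ext <;> simp
  have m1 : 0 ≤ m 1 := by
    have k : ∀ i, 0 ≤ g i 1 := fun i => by simp only [g, e1]; exact (hx i).le
    exact le_min (k 0) (le_min (k 1) (k 2))
  have m2 : m τ ≤ 0 := by
    by_contra hh
    push Not at hh
    refine h.ins_not_bdry (fun i => ?_) heb
    have := lt_min_iff.1 hh
    have h3 := lt_min_iff.1 this.2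
    fin_cases i
    exacts [this.1, h3.1, h3.2]
  obtain ⟨r, ⟨hr1, hr2⟩, hr⟩ := intermediate_value_Icc' hτ.le hm.continuousOn ⟨m2, m1⟩
  have hyβ : mv w x r ∈ β := by
    have e : mv w x r = mv w (mv w x τ) (r / τ) := by
      have : τ ≠ 0 := by linarith
      unfold mv
      ext <;> simp <;> field_simp
    rw [e]
    exact mv_mem (blk_convex hβ) hwβ heβ (div_nonneg (by linarith) (by linarith))
      ((div_le_one (by linarith)).2 hr2)
  have hn : ∀ i, 0 ≤ g i r := by
    have := le_min_iff.1 hr.ge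
    have h3 := le_min_iff.1 this.2
    intro i
    fin_cases i
    exacts [this.1, h3.1, h3.2]
  refine ⟨_, hyβ, ?_, ?_, hn⟩
  · intro e
    have e0 : mv w x r = mv w x 0 := by rw [e]; unfold mv; ext <;> simp
    have := mv_inj hwx e0
    linarith
  · have : ∃ j, g j r = 0 := by
      by_contra hh
      push Not at hh
      have : 0 < m r := lt_min (lt_of_le_of_ne (hn 0) (hh 0).symm)
        (lt_min (lt_of_le_of_ne (hn 1) (hh 1).symm) (lt_of_le_of_ne (hn 2) (hh 2).symm))
      exact this.ne' hr
    obtain ⟨j, hj⟩ := this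
    exact ⟨j, mem_of_ln (h.hs j) (blk_sub hβ hyβ) ((mul_eq_zero.1 hj).resolve_left (h.off j))⟩

theorem entries_even (h : Tri3 Δ v s) (hF : (entries Δ v s).Finite) :
    Even (entries Δ v s).ncard := by
  refine even_side (v := v) (s := s) _ hF Δ.B ?_ ?_ ?_ ?_ ?_ h.off ?_
  · intro κ hκ
    obtain ⟨a, b, -, e, -⟩ := Δ.seg_wf κ (Or.inr hκ)
    exact ⟨a, b, e⟩
  · rintro w ⟨⟨i, hi⟩, -, β, hβ, hwβ, x, hxβ, hx⟩
    obtain ⟨y, hyβ, hne, hy, hyn⟩ := h.exit hβ hi hwβ hxβ hx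
    exact ⟨y, ⟨hy, hyn, β, hβ, hyβ, x, hxβ, hx⟩, hne, β, hβ, hwβ, hyβ⟩
  · rintro w ⟨⟨i, hi⟩, -⟩ β hβ β' hβ' h1 h2
    exact blk_eq (h.hs i) hβ hβ' hi h1 h2
  · rintro w ⟨⟨i, hi⟩, -⟩
    exact ⟨i, ln_of_mem (h.hs i) hi⟩
  · rintro w ⟨-, hn, -⟩
    exact hn
  · rintro β hβ i x - y - hx hy hx0 hy0
    exact blk_unique hβ (h.hs i) hx (mem_of_ln (h.hs i) (blk_sub hβ hx) hx0) hy
      (mem_of_ln (h.hs i) (blk_sub hβ hy) hy0)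

theorem sideVerts_sub (h : Tri3 Δ v s) : sideVerts Δ v s ⊆ entries Δ v s := by
  rintro w ⟨i, hi, hpos, t, ht, hts, hwt⟩
  have hw : ∀ j, 0 ≤ ln (s j) (v j) * ln (s j) w := by
    intro j
    by_cases e : j = i
    · subst e
      rw [ln_of_mem (h.hs j) hi]
      simp
    · exact (hpos j e).le
  obtain ⟨j, k, hji, hki, hjk, hl⟩ := two i
  have htS := S_of_sep ht (Sbar_sub (h.hs i) (h.on i j hji.symm))
    (Sbar_sub (h.hs i) (h.on i k hki.symm)) (h.sideVerts_sep hji hki hjk hi hpos ht hts hwt)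
  obtain ⟨β, hβ, hwβ⟩ := blk_ex htS (h.hs i) (hts i) hwt hi
  have hx : ∃ x ∈ β, x ≠ w ∧ 0 < ln (s i) (v i) * ln (s i) x := by
    by_cases hb : w ∈ Δ.bdry
    · have hsi : s i ∈ triEdges Δ.x1 Δ.x2 Δ.x3 := by
        by_contra hne
        have hS : s i ∈ Δ.S := (h.hs i).resolve_right hne
        exact S_inter_not_bdry htS hS (hts i) hwt hi hb
      obtain ⟨x, hx, hne⟩ := blk_ne hβ w
      have h0 := blk_ln_ne hβ (h.hs i) hwβ hi hx hne
      have hviT : v i ∈ Δ.tri := Sbar_sub (h.hs j) (h.on j i hji)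
      exact ⟨x, hx, hne, lt_of_le_of_ne (edge_sign hsi hviT (blk_sub hβ hx))
        (mul_ne_zero (h.off i) h0).symm⟩
    · exact blk_side hβ hwβ hb (h.hs i) hi (h.off i)
  obtain ⟨x, hx, hne, hxi⟩ := hx
  refine ⟨⟨i, hi⟩, hw, β, hβ, hwβ, ?_⟩
  have hev : ∀ j, j ≠ i → ∀ᶠ r in nhds (0 : ℝ), 0 < ln (s j) (v j) * ln (s j) (mv w x r) := by
    intro j hj
    have hcont : Continuous fun r => ln (s j) (v j) * ln (s j) (mv w x r) := by
      simp only [ln_mv]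
      fun_prop
    refine hcont.continuousAt.eventually (lt_mem_nhds ?_)
    simpa [ln_mv] using hpos j hj
  have := ((hev j hji).and (hev k hki)).filter_mono (nhdsWithin_le_nhds (s := Ioi 0))
  obtain ⟨r, ⟨hrj, hrk⟩, hr0, hr1⟩ :=
    (this.and (Ioo_mem_nhdsGT (zero_lt_one (α := ℝ)))).exists
  refine ⟨mv w x r, mv_mem (blk_convex hβ) hwβ hx hr0.le hr1.le, fun l => ?_⟩
  rcases hl l with rfl | rfl | rfl
  · rw [ln_mv, ln_of_mem (h.hs l) hi]
    have := mul_pos hr0 hxi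
    linarith
  · exact hrj
  · exact hrk

theorem entries_cases (h : Tri3 Δ v s) (hw : w ∈ entries Δ v s) :
    w ∈ sideVerts Δ v s ∨ ∃ i, w = v i := by
  obtain ⟨⟨i, hi⟩, hn, β, hβ, hwβ, -⟩ := hw
  obtain ⟨j, k, hji, hki, hjk, hl⟩ := two i
  by_cases hj : ln (s j) w = 0
  · right
    exact ⟨k, inter_unique (h.hs i) (h.hs j) (h.ne_side hji.symm) hi
      (mem_of_ln (h.hs j) (blk_sub hβ hwβ) hj) (h.on i k hki.symm) (h.on j k hjk)⟩
  by_cases hk : ln (s k) w = 0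
  · right
    exact ⟨j, inter_unique (h.hs i) (h.hs k) (h.ne_side hki.symm) hi
      (mem_of_ln (h.hs k) (blk_sub hβ hwβ) hk) (h.on i j hji.symm) (h.on k j hjk.symm)⟩
  left
  obtain ⟨t, ht, hti, hwt⟩ := blk_second hβ (h.hs i) hwβ hi
  refine ⟨i, hi, fun l hli => ?_, t, ht, fun l e => ?_, hwt⟩
  · refine lt_of_le_of_ne (hn l) (mul_ne_zero (h.off l) ?_).symm
    rcases hl l with rfl | rfl | rfl
    exacts [absurd rfl hli, hj, hk]
  · have h0 := ln_of_mem ht hwt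
    rw [e] at h0
    rcases hl l with rfl | rfl | rfl
    exacts [hti e, hj h0, hk h0]

theorem corner_not_sideVert (h : Tri3 Δ v s) (k : Fin 3) : v k ∉ sideVerts Δ v s := by
  rintro ⟨i, hi, hpos, -⟩
  by_cases hik : i = k
  · subst hik
    exact h.off i (ln_of_mem (h.hs i) hi)
  · obtain ⟨a, b, hai, hbi, hab, hl⟩ := two i
    rcases hl k with rfl | rfl | rfl
    · exact hik rfl
    · have := hpos b hbi
      rw [h.on0 hab.symm] at this
      simp at this
    · have := hpos a hai
      rw [h.on0 hab] at this
      simp at this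

/-- If no blocking segment enters a triangle of initial segments through two of its corners, then
none enters through the third one. -/
theorem parity (h : Tri3 Δ v s) (k : Fin 3) (hk : ∀ i, i ≠ k → ¬ Enters Δ v s (v i)) :
    ¬ Enters Δ v s (v k) := by
  intro hen
  have hmem : v k ∈ entries Δ v s := by
    obtain ⟨j, l, hjk, -, -, -⟩ := two k
    refine ⟨⟨j, h.on j k hjk⟩, fun i => ?_, hen⟩
    by_cases e : i = k
    · subst e; exact mul_self_nonneg _
    · rw [h.on0 e]; simp
  have e : entries Δ v s = insert (v k) (sideVerts Δ v s) := by
    apply Subset.antisymm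
    · intro w hw
      rcases h.entries_cases hw with h1 | ⟨i, rfl⟩
      · exact Or.inr h1
      · left
        by_contra hne
        exact hk i (fun e => hne (by rw [e])) hw.2.2
    · rintro w (rfl | hw)
      · exact hmem
      · exact h.sideVerts_sub hw
  have hfin := h.sideVerts_finite
  have h1 := h.entries_even (e ▸ hfin.insert (v k))
  rw [e, ncard_insert_of_notMem (h.corner_not_sideVert k) hfin] at h1
  exact (Nat.not_even_iff_odd.2 (h.sideVerts_even.add_one)) h1

end Tri3

end TBA

namespace TBA

variable {Δ : TBA} {X Y Z : Pt} {s s' t β β' a b : Set Pt} {x y z u w v p d : Pt}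

theorem Cut.foot_not_mem (hc : Cor Δ X Y Z) (ha : Cut Δ X Y Z a) :
    foot a X Y ∉ segment ℝ X Z := fun h =>
  hc.not_mem ha.1 (inter_unique hc.perm.2.2.1.b12 hc.b12 hc.edge_ne.symm h (foot_seg ha.2.1)
    (left_mem_segment ℝ X Z) (left_mem_segment ℝ X Y) ▸ foot_mem hc.perm.2.2.1 ha.acrossY)

/-- A proper initial segment cuts off a corner triangle. -/
theorem Cut.tri3 (hc : Cor Δ X Y Z) (ha : Cut Δ X Y Z a) :
    Tri3 Δ ![X, foot a X Y, foot a X Z] ![a, segment ℝ X Z, segment ℝ X Y] where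
  hs := by
    intro i; fin_cases i
    exacts [Or.inl ha.1, hc.perm.2.2.1.b12, hc.b12]
  on := by
    intro i j h
    fin_cases i <;> fin_cases j
    exacts [absurd rfl h, foot_mem hc.perm.2.2.1 ha.acrossY, foot_mem hc ha.acrossZ,
      left_mem_segment ℝ X Z, absurd rfl h, foot_seg ha.2.2,
      left_mem_segment ℝ X Y, foot_seg ha.2.1, absurd rfl h]
  off := by
    intro i; fin_cases i
    · exact hc.ln_ne ha.1
    · exact fun h => ha.foot_not_mem hc (mem_of_ln hc.perm.2.2.1.b12
        (foot_tri hc.perm.2.2.1 ha.2.1) h)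
    · exact fun h => ha.swap.foot_not_mem hc.perm.2.2.1 (mem_of_ln hc.b12 (foot_tri hc ha.2.2) h)

theorem Cut.corner_enters (hc : Cor Δ X Y Z) (ha : Cut Δ X Y Z a) (hβ : β ∈ Δ.B) (hX : X ∈ β) :
    Enters Δ ![X, foot a X Y, foot a X Z] ![a, segment ℝ X Z, segment ℝ X Y] X := by
  obtain ⟨x, hx, hxX⟩ := blk_ne hβ X
  obtain ⟨p, hp, hpβ, -, h2⟩ := near hβ hX hx hxX
  have key : ∀ {κ}, κ ∈ triEdges Δ.x1 Δ.x2 Δ.x3 → p ∉ κ := fun hκ h =>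
    hp.2 _ (edge_mem_Sbar hκ) (ln_of_mem (edge_mem_Sbar hκ) h)
  refine ⟨β, hβ, hX, p, hpβ, fun i => ?_⟩
  fin_cases i
  · exact (mul_comm _ _).trans_gt (h2 a (Or.inl ha.1) (hc.not_mem ha.1))
  · exact edge_pos hc.perm.2.2.1.e12 (foot_tri hc.perm.2.2.1 ha.2.1) hp.1
      (ha.foot_not_mem hc) (key hc.perm.2.2.1.e12)
  · exact edge_pos hc.e12 (foot_tri hc ha.2.2) hp.1
      (ha.swap.foot_not_mem hc.perm.2.2.1) (key hc.e12)

theorem Cut.foot_not_enters (hst : Δ.Strong) (hc : Cor Δ X Y Z) (ha : Cut Δ X Y Z a)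
    (hb : Cut Δ Z Y X b) (h : ft b X Z < ft a X Z) :
    ¬ Enters Δ ![X, foot a X Y, foot a X Z] ![a, segment ℝ X Z, segment ℝ X Y]
      (foot a X Z) := by
  rintro ⟨β, hβ, hd, x, hx, hI⟩
  have h0 : 0 < ln a X * ln a x := hI 0
  have hxd : x ≠ foot a X Z := by
    rintro rfl
    rw [ln_of_mem (Or.inl ha.1) (foot_mem hc ha.acrossZ), mul_zero] at h0
    exact lt_irrefl _ h0
  linarith [ha.lean_off hst hc hb h hβ hd hx hxd, mul_comm (ln a X) (ln a x)]

/-- Among the crossing pairs of opposite kinds there is one whose chord `a` around `X` crosses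
no other chord around `X` and a single chord around `Z`. -/
theorem exists_extremal (hst : Δ.Strong) (hc : Cor Δ X Y Z) (ha : Cut Δ X Y Z a)
    (hb : Cut Δ Z Y X b) (h : ft b X Z < ft a X Z) :
    ∃ a b, Cut Δ X Y Z a ∧ Cut Δ Z Y X b ∧ ft b X Z < ft a X Z ∧ Adj Δ X Z b a ∧
      (∀ t, Cut Δ X Y Z t → (t ∩ a).Nonempty → t = a) ∧
      (∀ t, Cut Δ Z Y X t → (t ∩ a).Nonempty → t = b) := by
  have hfin : ({g | Cut Δ X Y Z g ∧ ∃ t, Cut Δ Z Y X t ∧ ft t X Z < ft g X Z}).Finite :=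
    Δ.finS.subset fun g hg => hg.1.1
  obtain ⟨a', ⟨ha', b₀, hb₀, h₀⟩, hmin⟩ :=
    Set.exists_min_image _ (fun g => ft g X Z) hfin ⟨a, ha, b, hb, h⟩
  obtain ⟨b', hb', -, hlt, hadj⟩ := ha'.left_adj hst hc hb₀ h₀
  have hbA := across_symm hb'.acrossZ
  have hba := ha'.meet hc hb' hlt
  refine ⟨a', b', ha', hb', hlt, hadj, fun t ht hm => ?_, fun t ht hm => ?_⟩
  · by_contra hne
    have h1 := ht.adj hst hc ha' hne hm
    rcases lt_or_gt_of_ne (ft_ne hc ht.acrossZ ha'.acrossZ hne) with h2 | h2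
    · have h3 := hadj t ht.acrossZ
      have h4 := h1 b' hbA
      rcases lt_or_gt_of_ne (ft_ne hc ht.acrossZ hbA (ht.ne hb')) with h5 | h5 <;> nlinarith
    · exact psi_ft hst hc hbA ha'.acrossZ ht.acrossZ
        (mul_pos (sub_pos.2 hlt) (sub_pos.2 h2)) hadj h1.symm hba (ht.meet hc hb' (hlt.trans h2))
  · by_contra hne
    have htA := across_symm ht.acrossZ
    have h1 := ha'.lt_of_meet hc ht hm
    rcases lt_or_gt_of_ne (ft_ne hc htA hbA hne) with h2 | h2
    · obtain ⟨g, hg, k1, k2, k3⟩ := prev htA hbA h2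
      rcases across_cases hc hg with hg' | hg'
      · have := hmin g ⟨hg', t, ht, lt_of_le_of_ne k2
          (ft_ne hc htA hg (hg'.ne ht).symm)⟩
        linarith
      · exact psi_ft hst hc ha'.acrossZ hbA hg
          (mul_pos_of_neg_of_neg (sub_neg.2 hlt) (sub_neg.2 k1)) hadj.symm k3.symm
          (inter_comm b' a' ▸ hba) (inter_comm g a' ▸ ha'.meet hc hg' (k1.trans hlt))
    · have := hadj t htA
      nlinarith

end TBA

namespace TBA

variable {Δ : TBA} {X Y Z : Pt} {s s' t β β' a b : Set Pt} {x y z u w v p d : Pt}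

theorem face_step (hst : Δ.Strong) {a b h k : Set Pt} {c e' : Pt} (ha : a ∈ Δ.Sbar)
    (hb : b ∈ Δ.Sbar) (hh : h ∈ Δ.Sbar) (hk : k ∈ Δ.Sbar) (hah : a ≠ h) (hab : a ≠ b)
    (hkh : k ≠ h) (hp : Gen Δ p) (hβ : β ∈ Δ.B) (hd : d ∈ β) (hpβ : p ∈ β) (hdR : d ∈ R Δ p)
    (da : d ∈ a) (dh : d ∈ h) (hcR : c ∈ R Δ p) (hcd : c ≠ d) (ca : c ∈ a) (cb : c ∈ b)
    (hu : u ∈ R Δ p) (hud : u ≠ d) (uh : u ∈ h) (uk : u ∈ k)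
    (heβ : e' ∈ β) (heb : e' ∈ b) : e' ∈ k := by
  obtain ⟨z, zR, zd, zh, f, hf, fh, -, zf, ef⟩ :=
    forced hst ha hb hh hah hab hp hβ hd hpβ hdR da dh hcR hcd ca cb heβ heb
  have hz := (face hp hh hdR hu zR dh uh zh hud.symm ha hk hf hah hkh fh da uk zf).resolve_left zd
  subst hz
  exact (three hk hh hkh uk uh hf zf).resolve_right fh ▸ ef

theorem Cut.no_cross (hst : Δ.Strong) (hc : Cor Δ X Y Z) (ha : Cut Δ X Y Z a)
    (hb : Cut Δ Z Y X b) (h : ft b X Z < ft a X Z) (hβ : β ∈ Δ.B) (hX : X ∈ β)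
    (ht : Cut Δ Y X Z t) : ¬ (t ∩ a).Nonempty := by
  intro hm
  have hc' := hc.perm.2.2.1
  have h1 := ha.swap.lt_of_meet hc' ht.swap hm
  have key : ¬ Enters Δ ![X, foot a X Y, foot a X Z] ![a, segment ℝ X Z, segment ℝ X Y]
      (foot a X Y) := by
    rintro ⟨β, hβ, hd, x, hx, hI⟩
    have h0 : 0 < ln a X * ln a x := hI 0
    have hxd : x ≠ foot a X Y := by
      rintro rfl
      rw [ln_of_mem (Or.inl ha.1) (foot_mem hc' ha.acrossY), mul_zero] at h0
      exact lt_irrefl _ h0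
    linarith [ha.swap.lean_off hst hc' ht.swap h1 hβ hd hx hxd, mul_comm (ln a X) (ln a x)]
  refine (ha.tri3 hc).parity 0 (fun i hi => ?_) (ha.corner_enters hc hβ hX)
  fin_cases i
  exacts [absurd rfl hi, key, ha.foot_not_enters hst hc hb h]

/-- No blocking segment passes through a corner next to a crossing pair of opposite kinds. -/
theorem corner_unblocked (hst : Δ.Strong) (hc : Cor Δ X Y Z) (ha : Cut Δ X Y Z a)
    (hb : Cut Δ Z Y X b) (h : ft b X Z < ft a X Z) : ∀ β ∈ Δ.B, X ∉ β := by
  intro β₀ hβ₀ hX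
  obtain ⟨a, b, ha, hb, h, hadj, hone, hone'⟩ := exists_extremal hst hc ha hb h
  have hc' := hc.perm.2.2.1
  have hbA := across_symm hb.acrossZ
  have ha' : a ∈ Δ.Sbar := Or.inl ha.1
  have hb' : b ∈ Δ.Sbar := Or.inl hb.1
  have hab := ha.ne hb
  obtain ⟨c, cb, ca⟩ := ha.meet hc hb h
  have hκ := hc'.e12
  have hμ := hc.e12
  have hκ' := edge_mem_Sbar hκ
  have hμ' := edge_mem_Sbar hμ
  have hcκ := not_edge_of_S ha.1 hb.1 hab ca cb hκ
  have hcμ := not_edge_of_S ha.1 hb.1 hab ca cb hμ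
  have a₁a := foot_mem hc' ha.acrossY
  have a₁μ := foot_seg ha.2.1
  have a₂a := foot_mem hc ha.acrossZ
  have a₂κ := foot_seg ha.2.2
  have b₁b := foot_mem hc hbA
  have b₁κ := foot_seg hbA.2
  obtain ⟨u2, u1⟩ := triangle_uns hst ha.1 hb.1 hκ' hab ca cb a₂a a₂κ b₁b b₁κ hcκ
    (hadj.symm.uns hc ha.acrossZ hbA)
  have ua : Uns Δ c (foot a X Y) := by
    intro t ht
    by_contra hlt
    obtain ⟨z, zt, za, hz⟩ := exists_btw ha' ht ca a₁a (not_le.1 hlt)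
    have htS := S_of_sep ht (Sbar_sub ha' ca) (Sbar_sub ha' a₁a) (not_le.1 hlt)
    have hne : t ≠ a := by
      rintro rfl
      simp [ln_of_mem ha' ca] at hlt
    rcases cut_cases hc htS with k | k | k
    · exact hne (hone t k ⟨z, zt, za⟩)
    · exact ha.no_cross hst hc hb h hβ₀ hX k ⟨z, zt, za⟩
    · rw [hone' t k ⟨z, zt, za⟩, ln_of_mem hb' cb, zero_mul] at hlt
      exact hlt le_rfl
  have sa : 0 < ln a X * ln a (foot b X Z) := foot_lt ha.2.2 h
  have sb : ln b X * ln b (foot a X Z) < 0 := foot_gt hbA.2 h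
  have sb' : 0 < ln b X * ln b (foot a X Y) :=
    (foot_btw ha.2.1).pos1 (mul_self_pos.2 (hc.ln_ne hb.1)) (nn hb.2.2 hb.2.1).le
  obtain ⟨β, hβ, hd⟩ := blk_ex ha.1 hb' hab ca cb
  have hb0 : ln b (foot a X Z) ≠ 0 := fun q => by simp [q] at sb
  have ha0 : ln a (foot b X Z) ≠ 0 := fun q => by simp [q] at sa
  obtain ⟨x, hx, y, hy, hxd, hyd, x1, x2, y1, y2⟩ := blk_turn hβ hd ha.1 hb.1 hab ca cb hb0 ha0
    (fun x hx q1 q2 => tri_block ha' hb' hκ' ca cb a₂a a₂κ b₁b b₁κ u2 u1 hβ hd hx q1 q2)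
  have xa : 0 < ln a X * ln a x := by
    nlinarith [ppos (a := ln a (foot b X Z)) (b := ln a X) (c := ln a x) (by linarith) (by linarith)]
  have xb : 0 < ln b X * ln b x := nn (a := ln b (foot a X Z)) (by linarith) (by linarith)
  -- the other end of the blocking segment lies on one of the sides at `X`
  obtain ⟨e, heβ, heb, hea, hebd⟩ : ∃ e ∈ β, e ∈ Δ.bdry ∧ 0 < ln a X * ln a e ∧
      0 < ln b X * ln b e := by
    by_cases hxb : x ∈ Δ.bdry
    · exact ⟨x, hx, hxb, xa, xb⟩
    · obtain ⟨τ, hτ, h1, h2⟩ := blk_extend hβ hd hx hxd.symm hxb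
      refine ⟨_, h1, h2, ?_, ?_⟩
      · rw [ln_mv, ln_of_mem ha' ca]; nlinarith
      · rw [ln_mv, ln_of_mem hb' cb]; nlinarith
  have hed : e ≠ c := by rintro rfl; rw [ln_of_mem ha' ca, mul_zero] at hea; exact lt_irrefl _ hea
  obtain ⟨p, hp, hpβ, n1, n2⟩ := near hβ hd heβ hed
  have hcR : c ∈ R Δ p := near_mem n1 n2 (fun _ _ => mul_self_nonneg _) ha' hb' hab ca cb
    (by rw [ln_of_mem ha' ca, mul_zero]) (by rw [ln_of_mem hb' cb, mul_zero])
  have a₁R : foot a X Y ∈ R Δ p := near_mem n1 n2 ua ha' hb' hab ca cb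
    (by rw [ln_of_mem ha' a₁a, mul_zero]) (ppos hebd sb').le
  have b₁R : foot b X Z ∈ R Δ p := near_mem n1 n2 u1 ha' hb' hab ca cb
    (ppos hea sa).le (by rw [ln_of_mem hb' b₁b, mul_zero])
  have a₁c : foot a X Y ≠ c := fun q => hcμ (q ▸ a₁μ)
  have b₁c : foot b X Z ≠ c := fun q => hcκ (q ▸ b₁κ)
  have heμ : e ∈ segment ℝ X Y ∧ e ∈ segment ℝ X Z := by
    have k1 : e ∈ segment ℝ X Z → e ∈ segment ℝ X Y := fun q =>
      face_step hst hb' hκ' ha' hμ' hab.symm (S_ne_edge hb.1 hκ) (S_ne_edge ha.1 hμ).symm hp hβ hd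
        hpβ hcR cb ca b₁R b₁c b₁b b₁κ a₁R a₁c a₁a a₁μ heβ q
    have k2 : e ∈ segment ℝ X Y → e ∈ segment ℝ X Z := fun q =>
      face_step hst ha' hμ' hb' hκ' hab (S_ne_edge ha.1 hμ) (S_ne_edge hb.1 hκ).symm hp hβ hd
        hpβ hcR ca cb a₁R a₁c a₁a a₁μ b₁R b₁c b₁b b₁κ heβ q
    have k3 : e ∉ segment ℝ Y Z := fun q => by
      have := (half_convex a (-ln a X)).segment_subset (x := Y) (y := Z)
        (by simpa [mem_ofPred_eq] using ha.2.1.le) (by simpa [mem_ofPred_eq] using ha.2.2.le) q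
      rw [mem_ofPred_eq] at this
      linarith
    rw [bdry, hc.bd] at heb
    rcases heb with (q | q) | q
    · exact ⟨q, k2 q⟩
    · exact absurd q k3
    · rw [segment_symm] at q
      exact ⟨k1 q, q⟩
  have heX : e = X := inter_unique hμ' hκ' hc.edge_ne heμ.1 heμ.2 (left_mem_segment ℝ X Y)
    (left_mem_segment ℝ X Z)
  subst heX
  -- hence the segment also meets the opposite region, which forces `XY` to meet `b`
  obtain ⟨q, hq, hqβ, m1, m2⟩ := near hβ hd hy hyd
  have hcR' : c ∈ R Δ q := near_mem m1 m2 (fun _ _ => mul_self_nonneg _) ha' hb' hab ca cb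
    (by rw [ln_of_mem ha' ca, mul_zero]) (by rw [ln_of_mem hb' cb, mul_zero])
  have a₂R : foot a e Z ∈ R Δ q := near_mem m1 m2 u2 ha' hb' hab ca cb
    (by rw [ln_of_mem ha' a₂a, mul_zero]) y1.le
  obtain ⟨z, -, -, zb, f, hf, -, fκ, zf, ef⟩ := forced hst ha' hκ' hb' hab (S_ne_edge ha.1 hκ) hq
    hβ hd hqβ hcR' ca cb a₂R (fun q => hcκ (q ▸ a₂κ)) a₂a a₂κ heβ heμ.2
  have hfμ := (three hμ' hκ' hc.edge_ne heμ.1 heμ.2 hf ef).resolve_right fκ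
  subst hfμ
  obtain ⟨τ, h0, h1, rfl⟩ := mem_seg.1 zf
  have hz := ln_of_mem hb' zb
  rw [ln_mv] at hz
  have hp1 : 0 < ln b e * ln b Y := nn hb.2.2 hb.2.1
  have hp2 : 0 < ln b e * ln b e := mul_self_pos.2 (hc.ln_ne hb.1)
  rcases h0.eq_or_lt with rfl | h0
  · nlinarith
  · nlinarith [mul_pos h0 hp1, mul_nonneg (sub_nonneg.2 h1) hp2.le, congrArg (ln b e * ·) hz]

end TBA

namespace TBA

variable {Δ : TBA} {X Y Z : Pt} {s s' t β β' a b : Set Pt} {x y z u w v p d : Pt}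

theorem interior_pos (hs : s ∈ Δ.Sbar) {K : Set Pt} {k : ℝ} (hk : k ≠ 0)
    (hK : ∀ y ∈ K, 0 ≤ k * ln s y) (hx : x ∈ interior K) : 0 < k * ln s x := by
  refine lt_of_le_of_ne (hK x (interior_subset hx)) fun h0 => ?_
  have h1 : ln s x = 0 := (mul_eq_zero.1 h0.symm).resolve_left hk
  obtain ⟨u, hu⟩ := ln_nonzero hs
  have hcont : Continuous fun r : ℝ => mv x u r := by
    simp only [mv_eq_smul]
    fun_prop
  have hnear : ∀ᶠ r in nhds (0 : ℝ), mv x u r ∈ K := by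
    have := hcont.tendsto 0
    rw [show mv x u 0 = x by simp [mv_eq_smul]] at this
    exact this (mem_interior_iff_mem_nhds.1 hx)
  obtain ⟨ε, hε, hball⟩ := Metric.eventually_nhds_iff.1 hnear
  have key : ∀ r, |r| < ε → 0 ≤ r * (k * ln s u) := fun r hr => by
    have := hK _ (hball (y := r) (by simpa using hr))
    rw [ln_mv, h1] at this
    linarith
  have e1 := key (ε / 2) (by rw [abs_of_pos (by linarith)]; linarith)
  have e2 := key (-(ε / 2)) (by rw [abs_neg, abs_of_pos (by linarith)]; linarith)
  exact mul_ne_zero hk hu (by nlinarith)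

theorem hull_nonneg {K : Set Pt} {k : ℝ} (h : ∀ y ∈ K, 0 ≤ k * ln s y) :
    ∀ y ∈ convexHull ℝ K, 0 ≤ k * ln s y := fun _ hy =>
  convexHull_min (t := {y | 0 ≤ k * ln s y}) h (half_convex s k) hy

theorem cr_sign (hs : s ∈ Δ.Sbar) (hu : u ∈ s) (hv : v ∈ s) (huv : u ≠ v)
    (h : 0 < ln s x * ln s y) : 0 < cr u v x * cr u v y := by
  obtain ⟨k, -, e⟩ := ln_eq_cr' hs huv (ln_of_mem hs hu) (ln_of_mem hs hv)
  rw [e, e] at h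
  by_contra hh
  nlinarith [mul_self_nonneg k, mul_nonneg (mul_self_nonneg k) (neg_nonneg.2 (not_lt.1 hh))]

theorem mem_tri_of_signs {A B C x : Pt} (h1 : 0 < cr A B C * cr A B x)
    (h2 : 0 < cr B C A * cr B C x) (h3 : 0 ≤ cr C A B * cr C A x) :
    x ∈ convexHull ℝ {A, B, C} := by
  have hne : cr A B C ≠ 0 := fun q => by simp [q] at h1
  rw [cr_cyc] at h2
  rw [cr_cyc B C A, cr_cyc A B C] at h3
  exact (hull_cr hne).2 ⟨h1.le, h2.le, h3⟩

/-- The points on the side of `Y` of two crossing segments around `X` and `Z` are interior points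
of the quadrilateral cut off by them. -/
theorem mem_interior_quad (hc : Cor Δ X Y Z) (ha : Cut Δ X Y Z a) (hb : Cut Δ Z Y X b)
    {c : Pt} (ca : c ∈ a) (cb : c ∈ b) (hp : Gen Δ p) (h1 : 0 < ln a Y * ln a p)
    (h2 : 0 < ln b Y * ln b p) :
    p ∈ interior (convexHull ℝ {foot a X Y, c, foot b Z Y, Y}) := by
  have hc' := hc.perm.2.2.1
  have hr := hc.perm.2.2.2.2
  have ha' : a ∈ Δ.Sbar := Or.inl ha.1
  have hb' : b ∈ Δ.Sbar := Or.inl hb.1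
  have hab := ha.ne hb
  have hμ := hc.e12
  have hν := hc.perm.2.1.e12
  have hμ' := edge_mem_Sbar hμ
  have hν' := edge_mem_Sbar hν
  have hcμ := not_edge_of_S ha.1 hb.1 hab ca cb hμ
  have hcν := not_edge_of_S ha.1 hb.1 hab ca cb hν
  have a₁a := foot_mem hc' ha.acrossY
  have a₁μ := foot_seg ha.2.1
  have b₂b := foot_mem hr hb.acrossY
  have b₂ν := foot_seg hb.2.1
  have hcT := Sbar_sub ha' ca
  have key : ∀ {κ}, κ ∈ triEdges Δ.x1 Δ.x2 Δ.x3 → p ∉ κ := fun hκ h =>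
    hp.2 _ (edge_mem_Sbar hκ) (ln_of_mem (edge_mem_Sbar hκ) h)
  let U : Set Pt := {x | 0 < ln a Y * ln a x ∧ 0 < ln b Y * ln b x ∧
    0 < ln (segment ℝ X Y) c * ln (segment ℝ X Y) x ∧
    0 < ln (segment ℝ Z Y) c * ln (segment ℝ Z Y) x}
  have hU : IsOpen U := by
    have := fun s k => isOpen_lt continuous_const (continuous_const.mul (ln_continuous s))
      (f := fun _ => (0 : ℝ)) (g := fun x => k * ln s x)
    exact (this _ _).inter ((this _ _).inter ((this _ _).inter (this _ _)))
  have hpU : p ∈ U := ⟨h1, h2, edge_pos hμ hcT hp.1 hcμ (key hμ), edge_pos hν hcT hp.1 hcν (key hν)⟩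
  refine interior_maximal (fun x hx => ?_) hU hpU
  obtain ⟨k1, k2, k3, k4⟩ := hx
  have hYa : Y ∉ a := hc.rot.not_mem ha.1
  have a₁Y : foot a X Y ≠ Y := fun q => hYa (q ▸ a₁a)
  have b₂Y : foot b Z Y ≠ Y := fun q => hc.rot.not_mem hb.1 (q ▸ b₂b)
  have a₁c : foot a X Y ≠ c := fun q => hcμ (q ▸ a₁μ)
  have b₂c : foot b Z Y ≠ c := fun q => hcν (q ▸ b₂ν)
  have Yμ := right_mem_segment ℝ X Y
  have Yν := right_mem_segment ℝ Z Y
  have e1 := cr_sign ha' a₁a ca a₁c k1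
  have e2 := cr_sign hb' cb b₂b b₂c.symm k2
  have e3 := cr_sign hμ' Yμ a₁μ a₁Y.symm k3
  have e4 := cr_sign hν' b₂ν Yν b₂Y k4
  have hopp : cr c Y (foot a X Y) * cr c Y (foot b Z Y) < 0 := by
    obtain ⟨m1, m2, -⟩ := hc.mem.1 hcT
    have n1 : cr X Y c ≠ 0 := fun q => hcμ (hc.on_line hcT q)
    have n2 : cr Y Z c ≠ 0 := fun q => hcν (segment_symm ℝ Y Z ▸ hc.rot.on_line hcT q)
    have m3 := ppos (lt_of_le_of_ne m1 (mul_ne_zero hc.ne n1).symm)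
      (lt_of_le_of_ne m2 (mul_ne_zero hc.ne n2).symm)
    obtain ⟨-, f1⟩ := ft_pos ha.2.1
    obtain ⟨-, f2⟩ := ft_pos hb.2.1
    rw [foot, foot, cr_aff, cr_aff, cr_self_right, show cr c Y X = - cr X Y c by
      rw [← cr_cyc, ← cr_swap], show cr c Y Z = cr Y Z c from (cr_cyc c Y Z).symm]
    nlinarith [mul_pos (mul_pos (sub_pos.2 f1) (sub_pos.2 f2)) m3]
  by_cases hx : 0 ≤ cr c Y (foot a X Y) * cr c Y x
  · refine convexHull_mono ?_ (mem_tri_of_signs (A := Y) (B := foot a X Y) (C := c) e3 e1 hx)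
    simp only [insert_subset_iff, singleton_subset_iff, mem_insert_iff, mem_singleton_iff]
    tauto
  · refine convexHull_mono ?_ (mem_tri_of_signs (A := c) (B := foot b Z Y) (C := Y) e2 e4 ?_)
    · simp only [insert_subset_iff, singleton_subset_iff, mem_insert_iff, mem_singleton_iff]
      tauto
    · rw [cr_swap c Y, cr_swap c Y]
      have := nn hopp (not_le.1 hx)
      linarith

end TBA

namespace TBA

variable {Δ : TBA} {X Y Z : Pt} {s s' t β β' a b : Set Pt} {x y z u w v p d : Pt}

/-- Two segments around `X` and `Z` whose feet on `XZ` are ordered so that they cross. -/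
structure Crossing (Δ : TBA) (X Y Z : Pt) (a b : Set Pt) : Prop where
  strong : Δ.Strong
  cor : Cor Δ X Y Z
  left : Cut Δ X Y Z a
  right : Cut Δ Z Y X b
  lt : ft b X Z < ft a X Z

namespace Crossing

theorem symm (h : Crossing Δ X Y Z a b) : Crossing Δ Z Y X b a where
  strong := h.strong
  cor := h.cor.perm.2.1
  left := h.right
  right := h.left
  lt := by
    rw [ft_symm h.left.2.2, ft_symm (across_symm h.right.acrossZ).2]
    linarith [h.lt]

theorem not_mem_left (h : Crossing Δ X Y Z a b) : ∀ β ∈ Δ.B, X ∉ β :=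
  corner_unblocked h.strong h.cor h.left h.right h.lt

theorem not_lean (h : Crossing Δ X Y Z a b) (hβ : β ∈ Δ.B) (hd : foot a X Z ∈ β) (hx : x ∈ β) :
    ln a X * ln a x ≤ 0 := by
  by_cases hxd : x = foot a X Z
  · rw [hxd, ln_of_mem (Or.inl h.left.1) (foot_mem h.cor h.left.acrossZ), mul_zero]
  · rw [mul_comm]
    exact (h.left.lean_off h.strong h.cor h.right h.lt hβ hd hx hxd).le

theorem quad_side (h : Crossing Δ X Y Z a b) {c : Pt} (ca : c ∈ a) :
    ∀ y ∈ convexHull ℝ {foot a X Y, c, foot b Z Y, Y}, 0 ≤ ln a Y * ln a y := by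
  refine hull_nonneg ?_
  have hc := h.cor
  rintro y (rfl | rfl | rfl | rfl)
  · rw [ln_of_mem (Or.inl h.left.1) (foot_mem hc.perm.2.2.1 h.left.acrossY), mul_zero]
  · rw [ln_of_mem (Or.inl h.left.1) ca, mul_zero]
  · have h1 := nn h.left.2.1 h.left.2.2
    exact ((foot_btw h.right.2.1).pos1 h1 (mul_self_nonneg _)).le
  · exact mul_self_nonneg _

theorem foot_blocked (h : Crossing Δ X Y Z a b) {c : Pt} (ca : c ∈ a) (cb : c ∈ b) :
    Δ.InternallyBlocked (convexHull ℝ {foot a X Y, c, foot b Z Y, Y}) (foot a X Y) := by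
  have hc := h.cor
  have hc' := hc.perm.2.2.1
  have ha := h.left
  have a₁a := foot_mem hc' ha.acrossY
  have a₁μ := foot_seg ha.2.1
  have hμ := hc.e12
  have ha' : a ∈ Δ.Sbar := Or.inl ha.1
  obtain ⟨β, hβ, hd⟩ := blk_ex ha.1 hc.b12 (S_ne_edge ha.1 hμ) a₁a a₁μ
  obtain ⟨x, hx, hxd⟩ := blk_ne hβ (foot a X Y)
  obtain ⟨p, hp, hpβ, n1, n2⟩ := near hβ hd hx hxd
  have key : ∀ {κ}, κ ∈ triEdges Δ.x1 Δ.x2 Δ.x3 → p ∉ κ := fun hκ h =>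
    hp.2 _ (edge_mem_Sbar hκ) (ln_of_mem (edge_mem_Sbar hκ) h)
  have hne : ¬ Enters Δ ![X, foot a X Y, foot a X Z] ![a, segment ℝ X Z, segment ℝ X Y]
      (foot a X Y) := by
    refine (ha.tri3 hc).parity 1 fun i hi => ?_
    fin_cases i
    · rintro ⟨β, hβ, hX, -⟩
      exact h.not_mem_left β hβ hX
    · exact absurd rfl hi
    · exact ha.foot_not_enters h.strong hc h.right h.lt
  have hpX : ln a X * ln a p < 0 := by
    refine lt_of_le_of_ne (not_lt.1 fun hpos => hne ⟨β, hβ, hd, p, hpβ, fun i => ?_⟩)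
      (mul_ne_zero (hc.ln_ne ha.1) (hp.2 a ha'))
    fin_cases i
    · exact hpos
    · exact edge_pos hc'.e12 (foot_tri hc' ha.2.1) hp.1 (ha.foot_not_mem hc) (key hc'.e12)
    · exact edge_pos hμ (foot_tri hc ha.2.2) hp.1 (ha.swap.foot_not_mem hc') (key hμ)
  have hb' : b ∈ Δ.Sbar := Or.inl h.right.1
  have a₁b : foot a X Y ∉ b := fun q =>
    S_inter_not_bdry ha.1 h.right.1 (ha.ne h.right) a₁a q (mem_bdry.2 ⟨_, hμ, a₁μ⟩)
  have hbY : 0 < ln b Y * ln b (foot a X Y) :=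
    (foot_btw ha.2.1).pos2 (nn h.right.2.1 h.right.2.2).le (mul_self_pos.2 (hc.rot.ln_ne h.right.1))
  refine ⟨β, hβ, hd, p, hpβ, mem_interior_quad hc ha h.right ca cb hp (nn ha.2.1 hpX) ?_⟩
  exact ppos ((mul_comm _ _).trans_gt hbY) ((mul_comm _ _).trans_gt (n2 b hb' a₁b))

end Crossing

end TBA

namespace TBA

variable {Δ : TBA} {X Y Z : Pt} {s s' t β β' a b : Set Pt} {x y z u w v p d : Pt}

theorem Cor.tri3 (hc : Cor Δ X Y Z) :
    Tri3 Δ ![X, Y, Z] ![segment ℝ Y Z, segment ℝ X Z, segment ℝ X Y] where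
  hs := by
    intro i; fin_cases i
    exacts [hc.rot.b12, hc.perm.2.2.1.b12, hc.b12]
  on := by
    intro i j h
    fin_cases i <;> fin_cases j
    exacts [absurd rfl h, left_mem_segment ℝ Y Z, right_mem_segment ℝ Y Z,
      left_mem_segment ℝ X Z, absurd rfl h, right_mem_segment ℝ X Z,
      left_mem_segment ℝ X Y, right_mem_segment ℝ X Y, absurd rfl h]
  off := by
    have key : ∀ {X Y Z}, Cor Δ X Y Z → ln (segment ℝ X Y) Z ≠ 0 := fun h => by
      obtain ⟨k, hk, e⟩ := h.ln_edge
      rw [e]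
      exact mul_ne_zero hk h.ne
    intro i; fin_cases i
    exacts [key hc.rot, key hc.perm.2.2.1, key hc]

namespace Crossing

theorem apex_not_blocked (h : Crossing Δ X Y Z a b) {K : Set Pt} (hK : K ⊆ Δ.tri) :
    ¬ Δ.InternallyBlocked K Y := by
  rintro ⟨β, hβ, hY, x, hx, hxK⟩
  refine h.cor.tri3.parity 1 (fun i hi => ?_) ⟨β, hβ, hY, x, hx, fun i => ?_⟩
  · fin_cases i
    · rintro ⟨β, hβ, hX, -⟩
      exact h.not_mem_left β hβ hX
    · exact absurd rfl hi
    · rintro ⟨β, hβ, hZ, -⟩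
      exact h.symm.not_mem_left β hβ hZ
  · refine interior_pos (h.cor.tri3.hs i) (h.cor.tri3.off i) (fun y hy => ?_) hxK
    fin_cases i
    · exact edge_sign h.cor.rot.e12 h.cor.mem_tri (hK hy)
    · exact edge_sign h.cor.perm.2.2.1.e12 h.cor.rot.mem_tri (hK hy)
    · exact edge_sign h.cor.e12 h.cor.rot.rot.mem_tri (hK hy)

theorem base_not_blocked (h : Crossing Δ X Y Z a b) {c : Pt} (ca : c ∈ a) :
    ¬ Δ.InternallyBlocked (convexHull ℝ {c, foot b X Z, foot a X Z}) (foot a X Z) := by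
  rintro ⟨β, hβ, hd, x, hx, hxK⟩
  refine absurd (interior_pos (Or.inl h.left.1) (h.cor.ln_ne h.left.1) (hull_nonneg ?_) hxK)
    (not_lt.2 (h.not_lean hβ hd hx))
  rintro y (rfl | rfl | rfl)
  · rw [ln_of_mem (Or.inl h.left.1) ca, mul_zero]
  · exact (foot_lt h.left.2.2 h.lt).le
  · rw [ln_of_mem (Or.inl h.left.1) (foot_mem h.cor h.left.acrossZ), mul_zero]

theorem tri3 (h : Crossing Δ X Y Z a b) {c : Pt} (ca : c ∈ a) (cb : c ∈ b) :
    Tri3 Δ ![c, foot b X Z, foot a X Z] ![segment ℝ X Z, a, b] where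
  hs := by
    intro i; fin_cases i
    exacts [h.cor.perm.2.2.1.b12, Or.inl h.left.1, Or.inl h.right.1]
  on := by
    intro i j hij
    fin_cases i <;> fin_cases j
    exacts [absurd rfl hij, foot_seg (across_symm h.right.acrossZ).2, foot_seg h.left.2.2,
      ca, absurd rfl hij, foot_mem h.cor h.left.acrossZ,
      cb, foot_mem h.cor (across_symm h.right.acrossZ), absurd rfl hij]
  off := by
    intro i; fin_cases i
    · exact fun q => not_edge_of_S h.left.1 h.right.1 (h.left.ne h.right) ca cb
        h.cor.perm.2.2.1.e12 (mem_of_ln h.cor.perm.2.2.1.b12 (Sbar_sub (Or.inl h.left.1) ca) q)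
    · exact right_ne_zero_of_mul (foot_lt h.left.2.2 h.lt).ne'
    · exact right_ne_zero_of_mul (foot_gt (across_symm h.right.acrossZ).2 h.lt).ne

theorem cross_not_blocked (h : Crossing Δ X Y Z a b) {c : Pt} (ca : c ∈ a) (cb : c ∈ b) :
    ¬ Δ.InternallyBlocked (convexHull ℝ {foot a X Y, c, foot b Z Y, Y}) c := by
  rintro ⟨β, hβ, hd, x, hx, hxK⟩
  have ha' : a ∈ Δ.Sbar := Or.inl h.left.1
  have hb' : b ∈ Δ.Sbar := Or.inl h.right.1
  have hbA := across_symm h.right.acrossZ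
  have h1 := interior_pos ha' (h.cor.rot.ln_ne h.left.1) (h.quad_side ca) hxK
  have h2 := interior_pos hb' (h.cor.rot.ln_ne h.right.1) (fun y hy => h.symm.quad_side cb y
    (by convert hy using 2; simp only [insert_comm])) hxK
  have hxc : x ≠ c := by
    rintro rfl
    rw [ln_of_mem ha' ca, mul_zero] at h1
    exact lt_irrefl _ h1
  have hcb := S_inter_not_bdry h.left.1 h.right.1 (h.left.ne h.right) ca cb
  obtain ⟨y, hy, hyc, hys⟩ := blk_opp hβ hd hcb hx hxc
  obtain ⟨p, hp, hpβ, n1, n2⟩ := near hβ hd hy hyc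
  have hκ := h.cor.perm.2.2.1.b12
  have hcκ := not_edge_of_S h.left.1 h.right.1 (h.left.ne h.right) ca cb h.cor.perm.2.2.1.e12
  have a1 : 0 < ln a X * ln a (foot b X Z) := foot_lt h.left.2.2 h.lt
  have b1 : ln b X * ln b (foot a X Z) < 0 := foot_gt hbA.2 h.lt
  refine (h.tri3 ca cb).parity 0 (fun i hi => ?_) ⟨β, hβ, hd, p, hpβ, fun i => ?_⟩
  · fin_cases i
    · exact absurd rfl hi
    · rintro ⟨β, hβ, hd, x, hx, hI⟩
      have e : 0 < ln b (foot a X Z) * ln b x := hI 2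
      have e1 := h.symm.not_lean hβ (by rwa [foot_symm hbA.2]) hx
      have e2 := nn b1 ((mul_comm _ _).trans_lt h.right.2.2)
      have := ppos e2 e
      linarith
    · rintro ⟨β, hβ, hd, x, hx, hI⟩
      have e : 0 < ln a (foot b X Z) * ln a x := hI 1
      have := ppos (a := ln a (foot b X Z)) (b := ln a X) (c := ln a x)
        (by linarith [mul_comm (ln a X) (ln a (foot b X Z))]) e
      linarith [h.not_lean hβ hd hx]
  · fin_cases i
    · exact (mul_comm _ _).trans_gt (n2 _ hκ hcκ)
    · have e1 := hys a ha' ca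
      have e2 := n1 a ha' ca
      have e3 := npos (a := ln a x) (b := ln a Y) (by linarith [mul_comm (ln a x) (ln a Y)]) e1
      have e4 := nn (b := ln a X) (by linarith [h.left.2.1, mul_comm (ln a X) (ln a Y)]) e3
      have e5 := ppos (b := ln a X) (c := ln a p) (a := ln a y) (by linarith) (by linarith)
      exact ppos a1 e5
    · have e1 := hys b hb' cb
      have e2 := n1 b hb' cb
      have e3 := npos (a := ln b x) (b := ln b Y) (by linarith [mul_comm (ln b x) (ln b Y)]) e1
      have e4 := nn h.right.2.2 h.right.2.1
      have e5 := npos e4 b1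
      have e6 := nn e3 e5
      have e7 := ppos (a := ln b y) (c := ln b p) e6 (by linarith)
      exact e7

end Crossing

end TBA

/-- Lemma 11: if proper initial segments `a₁a₂` (from `x₁x₂` to `x₁x₃`) and `b₁b₂`
(from `x₁x₃` to `x₂x₃`) of a strong triangle blocking arrangement intersect at `c`,
then in the quadrilateral region `Q = a₁ c b₂ x₂` the vertices `c, x₂` are externally
blocked and `a₁, b₂` are internally blocked; moreover no blocking segment passes through
`x₁` or `x₃`, and in the triangular region `Q' = c b₁ a₂` the vertices `a₂, b₁` are
externally blocked. -/
theorem TBA.triangular_blocks (Δ : TBA) (hstrong : Δ.Strong)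
    (a₁ a₂ b₁ b₂ c : Pt)
    (ha₁ : a₁ ∈ segment ℝ Δ.x1 Δ.x2) (ha₂ : a₂ ∈ segment ℝ Δ.x1 Δ.x3)
    (hb₁ : b₁ ∈ segment ℝ Δ.x1 Δ.x3) (hb₂ : b₂ ∈ segment ℝ Δ.x2 Δ.x3)
    (hA : segment ℝ a₁ a₂ ∈ Δ.S) (hB : segment ℝ b₁ b₂ ∈ Δ.S)
    (hc : c ∈ segment ℝ a₁ a₂ ∩ segment ℝ b₁ b₂)
    (Q Q' : Set Pt)
    (hQreg : Δ.IsRegion Q) (hQ : Q = convexHull ℝ {a₁, c, b₂, Δ.x2})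
    (hQ'reg : Δ.IsRegion Q') (hQ' : Q' = convexHull ℝ {c, b₁, a₂}) :
    ¬ Δ.InternallyBlocked Q c ∧ ¬ Δ.InternallyBlocked Q Δ.x2 ∧
    Δ.InternallyBlocked Q a₁ ∧ Δ.InternallyBlocked Q b₂ ∧
    (∀ b ∈ Δ.B, Δ.x1 ∉ b) ∧ (∀ b ∈ Δ.B, Δ.x3 ∉ b) ∧
    ¬ Δ.InternallyBlocked Q' a₂ ∧ ¬ Δ.InternallyBlocked Q' b₁ := by
  have hT := TBA.cor_base Δ
  have hT' := hT.perm.2.2.2.2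
  have ha₁S := left_mem_segment ℝ a₁ a₂
  have ha₂S := right_mem_segment ℝ a₁ a₂
  have hb₁S := left_mem_segment ℝ b₁ b₂
  have hb₂S := right_mem_segment ℝ b₁ b₂
  obtain ⟨hA2, e₁⟩ := TBA.exists_foot hT.perm.2.2.1 hA ha₁S ha₁
  obtain ⟨hA3, e₂⟩ := TBA.exists_foot hT hA ha₂S ha₂
  obtain ⟨hB1, f₁⟩ := TBA.exists_foot hT hB hb₁S hb₁
  obtain ⟨hB2, f₂⟩ := TBA.exists_foot hT' hB hb₂S (segment_symm ℝ Δ.x2 Δ.x3 ▸ hb₂)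
  have left : TBA.Cut Δ Δ.x1 Δ.x2 Δ.x3 (segment ℝ a₁ a₂) := ⟨hA, hA2.2, hA3.2⟩
  have right : TBA.Cut Δ Δ.x3 Δ.x2 Δ.x1 (segment ℝ b₁ b₂) :=
    ⟨hB, hB2.2, (TBA.across_symm hB1).2⟩
  have K : TBA.Crossing Δ Δ.x1 Δ.x2 Δ.x3 (segment ℝ a₁ a₂) (segment ℝ b₁ b₂) :=
    ⟨hstrong, hT, left, right, left.lt_of_meet hT right ⟨c, hc.2, hc.1⟩⟩
  have hQ₀ : Q ⊆ Δ.tri := by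
    rw [hQ]
    refine convexHull_min ?_ (TBA.tri_convex Δ)
    rintro y (rfl | rfl | rfl | rfl)
    · exact TBA.Sbar_sub (Or.inl hA) ha₁S
    · exact TBA.Sbar_sub (Or.inl hA) hc.1
    · exact TBA.Sbar_sub (Or.inl hB) hb₂S
    · exact subset_convexHull ℝ _ (by simp)
  have hQ₁ : Q = convexHull ℝ
      {TBA.foot (segment ℝ a₁ a₂) Δ.x1 Δ.x2, c, TBA.foot (segment ℝ b₁ b₂) Δ.x3 Δ.x2, Δ.x2} := by
    rw [hQ, ← e₁, ← f₂]
  have hQ₂ : Q = convexHull ℝ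
      {TBA.foot (segment ℝ b₁ b₂) Δ.x3 Δ.x2, c, TBA.foot (segment ℝ a₁ a₂) Δ.x1 Δ.x2, Δ.x2} := by
    rw [hQ₁]; congr 1; simp only [insert_comm]
  have hQ₁' : Q' = convexHull ℝ
      {c, TBA.foot (segment ℝ b₁ b₂) Δ.x1 Δ.x3, TBA.foot (segment ℝ a₁ a₂) Δ.x1 Δ.x3} := by
    rw [hQ', ← e₂, ← f₁]
  have hQ₂' : Q' = convexHull ℝ
      {c, TBA.foot (segment ℝ a₁ a₂) Δ.x3 Δ.x1, TBA.foot (segment ℝ b₁ b₂) Δ.x3 Δ.x1} := by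
    rw [hQ₁', TBA.foot_symm hA3.2, TBA.foot_symm hB1.2, pair_comm]
  refine ⟨hQ₁ ▸ K.cross_not_blocked hc.1 hc.2, K.apex_not_blocked hQ₀, ?_, ?_,
    K.not_mem_left, K.symm.not_mem_left, ?_, ?_⟩
  · have h := K.foot_blocked hc.1 hc.2
    rwa [← hQ₁, ← e₁] at h
  · have h := K.symm.foot_blocked hc.2 hc.1
    rwa [← hQ₂, ← f₂] at h
  · have h := K.base_not_blocked hc.1
    rwa [← hQ₁', ← e₂] at h
  · have h := K.symm.base_not_blocked hc.2
    rwa [← hQ₂', TBA.foot_symm hB1.2, ← f₁] at h
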